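/- Let A be a real symmetric positive definite 3×3 matrix, Q(x) = xᵀAx, and assume that for every ε > 0 there is C_ε with #{x ∈ ℤ³ : |√(Q(x)) − λ| < δ} ≤ C_ε λ^{2+ε} δ for all λ > 1 and λ^{−1} < δ < 1. Let 2 ≤ p < ∞ and ε > 0. Then there exists C = C(A, p, ε) such that for all λ > 1 and 0 < δ < 1 with either (i) δ > λ^{−1/2}, or (ii) 4 < p ≤ 5 and δ > max(λ^{(p−6)/2}, λ^{(27p−316)/(104(p−2))}), the following holds: for every finitely supported a : ℤ³ → ℂ vanishing outside {k ∈ ℤ³ : |√(Q(k)) − λ| < δ}, one has ‖f‖_{L^p} ≤ C λ^{ε} ((λδ)^{1/2 − 1/p} + λ^{1 − 3/p} δ^{1/2}) ‖a‖_{ℓ²}. -/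

import Mathlib

open MeasureTheory

noncomputable def trigSum (a : (Fin 3 → ℤ) →₀ ℂ) (x : Fin 3 → ℝ) : ℂ :=
  ∑ k ∈ a.support, a k * Complex.exp (2 * Real.pi * Complex.I * ((∑ i, (k i : ℝ) * x i : ℝ) : ℂ))

noncomputable def lpNorm (p : ℝ) (a : (Fin 3 → ℤ) →₀ ℂ) : ℝ :=
  (∫ x in (Set.univ.pi fun _ : Fin 3 => Set.Icc (0:ℝ) 1), ‖trigSum a x‖ ^ p) ^ (1 / p)

noncomputable def l2Norm (a : (Fin 3 → ℤ) →₀ ℂ) : ℝ :=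
  (∑ k ∈ a.support, ‖a k‖ ^ 2) ^ ((1:ℝ) / 2)

noncomputable def Qform (A : Matrix (Fin 3) (Fin 3) ℝ) (x : Fin 3 → ℝ) : ℝ :=
  ∑ i, ∑ j, A i j * x i * x j

noncomputable section

/-- Frequencies. -/
abbrev Freq := Fin 3 → ℤ

/-- The character of frequency `k`. -/
def chr (k : Freq) (x : Fin 3 → ℝ) : ℂ :=
  Complex.exp (2 * Real.pi * Complex.I * ((∑ i, (k i : ℝ) * x i : ℝ) : ℂ))

/-- Mean over the unit cube. -/
def avg (f : (Fin 3 → ℝ) → ℝ) : ℝ :=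
  ∫ x in (Set.univ.pi fun _ : Fin 3 => Set.Icc (0:ℝ) 1), f x

/-- The trigonometric polynomial with coefficients `a` and frequencies in `I`. -/
def tp (a : Freq → ℂ) (I : Finset Freq) (x : Fin 3 → ℝ) : ℂ := ∑ k ∈ I, a k * chr k x

/-- The mass of `a` on `I`. -/
def mass (a : Freq → ℂ) (I : Finset Freq) : ℝ := ∑ k ∈ I, ‖a k‖ ^ 2

lemma mass_nonneg (a : Freq → ℂ) (I : Finset Freq) : 0 ≤ mass a I :=
  Finset.sum_nonneg fun _ _ => by positivity

lemma mass_mono (a : Freq → ℂ) {I J : Finset Freq} (h : I ⊆ J) : mass a I ≤ mass a J :=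
  Finset.sum_le_sum_of_subset_of_nonneg h fun _ _ _ => by positivity

@[fun_prop]
lemma continuous_chr (k : Freq) : Continuous (chr k) := by
  unfold chr; fun_prop

@[fun_prop]
lemma continuous_tp (a : Freq → ℂ) (I : Finset Freq) : Continuous (tp a I) := by
  unfold tp; fun_prop

lemma chr_add (k l : Freq) (x : Fin 3 → ℝ) : chr (k + l) x = chr k x * chr l x := by
  unfold chr
  rw [← Complex.exp_add]
  congr 1
  rw [← mul_add, ← Complex.ofReal_add, ← Finset.sum_add_distrib]
  congr 3
  ext i
  push_cast [Pi.add_apply]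
  ring

lemma norm_chr (k : Freq) (x : Fin 3 → ℝ) : ‖chr k x‖ = 1 := by
  unfold chr
  rw [Complex.norm_exp]
  simp

lemma conj_chr (k : Freq) (x : Fin 3 → ℝ) : (starRingEnd ℂ) (chr k x) = chr (-k) x := by
  unfold chr
  rw [← Complex.exp_conj]
  congr 1
  simp only [map_mul, Complex.conj_I, Complex.conj_ofReal, Pi.neg_apply, map_ofNat]
  push_cast
  simp [Finset.mul_sum]

lemma integrableOn_cube {E : Type*} [NormedAddCommGroup E] {f : (Fin 3 → ℝ) → E}
    (hf : Continuous f) :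
    IntegrableOn f (Set.univ.pi fun _ : Fin 3 => Set.Icc (0:ℝ) 1) :=
  hf.continuousOn.integrableOn_compact (isCompact_univ_pi fun _ => isCompact_Icc)

lemma avg_mono {f g : (Fin 3 → ℝ) → ℝ} (hf : Continuous f) (hg : Continuous g)
    (h : ∀ x, f x ≤ g x) : avg f ≤ avg g :=
  setIntegral_mono (integrableOn_cube hf) (integrableOn_cube hg) h

lemma avg_nonneg {f : (Fin 3 → ℝ) → ℝ} (h : ∀ x, 0 ≤ f x) : 0 ≤ avg f :=
  integral_nonneg h

lemma avg_add {f g : (Fin 3 → ℝ) → ℝ} (hf : Continuous f) (hg : Continuous g) :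
    avg (fun x => f x + g x) = avg f + avg g :=
  integral_add (integrableOn_cube hf) (integrableOn_cube hg)

lemma avg_const_mul (c : ℝ) (f : (Fin 3 → ℝ) → ℝ) : avg (fun x => c * f x) = c * avg f :=
  integral_const_mul c f

lemma avg_sum {ι : Type*} (s : Finset ι) {f : ι → (Fin 3 → ℝ) → ℝ}
    (hf : ∀ i ∈ s, Continuous (f i)) :
    avg (fun x => ∑ i ∈ s, f i x) = ∑ i ∈ s, avg (f i) :=
  integral_finsetSum s fun i hi => integrableOn_cube (hf i hi)

lemma avg_const (c : ℝ) : avg (fun _ => c) = c := by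
  unfold avg
  rw [setIntegral_const]
  rw [Measure.real, volume_pi_pi]
  simp

lemma avg_sq_le_mul {f g : (Fin 3 → ℝ) → ℝ} (hf : Continuous f) (hg : Continuous g) {P Q : ℝ}
    (h1 : avg (fun x => f x ^ 2) ≤ P) (h2 : avg (fun x => g x ^ 2) ≤ Q) :
    avg (fun x => f x * g x) ≤ √(P * Q) := by
  have key : ∀ t : ℝ, 0 ≤ P * (t * t) + (-2 * avg (fun x => f x * g x)) * t + Q := by
    intro t
    have h0 : 0 ≤ avg (fun x => (t * f x - g x) ^ 2) := avg_nonneg fun x => sq_nonneg _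
    have h3 : avg (fun x => (t * f x - g x) ^ 2) = t ^ 2 * avg (fun x => f x ^ 2) +
        ((-2 * t) * avg (fun x => f x * g x) + avg (fun x => g x ^ 2)) := by
      rw [← avg_const_mul, ← avg_const_mul, ← avg_add (by fun_prop) (by fun_prop),
        ← avg_add (by fun_prop) (by fun_prop)]
      congr 1; ext x; ring
    nlinarith [mul_le_mul_of_nonneg_left h1 (sq_nonneg t)]
  have h4 := discrim_le_zero key
  unfold discrim at h4
  apply Real.le_sqrt_of_sq_le
  nlinarith

lemma integral_chr (k : Freq) :
    ∫ x in (Set.univ.pi fun _ : Fin 3 => Set.Icc (0:ℝ) 1), chr k x = if k = 0 then 1 else 0 := by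
  have h1 : ∀ x, chr k x = ∏ i, Complex.exp (2 * Real.pi * Complex.I * (k i : ℂ) * (x i : ℂ)) := by
    intro x
    rw [← Complex.exp_sum]
    unfold chr
    congr 1
    push_cast
    rw [Finset.mul_sum]
    refine Finset.sum_congr rfl fun i _ => by ring
  have h2 : ∀ n : ℤ, ∫ t in Set.Icc (0:ℝ) 1, Complex.exp (2 * Real.pi * Complex.I * (n : ℂ) * (t : ℂ))
      = if n = 0 then 1 else 0 := by
    intro n
    split_ifs with hn
    · simp [hn]
    · rw [integral_Icc_eq_integral_Ioc, ← intervalIntegral.integral_of_le zero_le_one,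
        integral_exp_mul_complex]
      · have := Complex.exp_int_mul_two_pi_mul_I n
        have h3 : 2 * (Real.pi : ℂ) * Complex.I * n = n * (2 * Real.pi * Complex.I) := by ring
        simp [h3, this]
      · simp [Real.pi_ne_zero, hn]
  simp_rw [h1]
  rw [volume_pi, Measure.restrict_pi_pi,
    integral_fintype_prod_eq_prod (μ := fun _ => (volume : Measure ℝ).restrict (Set.Icc 0 1))
      (fun i (t : ℝ) => Complex.exp (2 * Real.pi * Complex.I * (k i : ℂ) * (t : ℂ)))]
  simp_rw [h2]
  split_ifs with hk
  · simp [hk]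
  · obtain ⟨i, hi⟩ := Function.ne_iff.mp hk
    exact Finset.prod_eq_zero (Finset.mem_univ i) (if_neg hi)

/-- Parseval for a trigonometric polynomial indexed by distinct frequencies. -/
lemma avg_norm_sq_sum (s : Finset Freq) (c : Freq → ℂ) :
    avg (fun x => ‖∑ n ∈ s, c n * chr n x‖ ^ 2) = ∑ n ∈ s, ‖c n‖ ^ 2 := by
  have h1 : ∀ x, ((‖∑ n ∈ s, c n * chr n x‖ ^ 2 : ℝ) : ℂ) =
      ∑ n ∈ s, ∑ m ∈ s, (c n * (starRingEnd ℂ) (c m)) * chr (n - m) x := by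
    intro x
    rw [Complex.ofReal_pow, ← Complex.mul_conj', map_sum, Finset.sum_mul_sum]
    refine Finset.sum_congr rfl fun n _ => Finset.sum_congr rfl fun m _ => ?_
    rw [map_mul, conj_chr, sub_eq_add_neg, chr_add]
    ring
  have h2 : ((avg (fun x => ‖∑ n ∈ s, c n * chr n x‖ ^ 2) : ℝ) : ℂ) =
      ((∑ n ∈ s, ‖c n‖ ^ 2 : ℝ) : ℂ) := by
    unfold avg
    rw [← integral_complex_ofReal]
    simp_rw [h1]
    rw [integral_finsetSum _ fun n _ => integrableOn_cube (by fun_prop)]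
    rw [Complex.ofReal_sum]
    refine Finset.sum_congr rfl fun n hn => ?_
    rw [integral_finsetSum _ fun n _ => integrableOn_cube (by fun_prop)]
    simp_rw [integral_const_mul, integral_chr]
    rw [Finset.sum_eq_single n]
    · simp [Complex.mul_conj']
    · intro m _ hm
      rw [if_neg (sub_ne_zero.mpr (Ne.symm hm)), mul_zero]
    · intro h; exact absurd hn h
  exact_mod_cast h2

lemma avg_norm_tp_sq (a : Freq → ℂ) (I : Finset Freq) :
    avg (fun x => ‖tp a I x‖ ^ 2) = mass a I := avg_norm_sq_sum I a

/-- Parseval with repeated frequencies. -/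
lemma avg_norm_sq_sum_index {β : Type*} (P : Finset β) (c : β → ℂ) (κ : β → Freq)
    (s : Finset Freq) (hs : ∀ p ∈ P, κ p ∈ s) :
    avg (fun x => ‖∑ p ∈ P, c p * chr (κ p) x‖ ^ 2) =
      ∑ n ∈ s, ‖∑ p ∈ P with κ p = n, c p‖ ^ 2 := by
  rw [← avg_norm_sq_sum s]
  congr 1; ext x; congr 2
  rw [← Finset.sum_fiberwise_of_maps_to hs]
  refine Finset.sum_congr rfl fun n _ => ?_
  rw [Finset.sum_mul]
  refine Finset.sum_congr rfl fun p hp => ?_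
  rw [(Finset.mem_filter.mp hp).2]

/-- Almost orthogonality of the pieces of `tp a I` against a trigonometric polynomial. -/
lemma orth {ι β : Type*} [DecidableEq ι] (a : Freq → ℂ) (I : Finset Freq) (cell : Freq → ι)
    (m : ℕ) (Z : Finset β) (b : β → ℂ) (ζ : β → Freq)
    (h : ∀ n : Freq, (((I.filter fun k => ∃ z ∈ Z, k + ζ z = n).image cell).card ≤ m)) :
    avg (fun x => ‖tp a I x‖ ^ 2 * ‖∑ z ∈ Z, b z * chr (ζ z) x‖ ^ 2) ≤
      m * ∑ i ∈ I.image cell,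
        avg (fun x => ‖tp a (I.filter fun k => cell k = i) x‖ ^ 2 *
          ‖∑ z ∈ Z, b z * chr (ζ z) x‖ ^ 2) := by
  classical
  set s : Finset Freq := (I ×ˢ Z).image fun p => p.1 + ζ p.2 with hs
  have hprod : ∀ I' ⊆ I, avg (fun x => ‖tp a I' x‖ ^ 2 * ‖∑ z ∈ Z, b z * chr (ζ z) x‖ ^ 2) =
      ∑ n ∈ s, ‖∑ p ∈ I' ×ˢ Z with p.1 + ζ p.2 = n, a p.1 * b p.2‖ ^ 2 := by
    intro I' hI'
    rw [← avg_norm_sq_sum_index (I' ×ˢ Z) (fun p => a p.1 * b p.2) (fun p => p.1 + ζ p.2) s]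
    · congr 1; ext x
      rw [← mul_pow, ← norm_mul, tp, Finset.sum_mul_sum, Finset.sum_product]
      congr 2
      refine Finset.sum_congr rfl fun k _ => Finset.sum_congr rfl fun z _ => ?_
      rw [chr_add]; ring
    · intro p hp
      rw [Finset.mem_product] at hp
      exact Finset.mem_image_of_mem _ (Finset.mem_product.mpr ⟨hI' hp.1, hp.2⟩)
  rw [hprod I subset_rfl, Finset.sum_congr rfl fun i _ => hprod _ (Finset.filter_subset _ I),
    Finset.sum_comm, Finset.mul_sum]
  refine Finset.sum_le_sum fun n _ => ?_
  set C := (I.filter fun k => ∃ z ∈ Z, k + ζ z = n).image cell with hC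
  set H : ι → ℂ := fun i => ∑ p ∈ (I.filter fun k => cell k = i) ×ˢ Z with p.1 + ζ p.2 = n,
    a p.1 * b p.2 with hH
  have h1 : ∑ p ∈ I ×ˢ Z with p.1 + ζ p.2 = n, a p.1 * b p.2 = ∑ i ∈ C, H i := by
    rw [← Finset.sum_fiberwise_of_maps_to (t := C) (g := fun p : Freq × β => cell p.1)]
    · refine Finset.sum_congr rfl fun i _ => ?_
      rw [hH]
      refine Finset.sum_congr ?_ fun _ _ => rfl
      ext p
      simp only [Finset.mem_filter, Finset.mem_product]
      tauto
    · intro p hp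
      simp only [Finset.mem_filter, Finset.mem_product] at hp
      exact Finset.mem_image_of_mem _ (Finset.mem_filter.mpr ⟨hp.1.1, p.2, hp.1.2, hp.2⟩)
  rw [h1]
  calc ‖∑ i ∈ C, H i‖ ^ 2 ≤ (∑ i ∈ C, ‖H i‖) ^ 2 := by gcongr; exact norm_sum_le _ _
    _ ≤ C.card * ∑ i ∈ C, ‖H i‖ ^ 2 := sq_sum_le_card_mul_sum_sq
    _ ≤ m * ∑ i ∈ I.image cell, ‖H i‖ ^ 2 := by
        gcongr
        · exact h n
        · exact Finset.image_subset_image (Finset.filter_subset _ _)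

lemma sum_mass_filter {ι : Type*} [DecidableEq ι] (a : Freq → ℂ) (I : Finset Freq)
    (cell : Freq → ι) :
    ∑ i ∈ I.image cell, mass a (I.filter fun k => cell k = i) = mass a I :=
  Finset.sum_fiberwise_of_maps_to (fun _ h => Finset.mem_image_of_mem cell h) _

lemma tp_eq_sum_filter {ι : Type*} [DecidableEq ι] (a : Freq → ℂ) (I : Finset Freq)
    (cell : Freq → ι) (x : Fin 3 → ℝ) :
    tp a I x = ∑ i ∈ I.image cell, tp a (I.filter fun k => cell k = i) x :=
  (Finset.sum_fiberwise_of_maps_to (fun _ h => Finset.mem_image_of_mem cell h) _).symm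

lemma norm_tp_sq_le (a : Freq → ℂ) (I : Finset Freq) (x : Fin 3 → ℝ) :
    ‖tp a I x‖ ^ 2 ≤ I.card * mass a I := by
  calc ‖tp a I x‖ ^ 2 ≤ (∑ k ∈ I, ‖a k‖) ^ 2 := by
        gcongr
        refine (norm_sum_le _ _).trans (Finset.sum_le_sum fun k _ => ?_)
        rw [norm_mul, norm_chr, mul_one]
    _ ≤ _ := sq_sum_le_card_mul_sum_sq

/-- Broad-narrow dichotomy. -/
lemma broad_narrow {ι : Type*} (C : Finset ι) (y : ι → ℂ) (adj : ι → ι → Prop)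
    [DecidableRel adj] (h27 : ∀ i ∈ C, (C.filter fun j => adj i j).card ≤ 27) {m : ℝ}
    (hm : (C.card : ℝ) ≤ m) {n : ℕ} (hn : n ≠ 0) :
    ‖∑ i ∈ C, y i‖ ^ (2 * n) ≤ 54 ^ (2 * n) * ∑ i ∈ C, ‖y i‖ ^ (2 * n) ∨
    ‖∑ i ∈ C, y i‖ ^ (2 * n) ≤ (2 * m) ^ (2 * n) *
      ∑ p ∈ (C ×ˢ C).filter (fun p => ¬ adj p.1 p.2), ‖y p.1‖ ^ n * ‖y p.2‖ ^ n := by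
  classical
  rcases C.eq_empty_or_nonempty with rfl | hne
  · left
    simp [hn]
  obtain ⟨i0, hi0, hmax⟩ := C.exists_max_image (fun i => ‖y i‖) hne
  have hm0 : 0 < m := lt_of_lt_of_le (by exact_mod_cast hne.card_pos) hm
  set S := ‖∑ i ∈ C, y i‖ with hS
  have hS0 : 0 ≤ S := norm_nonneg _
  by_cases h1 : S ≤ 54 * ‖y i0‖
  · left
    calc S ^ (2 * n) ≤ (54 * ‖y i0‖) ^ (2 * n) := by gcongr
      _ = 54 ^ (2 * n) * ‖y i0‖ ^ (2 * n) := mul_pow _ _ _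
      _ ≤ _ := by
        gcongr
        exact Finset.single_le_sum (f := fun i => ‖y i‖ ^ (2 * n)) (fun i _ => by positivity) hi0
  · right
    push Not at h1
    have h2 : S ≤ ∑ j ∈ C.filter (fun j => adj i0 j), ‖y j‖ +
        ∑ j ∈ C.filter (fun j => ¬ adj i0 j), ‖y j‖ := by
      rw [Finset.sum_filter_add_sum_filter_not]; exact norm_sum_le _ _
    have h3 : ∑ j ∈ C.filter (fun j => adj i0 j), ‖y j‖ ≤ 27 * ‖y i0‖ := by
      refine (Finset.sum_le_card_nsmul _ _ ‖y i0‖ fun j hj =>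
        hmax j (Finset.mem_filter.mp hj).1).trans ?_
      rw [nsmul_eq_mul]
      gcongr
      exact_mod_cast h27 i0 hi0
    obtain ⟨j, hj, hj2⟩ : ∃ j ∈ C.filter (fun j => ¬ adj i0 j), S ≤ 2 * m * ‖y j‖ := by
      by_contra! hcon
      have h4 : ∑ j ∈ C.filter (fun j => ¬ adj i0 j), ‖y j‖ ≤ S / 2 := by
        calc ∑ j ∈ C.filter (fun j => ¬ adj i0 j), ‖y j‖
            ≤ ∑ j ∈ C.filter (fun j => ¬ adj i0 j), S / (2 * m) := by
              refine Finset.sum_le_sum fun j hj => ?_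
              rw [le_div_iff₀ (by positivity)]
              linarith [hcon j hj]
          _ ≤ m * (S / (2 * m)) := by
              rw [Finset.sum_const, nsmul_eq_mul]
              gcongr
              refine le_trans ?_ hm
              exact_mod_cast Finset.card_filter_le _ _
          _ = S / 2 := by field_simp
      linarith
    have hj3 := Finset.mem_filter.mp hj
    have h5 : S ≤ 2 * m * ‖y i0‖ := hj2.trans (by gcongr; exact hmax j hj3.1)
    calc S ^ (2 * n) = S ^ n * S ^ n := by rw [two_mul, pow_add]
      _ ≤ (2 * m * ‖y i0‖) ^ n * (2 * m * ‖y j‖) ^ n := by gcongr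
      _ = (2 * m) ^ (2 * n) * (‖y i0‖ ^ n * ‖y j‖ ^ n) := by ring
      _ ≤ _ := by
        gcongr
        exact Finset.single_le_sum (f := fun p : ι × ι => ‖y p.1‖ ^ n * ‖y p.2‖ ^ n)
          (fun i _ => by positivity) (Finset.mem_filter.mpr
          ⟨Finset.mem_product.mpr ⟨hi0, hj3.1⟩, hj3.2⟩ : (i0, j) ∈ _)

abbrev V3 := EuclideanSpace ℝ (Fin 3)

lemma inner_three (x y : V3) : inner ℝ x y = x 0 * y 0 + x 1 * y 1 + x 2 * y 2 := by
  rw [PiLp.inner_apply, Fin.sum_univ_three]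
  simp [mul_comm]

lemma norm_sq_three (x : V3) : ‖x‖ ^ 2 = x 0 ^ 2 + x 1 ^ 2 + x 2 ^ 2 := by
  rw [← real_inner_self_eq_norm_sq, inner_three]; ring

lemma abs_coord_le (x : V3) (i : Fin 3) : |x i| ≤ ‖x‖ := PiLp.norm_apply_le x i

/-- If `x, y` lie in a thin spherical shell and within `ρ` of `p`, then `x - y` is nearly
orthogonal to `p`. -/
lemma abs_inner_sub_le {x y p : V3} {Λ T ρ : ℝ} (hx : |‖x‖ ^ 2 - Λ ^ 2| ≤ T ^ 2)
    (hy : |‖y‖ ^ 2 - Λ ^ 2| ≤ T ^ 2) (hxp : ‖x - p‖ ≤ ρ) (hyp : ‖y - p‖ ≤ ρ) :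
    |inner ℝ (x - y) p| ≤ T ^ 2 + ρ ^ 2 / 2 := by
  have h1 := norm_sub_sq_real x p
  have h2 := norm_sub_sq_real y p
  rw [inner_sub_left]
  have h3 : ‖x - p‖ ^ 2 ≤ ρ ^ 2 := by gcongr
  have h4 : ‖y - p‖ ^ 2 ≤ ρ ^ 2 := by gcongr
  have h5 := sq_nonneg ‖x - p‖
  have h6 := sq_nonneg ‖y - p‖
  rw [abs_le] at *
  constructor <;> linarith [hx.1, hx.2, hy.1, hy.2]

lemma gram_lower {p u : V3} {Λ T : ℝ} (hp : |‖p‖ ^ 2 - Λ ^ 2| ≤ T ^ 2)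
    (hpu : |‖p - u‖ ^ 2 - Λ ^ 2| ≤ T ^ 2) (hT : 0 ≤ T) (hTu : T ≤ ‖u‖) (hu : ‖u‖ ≤ Λ / 10) :
    (9 / 10) * (‖u‖ ^ 2 * Λ ^ 2) ≤ ‖u‖ ^ 2 * ‖p‖ ^ 2 - (inner ℝ u p) ^ 2 := by
  have h1 := norm_sub_sq_real p u
  rw [real_inner_comm] at h1
  rw [abs_le] at hp hpu
  have hT2 : T ^ 2 ≤ ‖u‖ ^ 2 := by gcongr
  have hU : ‖u‖ ^ 2 ≤ Λ ^ 2 / 100 := by nlinarith [norm_nonneg u]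
  have h2 : |inner ℝ u p| ≤ (3 / 2) * ‖u‖ ^ 2 := by
    rw [abs_le]; constructor <;> nlinarith [hp.1, hp.2, hpu.1, hpu.2]
  have h3 : (inner ℝ u p) ^ 2 ≤ (9 / 4) * (‖u‖ ^ 2 * ‖u‖ ^ 2) := by
    rw [← sq_abs]
    calc |inner ℝ u p| ^ 2 ≤ ((3 / 2) * ‖u‖ ^ 2) ^ 2 := by gcongr
      _ = _ := by ring
  have h4 : ‖u‖ ^ 2 * ‖u‖ ^ 2 ≤ ‖u‖ ^ 2 * (Λ ^ 2 / 100) := by gcongr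
  have h5 : ‖u‖ ^ 2 * (Λ ^ 2 - Λ ^ 2 / 100) ≤ ‖u‖ ^ 2 * ‖p‖ ^ 2 := by
    gcongr; linarith [hp.1]
  nlinarith

lemma norm_sq_comb_le {p u d : V3} {Λ T ρ ℓ : ℝ} (hp : |‖p‖ ^ 2 - Λ ^ 2| ≤ T ^ 2)
    (hpu : |‖p - u‖ ^ 2 - Λ ^ 2| ≤ T ^ 2) (hT : 0 ≤ T) (hTu : T ≤ ‖u‖) (hu : ‖u‖ ≤ Λ / 10)
    (hℓ : 0 < ℓ) (hℓu : ℓ ≤ ‖u‖) (h1 : |inner ℝ d p| ≤ 4 * ρ ^ 2)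
    (h2 : |inner ℝ d u| ≤ 6 * ρ ^ 2) :
    ‖(inner ℝ d p) • u - (inner ℝ d u) • p‖ ^ 2 ≤
      49 * (ρ ^ 2 / ℓ) ^ 2 * (‖u‖ ^ 2 * ‖p‖ ^ 2 - (inner ℝ u p) ^ 2) := by
  have hg := gram_lower hp hpu hT hTu hu
  have hΛ : 0 < Λ := by linarith
  have hp' : ‖p‖ ≤ (101 / 100) * Λ := by
    rw [abs_le] at hp
    have hT2 : T ^ 2 ≤ Λ ^ 2 / 100 := by nlinarith
    apply abs_le_of_sq_le_sq' _ (by positivity) |>.2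
    nlinarith [hp.2]
  have h3 : ‖(inner ℝ d p) • u - (inner ℝ d u) • p‖ ≤ (647 / 100) * ρ ^ 2 * Λ := by
    refine (norm_sub_le _ _).trans ?_
    rw [norm_smul, norm_smul, Real.norm_eq_abs, Real.norm_eq_abs]
    have h4 : |inner ℝ d p| * ‖u‖ ≤ 4 * ρ ^ 2 * (Λ / 10) := by gcongr
    have h5 : |inner ℝ d u| * ‖p‖ ≤ 6 * ρ ^ 2 * ((101 / 100) * Λ) := by gcongr
    have : 0 ≤ ρ ^ 2 * Λ := by positivity
    nlinarith
  calc _ ≤ ((647 / 100) * ρ ^ 2 * Λ) ^ 2 := by gcongr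
    _ ≤ 49 * (9 / 10) * ((ρ ^ 2) ^ 2 * Λ ^ 2) := by
      have : 0 ≤ (ρ ^ 2) ^ 2 * Λ ^ 2 := by positivity
      nlinarith
    _ = 49 * (ρ ^ 2 / ℓ) ^ 2 * ((9 / 10) * (ℓ ^ 2 * Λ ^ 2)) := by field_simp
    _ ≤ 49 * (ρ ^ 2 / ℓ) ^ 2 * ((9 / 10) * (‖u‖ ^ 2 * Λ ^ 2)) := by gcongr
    _ ≤ _ := by gcongr

/-- The scalar triple product. -/
def triple (x y z : V3) : ℝ :=
  x 0 * (y 1 * z 2 - y 2 * z 1) + x 1 * (y 2 * z 0 - y 0 * z 2) + x 2 * (y 0 * z 1 - y 1 * z 0)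

lemma inner_mul_gram (d e u p : V3) :
    inner ℝ d e * (‖u‖ ^ 2 * ‖p‖ ^ 2 - (inner ℝ u p) ^ 2) =
      triple d u p * triple e u p +
      inner ℝ ((inner ℝ d p) • u - (inner ℝ d u) • p) ((inner ℝ e p) • u - (inner ℝ e u) • p) := by
  simp only [inner_three, norm_sq_three, triple, PiLp.sub_apply, PiLp.smul_apply, smul_eq_mul]
  ring

lemma norm_sq_mul_gram (d u p : V3) :
    ‖d‖ ^ 2 * (‖u‖ ^ 2 * ‖p‖ ^ 2 - (inner ℝ u p) ^ 2) =
      triple d u p ^ 2 + ‖(inner ℝ d p) • u - (inner ℝ d u) • p‖ ^ 2 := by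
  rw [← real_inner_self_eq_norm_sq, inner_mul_gram, real_inner_self_eq_norm_sq]; ring

lemma triple_eq_zero {v d u p : V3} (hv : v ≠ 0) (hd : inner ℝ d v = 0) (hu : inner ℝ u v = 0)
    (hp : inner ℝ p v = 0) : triple d u p = 0 := by
  by_contra h
  apply hv
  rw [inner_three] at hd hu hp
  ext i
  have : triple d u p * v i = 0 := by
    unfold triple
    fin_cases i
    · simp only [Fin.zero_eta]
      linear_combination (u 1 * p 2 - u 2 * p 1) * hd + (p 1 * d 2 - p 2 * d 1) * hu +
        (d 1 * u 2 - d 2 * u 1) * hp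
    · simp only [Fin.mk_one]
      linear_combination (u 2 * p 0 - u 0 * p 2) * hd + (p 2 * d 0 - p 0 * d 2) * hu +
        (d 2 * u 0 - d 0 * u 2) * hp
    · simp only [Fin.reduceFinMk]
      linear_combination (u 0 * p 1 - u 1 * p 0) * hd + (p 0 * d 1 - p 1 * d 0) * hu +
        (d 0 * u 1 - d 1 * u 0) * hp
  simpa [h] using this

/-- Planar case: a difference vector nearly orthogonal to both `p` and `u` is short. -/
lemma norm_le_of_triple_eq_zero {p u d : V3} {Λ T ρ ℓ : ℝ} (hp : |‖p‖ ^ 2 - Λ ^ 2| ≤ T ^ 2)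
    (hpu : |‖p - u‖ ^ 2 - Λ ^ 2| ≤ T ^ 2) (hT : 0 ≤ T) (hTu : T ≤ ‖u‖) (hu : ‖u‖ ≤ Λ / 10)
    (hℓ : 0 < ℓ) (hℓu : ℓ ≤ ‖u‖) (h1 : |inner ℝ d p| ≤ 4 * ρ ^ 2)
    (h2 : |inner ℝ d u| ≤ 6 * ρ ^ 2) (h0 : triple d u p = 0) : ‖d‖ ≤ 7 * (ρ ^ 2 / ℓ) := by
  have hg := gram_lower hp hpu hT hTu hu
  have hc := norm_sq_comb_le hp hpu hT hTu hu hℓ hℓu h1 h2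
  have hn := norm_sq_mul_gram d u p
  have hΛ : 0 < Λ := by linarith
  have hu0 : 0 < ‖u‖ := by linarith
  set G := ‖u‖ ^ 2 * ‖p‖ ^ 2 - (inner ℝ u p) ^ 2
  have hG : 0 < G := lt_of_lt_of_le (by positivity) hg
  rw [h0] at hn
  apply abs_le_of_sq_le_sq' _ (by positivity) |>.2
  have : ‖d‖ ^ 2 * G ≤ (7 * (ρ ^ 2 / ℓ)) ^ 2 * G := by nlinarith
  exact le_of_mul_le_mul_right this hG

lemma le_of_gram_identities {A B yd ye G h σ nd ne ip : ℝ} (hG : 0 < G) (hh0 : 0 ≤ h)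
    (hσ0 : 0 < σ)
    (hnd : nd ^ 2 * G = A ^ 2 + yd ^ 2) (hne : ne ^ 2 * G = B ^ 2 + ye ^ 2)
    (hip : |ip * G - A * B| ≤ yd * ye) (hcd : yd ^ 2 ≤ 49 * h ^ 2 * G)
    (hce : ye ^ 2 ≤ 49 * h ^ 2 * G) (h5 : |ip| ≤ 2 * h ^ 2) (hσ : 14 * h ≤ σ) (heσ : σ ≤ ne) :
    nd ≤ 9 * h := by
  have hyde : yd * ye ≤ 49 * h ^ 2 * G := by
    apply abs_le_of_sq_le_sq' _ (by positivity) |>.2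
    calc (yd * ye) ^ 2 = yd ^ 2 * ye ^ 2 := by ring
      _ ≤ (49 * h ^ 2 * G) * (49 * h ^ 2 * G) := by gcongr
      _ = _ := by ring
  have hxx : |A * B| ≤ 51 * h ^ 2 * G := by
    have h6 : A * B = ip * G - (ip * G - A * B) := by ring
    rw [h6]
    refine (abs_sub _ _).trans ?_
    rw [abs_mul, abs_of_pos hG]
    have : |ip| * G ≤ 2 * h ^ 2 * G := by gcongr
    linarith
  have hxe : (3 / 4) * σ ^ 2 * G ≤ B ^ 2 := by
    have h7 : σ ^ 2 * G ≤ ne ^ 2 * G := by gcongr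
    have h8 : 49 * h ^ 2 * G ≤ σ ^ 2 / 4 * G := by
      gcongr
      nlinarith
    linarith
  have hxd : A ^ 2 ≤ 18 * h ^ 2 * G := by
    have h9 : A ^ 2 * B ^ 2 ≤ (51 * h ^ 2 * G) ^ 2 := by
      rw [← mul_pow, ← sq_abs]; gcongr
    have h10 : A ^ 2 * ((3 / 4) * σ ^ 2 * G) ≤ (51 * h ^ 2 * G) ^ 2 :=
      le_trans (by gcongr) h9
    have h11 : (51 * h ^ 2 * G) ^ 2 ≤ 18 * h ^ 2 * G * ((3 / 4) * σ ^ 2 * G) := by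
      have h12 : (14 * h) ^ 2 ≤ σ ^ 2 := by gcongr
      have h13 : h ^ 2 * G ^ 2 * (14 * h) ^ 2 ≤ h ^ 2 * G ^ 2 * σ ^ 2 := by gcongr
      have h14 : 0 ≤ h ^ 4 * G ^ 2 := by positivity
      calc (51 * h ^ 2 * G) ^ 2 = 2601 * (h ^ 4 * G ^ 2) := by ring
        _ ≤ 2646 * (h ^ 4 * G ^ 2) := by gcongr; norm_num
        _ = (27 / 2) * (h ^ 2 * G ^ 2 * (14 * h) ^ 2) := by ring
        _ ≤ (27 / 2) * (h ^ 2 * G ^ 2 * σ ^ 2) := by gcongr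
        _ = _ := by ring
    exact le_of_mul_le_mul_right (h10.trans h11) (by positivity)
  apply abs_le_of_sq_le_sq' _ (by positivity) |>.2
  have : nd ^ 2 * G ≤ (9 * h) ^ 2 * G := by
    have h0 : 0 ≤ h ^ 2 * G := by positivity
    calc nd ^ 2 * G = A ^ 2 + yd ^ 2 := hnd
      _ ≤ 18 * h ^ 2 * G + 49 * h ^ 2 * G := by gcongr
      _ ≤ _ := by linarith
  exact le_of_mul_le_mul_right this hG

/-- Spatial case: if moreover `d` is nearly orthogonal to a long transversal vector `e` of the
same strip, then `d` is short. -/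
lemma norm_le_of_inner_le {p u d e : V3} {Λ T ρ ℓ σ : ℝ} (hp : |‖p‖ ^ 2 - Λ ^ 2| ≤ T ^ 2)
    (hpu : |‖p - u‖ ^ 2 - Λ ^ 2| ≤ T ^ 2) (hT : 0 ≤ T) (hTu : T ≤ ‖u‖) (hu : ‖u‖ ≤ Λ / 10)
    (hℓ : 0 < ℓ) (hℓu : ℓ ≤ ‖u‖) (h1 : |inner ℝ d p| ≤ 4 * ρ ^ 2)
    (h2 : |inner ℝ d u| ≤ 6 * ρ ^ 2) (h3 : |inner ℝ e p| ≤ 4 * ρ ^ 2)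
    (h4 : |inner ℝ e u| ≤ 6 * ρ ^ 2) (h5 : |inner ℝ d e| ≤ 2 * T ^ 2) (hTh : T ≤ ρ ^ 2 / ℓ)
    (hσ : 14 * (ρ ^ 2 / ℓ) ≤ σ) (heσ : σ ≤ ‖e‖) (hσ0 : 0 < σ) : ‖d‖ ≤ 9 * (ρ ^ 2 / ℓ) := by
  have hg := gram_lower hp hpu hT hTu hu
  have hcs := abs_real_inner_le_norm ((inner ℝ d p) • u - (inner ℝ d u) • p)
    ((inner ℝ e p) • u - (inner ℝ e u) • p)
  have hΛ : 0 < Λ := by linarith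
  have hu0 : 0 < ‖u‖ := by linarith
  refine le_of_gram_identities (lt_of_lt_of_le (by positivity) hg) (by positivity)
    hσ0 (norm_sq_mul_gram d u p) (norm_sq_mul_gram e u p) ?_
    (norm_sq_comb_le hp hpu hT hTu hu hℓ hℓu h1 h2)
    (norm_sq_comb_le hp hpu hT hTu hu hℓ hℓu h3 h4) (h5.trans (by gcongr)) hσ heσ
  rw [inner_mul_gram d e u p, add_sub_cancel_left]
  exact hcs

/-- Adjacency of cells. -/
def Near (c c' : Fin 3 → ℤ) : Prop := ∀ i, |c i - c' i| ≤ 1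

instance : DecidableRel Near := fun c c' => inferInstanceAs (Decidable (∀ i, |c i - c' i| ≤ 1))

/-- The cell of `φ k` in the grid of cubes of side `s`. -/
def cube (φ : Freq →+ V3) (s : ℝ) (k : Freq) : Fin 3 → ℤ := fun i => ⌊φ k i / s⌋

lemma card_near_le (C : Finset (Fin 3 → ℤ)) (c : Fin 3 → ℤ) :
    (C.filter fun j => Near c j).card ≤ 27 := by
  have h : (C.filter fun j => Near c j) ⊆ Finset.Icc (c - 1) (c + 1) := by
    intro j hj
    have := (Finset.mem_filter.mp hj).2
    rw [Finset.mem_Icc, Pi.le_def, Pi.le_def]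
    constructor <;> intro i <;> have h1 := abs_le.mp (this i) <;>
      simp only [Pi.sub_apply, Pi.add_apply, Pi.one_apply] <;> omega
  refine (Finset.card_le_card h).trans ?_
  rw [Pi.card_Icc]
  simp only [Int.card_Icc, Pi.sub_apply, Pi.add_apply, Pi.one_apply]
  have : ∀ i, (c i + 1 + 1 - (c i - 1)).toNat = 3 := fun i => by omega
  simp [this]

lemma abs_floor_sub_le {x y s : ℝ} (hs : 0 < s) {n : ℕ} (h : |x - y| ≤ n * s) :
    |⌊x / s⌋ - ⌊y / s⌋| ≤ n := by
  have h1 : x / s ≤ y / s + n := by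
    rw [div_add' _ _ _ hs.ne', div_le_div_iff_of_pos_right hs]; linarith [(abs_le.mp h).2]
  have h2 : y / s ≤ x / s + n := by
    rw [div_add' _ _ _ hs.ne', div_le_div_iff_of_pos_right hs]; linarith [(abs_le.mp h).1]
  have h3 := Int.floor_mono h1
  have h4 := Int.floor_mono h2
  rw [Int.floor_add_natCast] at h3 h4
  rw [abs_le]; constructor <;> omega

lemma near_of_coord {φ : Freq →+ V3} {s : ℝ} (hs : 0 < s) {k l : Freq}
    (h : ∀ i, |φ k i - φ l i| ≤ s) : Near (cube φ s k) (cube φ s l) := fun i => by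
  have := abs_floor_sub_le hs (n := 1) (x := φ k i) (y := φ l i) (by simpa using h i)
  exact_mod_cast this

lemma near_of_norm {φ : Freq →+ V3} {s : ℝ} (hs : 0 < s) {k l : Freq}
    (h : ‖φ k - φ l‖ ≤ s) : Near (cube φ s k) (cube φ s l) :=
  near_of_coord hs fun i => (abs_coord_le (φ k - φ l) i).trans h

lemma abs_coord_sub_le_of_cube_eq {φ : Freq →+ V3} {s : ℝ} (hs : 0 < s) {k l : Freq}
    (h : cube φ s k = cube φ s l) (i : Fin 3) : |φ k i - φ l i| ≤ s := by
  have h1 := congrFun h i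
  unfold cube at h1
  have h2 := (Int.abs_sub_lt_one_of_floor_eq_floor h1).le
  rw [← sub_div, abs_div, abs_of_pos hs, div_le_one hs] at h2
  exact h2

lemma norm_sub_le_of_coord {x y : V3} {s : ℝ} (h : ∀ i, |x i - y i| ≤ s) :
    ‖x - y‖ ≤ 2 * s := by
  have h0 : 0 ≤ s := (abs_nonneg _).trans (h 0)
  apply abs_le_of_sq_le_sq' _ (by positivity) |>.2
  rw [norm_sq_three]
  have h1 : ∀ i, (x i - y i) ^ 2 ≤ s ^ 2 := fun i => by
    rw [← sq_abs]; have := h i; gcongr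
  have := h1 0; have := h1 1; have := h1 2
  simp only [PiLp.sub_apply]
  nlinarith

lemma norm_sub_le_of_cube_eq {φ : Freq →+ V3} {s : ℝ} (hs : 0 < s) {k l : Freq}
    (h : cube φ s k = cube φ s l) : ‖φ k - φ l‖ ≤ 2 * s :=
  norm_sub_le_of_coord (abs_coord_sub_le_of_cube_eq hs h)

lemma card_image_cube_le {φ : Freq →+ V3} {s R : ℝ} (hs : 0 < s) (hR : 0 ≤ R) {S : Finset Freq}
    (h : ∀ k ∈ S, ∀ l ∈ S, ‖φ k - φ l‖ ≤ R) :
    ((S.image (cube φ s)).card : ℝ) ≤ (2 * (R / s) + 3) ^ 3 := by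
  rcases S.eq_empty_or_nonempty with rfl | ⟨k0, hk0⟩
  · simp; positivity
  set n : ℕ := ⌈R / s⌉₊ with hn
  have h1 : S.image (cube φ s) ⊆ Finset.Icc (cube φ s k0 - fun _ => (n : ℤ))
      (cube φ s k0 + fun _ => (n : ℤ)) := by
    intro c hc
    obtain ⟨k, hk, rfl⟩ := Finset.mem_image.mp hc
    have h2 : ∀ i, |cube φ s k i - cube φ s k0 i| ≤ n := fun i => by
      refine abs_floor_sub_le hs ?_
      refine ((abs_coord_le (φ k - φ k0) i).trans (h k hk k0 hk0)).trans ?_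
      rw [← div_le_iff₀ hs]; exact Nat.le_ceil _
    rw [Finset.mem_Icc, Pi.le_def, Pi.le_def]
    constructor <;> intro i <;> have h3 := abs_le.mp (h2 i) <;>
      simp only [Pi.sub_apply, Pi.add_apply] <;> omega
  have h2 := Finset.card_le_card h1
  rw [Pi.card_Icc] at h2
  simp only [Int.card_Icc, Pi.sub_apply, Pi.add_apply] at h2
  have h3 : ∀ i, (cube φ s k0 i + n + 1 - (cube φ s k0 i - n)).toNat = 2 * n + 1 :=
    fun i => by omega
  simp only [h3, Finset.prod_const, Finset.card_univ, Fintype.card_fin] at h2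
  calc ((S.image (cube φ s)).card : ℝ) ≤ ((2 * n + 1 : ℕ) : ℝ) ^ 3 := by exact_mod_cast h2
    _ ≤ _ := by
      have := (Nat.ceil_lt_add_one (a := R / s) (by positivity)).le
      push_cast
      refine pow_le_pow_left₀ (by positivity) ?_ 3
      linarith

/-- Orthogonality of the pieces cut out by cells, in terms of an adjacency relation. -/
lemma orth_adj {ι β : Type*} [DecidableEq ι] (a : Freq → ℂ) (I : Finset Freq) (cell : Freq → ι)
    (adj : ι → ι → Prop) [DecidableRel adj]
    (m : ℕ) (hm : ∀ i, (((I.image cell).filter fun j => adj i j).card ≤ m))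
    (Z : Finset β) (b : β → ℂ) (ζ : β → Freq)
    (h : ∀ k ∈ I, ∀ l ∈ I, ∀ z ∈ Z, ∀ w ∈ Z, k + ζ z = l + ζ w → adj (cell k) (cell l)) :
    avg (fun x => ‖tp a I x‖ ^ 2 * ‖∑ z ∈ Z, b z * chr (ζ z) x‖ ^ 2) ≤
      m * ∑ i ∈ I.image cell,
        avg (fun x => ‖tp a (I.filter fun k => cell k = i) x‖ ^ 2 *
          ‖∑ z ∈ Z, b z * chr (ζ z) x‖ ^ 2) := by
  refine orth a I cell m Z b ζ fun n => ?_
  rcases (I.filter fun k => ∃ z ∈ Z, k + ζ z = n).eq_empty_or_nonempty with he | ⟨k, hk⟩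
  · rw [he]; simp
  · obtain ⟨hkI, z, hz, hkz⟩ := Finset.mem_filter.mp hk
    refine (Finset.card_le_card fun j hj => ?_).trans (hm (cell k))
    obtain ⟨l, hl, rfl⟩ := Finset.mem_image.mp hj
    obtain ⟨hlI, w, hw, hlw⟩ := Finset.mem_filter.mp hl
    exact Finset.mem_filter.mpr ⟨Finset.mem_image_of_mem _ hlI,
      h k hkI l hlI z hz w hw (hkz.trans hlw.symm)⟩

/-- Orthogonality for cubes against `tp a J`. -/
lemma orth_cube (a : Freq → ℂ) (I J : Finset Freq) (φ : Freq →+ V3) (s : ℝ)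
    (h : ∀ k ∈ I, ∀ l ∈ I, ∀ z ∈ J, ∀ w ∈ J, k + z = l + w → Near (cube φ s k) (cube φ s l)) :
    avg (fun x => ‖tp a I x‖ ^ 2 * ‖tp a J x‖ ^ 2) ≤
      27 * ∑ i ∈ I.image (cube φ s),
        avg (fun x => ‖tp a (I.filter fun k => cube φ s k = i) x‖ ^ 2 * ‖tp a J x‖ ^ 2) :=
  orth_adj a I (cube φ s) Near 27 (fun i => card_near_le _ i) J a id h

/-- Orthogonality for cubes against `(tp a J)²`. -/
lemma orth_cube_sq (a : Freq → ℂ) (I J : Finset Freq) (φ : Freq →+ V3) (s : ℝ)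
    (h : ∀ k ∈ I, ∀ l ∈ I, ∀ z₁ ∈ J, ∀ z₂ ∈ J, ∀ w₁ ∈ J, ∀ w₂ ∈ J,
      k + (z₁ + z₂) = l + (w₁ + w₂) → Near (cube φ s k) (cube φ s l)) :
    avg (fun x => ‖tp a I x‖ ^ 2 * ‖tp a J x‖ ^ 4) ≤
      27 * ∑ i ∈ I.image (cube φ s),
        avg (fun x => ‖tp a (I.filter fun k => cube φ s k = i) x‖ ^ 2 * ‖tp a J x‖ ^ 4) := by
  have key := orth_adj a I (cube φ s) Near 27 (fun i => card_near_le _ i) (J ×ˢ J)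
    (fun p => a p.1 * a p.2) (fun p => p.1 + p.2) (fun k hk l hl z hz w hw hkl => by
      rw [Finset.mem_product] at hz hw
      exact h k hk l hl _ hz.1 _ hz.2 _ hw.1 _ hw.2 hkl)
  have h1 : ∀ x, ‖∑ z ∈ J ×ˢ J, a z.1 * a z.2 * chr (z.1 + z.2) x‖ ^ 2 = ‖tp a J x‖ ^ 4 := by
    intro x
    have : ∑ z ∈ J ×ˢ J, a z.1 * a z.2 * chr (z.1 + z.2) x = tp a J x ^ 2 := by
      rw [sq, tp, Finset.sum_mul_sum, Finset.sum_product]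
      refine Finset.sum_congr rfl fun k _ => Finset.sum_congr rfl fun z _ => ?_
      rw [chr_add]; ring
    rw [this, norm_pow]; ring
  simp only [h1] at key
  exact_mod_cast key

/-- `φ` maps `S` into a cap of the `T²`-neighbourhood of the sphere of radius `Λ`, with at most `ν`
points in any set of diameter `T`. -/
structure IsShell (φ : Freq →+ V3) (S : Finset Freq) (Λ T ν : ℝ) : Prop where
  pos : 0 < T
  shell : ∀ k ∈ S, |‖φ k‖ ^ 2 - Λ ^ 2| ≤ T ^ 2
  cap : ∀ k ∈ S, ∀ l ∈ S, ‖φ k - φ l‖ ≤ Λ / 10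
  card_le : ∀ U ⊆ S, (∀ k ∈ U, ∀ l ∈ U, ‖φ k - φ l‖ ≤ T) → (U.card : ℝ) ≤ ν

lemma IsShell.nonneg {φ : Freq →+ V3} {S : Finset Freq} {Λ T ν : ℝ} (h : IsShell φ S Λ T ν) :
    0 ≤ ν := by
  simpa using h.card_le ∅ (Finset.empty_subset _) (by simp)

lemma IsShell.mono {φ : Freq →+ V3} {S S' : Finset Freq} {Λ T ν : ℝ} (h : IsShell φ S Λ T ν)
    (hS : S' ⊆ S) : IsShell φ S' Λ T ν :=
  ⟨h.pos, fun k hk => h.shell k (hS hk), fun k hk l hl => h.cap k (hS hk) l (hS hl),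
    fun U hU => h.card_le U (hU.trans hS)⟩

/-- The linear estimate in `L^(2(q+1))` with loss exponent `η`. -/
def LinearBound (P : (Freq →+ V3) → Prop) (q : ℕ) (η : ℝ) : Prop :=
  ∃ A : ℝ, 0 < A ∧ ∀ φ S Λ T ν, P φ → IsShell φ S Λ T ν → ∀ (a : Freq → ℂ) (R : ℝ), T ≤ R →
    (∀ k ∈ S, ∀ l ∈ S, ‖φ k - φ l‖ ≤ R) →
    avg (fun x => ‖tp a S x‖ ^ (2 * (q + 1))) ≤ A * ν ^ q * (R / T) ^ η * mass a S ^ (q + 1)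

/-- The bilinear estimate for pieces of diameter `ρ` at distance `ℓ`, with gain
`(ρ / ℓ) ^ c`. -/
def BilinearBound (P : (Freq →+ V3) → Prop) (q : ℕ) (η c B : ℝ) : Prop :=
  ∃ A : ℝ, 0 < A ∧ ∀ φ S Λ T ν, P φ → IsShell φ S Λ T ν → ∀ (a : Freq → ℂ) (I J : Finset Freq)
    (ρ ℓ : ℝ), I ⊆ S → J ⊆ S → T ≤ ρ → ρ ≤ ℓ → T ≤ ℓ * (ρ / ℓ) ^ B →
    (∀ k ∈ I, ∀ l ∈ I, ‖φ k - φ l‖ ≤ ρ) → (∀ k ∈ J, ∀ l ∈ J, ‖φ k - φ l‖ ≤ ρ) →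
    (∀ k ∈ I, ∀ l ∈ J, ℓ ≤ ‖φ k - φ l‖) →
    avg (fun x => ‖tp a I x‖ ^ 2 * ‖tp a J x‖ ^ (2 * q)) ≤
      A * ν ^ q * (ρ / T) ^ η * (ρ / ℓ) ^ c * (mass a I * mass a J ^ q)

/-- The gain in the bilinear estimate can be improved by a definite amount. -/
def BilinearStep (P : (Freq →+ V3) → Prop) (q : ℕ) : Prop :=
  ∀ η₀ cmax : ℝ, 0 < η₀ → ∃ g : ℝ, 0 < g ∧ ∀ η c B : ℝ, η₀ ≤ η → η ≤ 3 * q → 0 ≤ c → c ≤ cmax →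
    1 ≤ B → LinearBound P q η → BilinearBound P q η c B → BilinearBound P q η (c + g) (2 * B + 2)

lemma pow_sum_le_of_card_le {ι : Type*} (s : Finset ι) (f : ι → ℝ) (hf : ∀ i ∈ s, 0 ≤ f i) {N : ℝ}
    (hN : (s.card : ℝ) ≤ N) {p : ℕ} (hp : p ≠ 0) :
    (∑ i ∈ s, f i) ^ p ≤ N ^ p * ∑ i ∈ s, f i ^ p := by
  rcases s.eq_empty_or_nonempty with rfl | hne
  · simp [hp]
  obtain ⟨i0, hi0, hmax⟩ := s.exists_max_image f hne
  have h0 := hf i0 hi0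
  calc (∑ i ∈ s, f i) ^ p ≤ (N * f i0) ^ p := by
        refine pow_le_pow_left₀ (Finset.sum_nonneg hf) ?_ p
        refine (Finset.sum_le_card_nsmul _ _ _ hmax).trans ?_
        rw [nsmul_eq_mul]; gcongr
    _ = N ^ p * f i0 ^ p := mul_pow _ _ _
    _ ≤ _ := by
        have : 0 ≤ N := le_trans (by positivity) hN
        gcongr
        exact Finset.single_le_sum (f := fun i => f i ^ p) (fun i hi => pow_nonneg (hf i hi) p) hi0

lemma avg_split {ι : Type*} [DecidableEq ι] (a : Freq → ℂ) (I J : Finset Freq) (g : Freq → ι)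
    {N X : ℝ} (hI : ((I.image g).card : ℝ) ≤ N) (hJ : ((J.image g).card : ℝ) ≤ N) {q : ℕ}
    (hq : q ≠ 0) (hX : 0 ≤ X)
    (h : ∀ i ∈ I.image g, ∀ j ∈ J.image g,
      avg (fun x => ‖tp a (I.filter fun k => g k = i) x‖ ^ 2 *
        ‖tp a (J.filter fun k => g k = j) x‖ ^ (2 * q)) ≤ X) :
    avg (fun x => ‖tp a I x‖ ^ 2 * ‖tp a J x‖ ^ (2 * q)) ≤ N ^ (2 * q + 4) * X := by
  have hN : 0 ≤ N := le_trans (by positivity) hI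
  have hpt : ∀ (L : Finset Freq), ((L.image g).card : ℝ) ≤ N → ∀ p : ℕ, p ≠ 0 → ∀ x,
      ‖tp a L x‖ ^ p ≤ N ^ p * ∑ i ∈ L.image g, ‖tp a (L.filter fun k => g k = i) x‖ ^ p := by
    intro L hL p hp x
    refine le_trans ?_ (pow_sum_le_of_card_le _ _ (fun i _ => norm_nonneg _) hL hp)
    rw [tp_eq_sum_filter a L g x]
    gcongr
    exact norm_sum_le _ _
  calc avg (fun x => ‖tp a I x‖ ^ 2 * ‖tp a J x‖ ^ (2 * q))
      ≤ avg (fun x => ∑ i ∈ I.image g, ∑ j ∈ J.image g, N ^ (2 + 2 * q) *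
        (‖tp a (I.filter fun k => g k = i) x‖ ^ 2 *
          ‖tp a (J.filter fun k => g k = j) x‖ ^ (2 * q))) := by
        refine avg_mono (by fun_prop) (by fun_prop) fun x => ?_
        have h1 := hpt I hI 2 two_ne_zero x
        have h2 := hpt J hJ (2 * q) (by omega) x
        refine (mul_le_mul h1 h2 (by positivity) (by positivity)).trans (le_of_eq ?_)
        simp_rw [← Finset.mul_sum]
        rw [← Finset.sum_mul, pow_add]
        ring
    _ = ∑ i ∈ I.image g, ∑ j ∈ J.image g, N ^ (2 + 2 * q) *
        avg (fun x => ‖tp a (I.filter fun k => g k = i) x‖ ^ 2 *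
          ‖tp a (J.filter fun k => g k = j) x‖ ^ (2 * q)) := by
        rw [avg_sum _ fun i _ => by fun_prop]
        refine Finset.sum_congr rfl fun i _ => ?_
        rw [avg_sum _ fun i _ => by fun_prop]
        refine Finset.sum_congr rfl fun j _ => avg_const_mul _ _
    _ ≤ ∑ i ∈ I.image g, ∑ j ∈ J.image g, N ^ (2 + 2 * q) * X := by
        refine Finset.sum_le_sum fun i hi => Finset.sum_le_sum fun j hj => ?_
        gcongr
        exact h i hi j hj
    _ ≤ N * (N * (N ^ (2 + 2 * q) * X)) := by
        rw [Finset.sum_const, Finset.sum_const, nsmul_eq_mul, nsmul_eq_mul]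
        gcongr
    _ = _ := by ring

lemma mul_pow_le_add {X Y : ℝ} (hX : 0 ≤ X) (hY : 0 ≤ Y) (q : ℕ) :
    X * Y ^ q ≤ X ^ (q + 1) + Y ^ (q + 1) := by
  rcases le_total X Y with h | h
  · have : X * Y ^ q ≤ Y * Y ^ q := by gcongr
    have h2 : 0 ≤ X ^ (q + 1) := by positivity
    rw [pow_succ' Y]; linarith
  · have : X * Y ^ q ≤ X * X ^ q := by gcongr
    have h2 : 0 ≤ Y ^ (q + 1) := by positivity
    rw [pow_succ' X]; linarith

lemma tp_eq_zero_of_mass {a : Freq → ℂ} {I : Finset Freq} (h : mass a I = 0) (x : Fin 3 → ℝ) :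
    tp a I x = 0 := by
  have := norm_tp_sq_le a I x
  rw [h, mul_zero] at this
  have h2 : ‖tp a I x‖ = 0 := by
    apply pow_eq_zero_iff two_ne_zero |>.1
    exact le_antisymm this (by positivity)
  exact norm_eq_zero.mp h2

lemma bilinear_base {P : (Freq →+ V3) → Prop} {q : ℕ} (hq : q ≠ 0) {η : ℝ}
    (h : LinearBound P q η) : BilinearBound P q η 0 1 := by
  obtain ⟨A, hA, h⟩ := h
  refine ⟨2 * A, by positivity, fun φ S Λ T ν hP hS a I J ρ ℓ hI hJ hTρ hρℓ _ hdI hdJ _ => ?_⟩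
  have hT := hS.pos
  have hν := hS.nonneg
  have hρ : 0 < ρ := hT.trans_le hTρ
  rw [Real.rpow_zero, mul_one]
  rcases (mass_nonneg a I).eq_or_lt with h0 | hWI
  · simp [tp_eq_zero_of_mass h0.symm, ← h0, avg_const]
  rcases (mass_nonneg a J).eq_or_lt with h0 | hWJ
  · simp [tp_eq_zero_of_mass h0.symm, ← h0, avg_const, hq]
  have h1 := h φ I Λ T ν hP (hS.mono hI) a ρ hTρ hdI
  have h2 := h φ J Λ T ν hP (hS.mono hJ) a ρ hTρ hdJ
  have hX : ∀ x, ‖tp a I x‖ ^ 2 * ‖tp a J x‖ ^ (2 * q) ≤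
      (mass a I * mass a J ^ q) * ((mass a I ^ (q + 1))⁻¹ * ‖tp a I x‖ ^ (2 * (q + 1)) +
        (mass a J ^ (q + 1))⁻¹ * ‖tp a J x‖ ^ (2 * (q + 1))) := by
    intro x
    have h3 := mul_pow_le_add (X := ‖tp a I x‖ ^ 2 / mass a I) (Y := ‖tp a J x‖ ^ 2 / mass a J)
      (by positivity) (by positivity) q
    have h4 : ‖tp a I x‖ ^ 2 * ‖tp a J x‖ ^ (2 * q) = (mass a I * mass a J ^ q) *
      (‖tp a I x‖ ^ 2 / mass a I * (‖tp a J x‖ ^ 2 / mass a J) ^ q) := by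
      rw [div_pow, pow_mul]; field_simp
    rw [h4]
    gcongr
    refine h3.trans (le_of_eq ?_)
    rw [div_pow, div_pow, ← pow_mul, ← pow_mul, div_eq_inv_mul, div_eq_inv_mul]
  refine (avg_mono (by fun_prop) (by fun_prop) hX).trans ?_
  rw [avg_const_mul, avg_add (by fun_prop) (by fun_prop), avg_const_mul, avg_const_mul]
  calc _ ≤ (mass a I * mass a J ^ q) *
      ((mass a I ^ (q + 1))⁻¹ * (A * ν ^ q * (ρ / T) ^ η * mass a I ^ (q + 1)) +
      (mass a J ^ (q + 1))⁻¹ * (A * ν ^ q * (ρ / T) ^ η * mass a J ^ (q + 1))) := by gcongr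
    _ = _ := by field_simp; ring

lemma BilinearBound.mono {P : (Freq →+ V3) → Prop} {q : ℕ} {η c c' B : ℝ}
    (h : BilinearBound P q η c B) (hc : c' ≤ c) : BilinearBound P q η c' B := by
  obtain ⟨A, hA, h⟩ := h
  refine ⟨A, hA, fun φ S Λ T ν hP hS a I J ρ ℓ hI hJ hTρ hρℓ hB hdI hdJ hd => ?_⟩
  have hT := hS.pos
  have hν := hS.nonneg
  have hρ : 0 < ρ := hT.trans_le hTρ
  have hℓ : 0 < ℓ := hρ.trans_le hρℓ
  have hW := mass_nonneg a I
  have hW' := mass_nonneg a J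
  refine (h φ S Λ T ν hP hS a I J ρ ℓ hI hJ hTρ hρℓ hB hdI hdJ hd).trans ?_
  have : (ρ / ℓ) ^ c ≤ (ρ / ℓ) ^ c' :=
    Real.rpow_le_rpow_of_exponent_ge (by positivity) (by rw [div_le_one hℓ]; exact hρℓ) hc
  gcongr

lemma bilinear_iterate {P : (Freq →+ V3) → Prop} {q : ℕ} (hq : q ≠ 0) (hstep : BilinearStep P q)
    {η₀ cmax : ℝ} (hη₀ : 0 < η₀) (hcmax : 0 ≤ cmax) :
    ∃ B : ℝ, 1 ≤ B ∧ ∀ η, η₀ ≤ η → η ≤ 3 * q → LinearBound P q η →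
      BilinearBound P q η cmax B := by
  obtain ⟨g, hg, hstep⟩ := hstep η₀ cmax hη₀
  have key : ∀ j : ℕ, ∃ B : ℝ, 1 ≤ B ∧ ∀ η, η₀ ≤ η → η ≤ 3 * q → LinearBound P q η →
      BilinearBound P q η (min cmax (j * g)) B := by
    intro j
    induction j with
    | zero =>
      refine ⟨1, le_rfl, fun η h1 h2 h => ?_⟩
      simpa [hcmax] using bilinear_base hq h
    | succ j ih =>
      obtain ⟨B, hB, ih⟩ := ih
      refine ⟨2 * B + 2, by linarith, fun η h1 h2 h => ?_⟩
      refine (hstep η _ B h1 h2 (le_min hcmax (by positivity)) (min_le_left _ _) hB h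
        (ih η h1 h2 h)).mono ?_
      push_cast
      rcases le_total cmax (j * g) with h3 | h3
      · rw [min_eq_left h3]
        exact (min_le_left _ _).trans (by linarith)
      · rw [min_eq_right h3]
        exact (min_le_right _ _).trans (by linarith)
  obtain ⟨j, hj⟩ := exists_nat_ge (cmax / g)
  obtain ⟨B, hB, h⟩ := key j
  rw [min_eq_left ((div_le_iff₀ hg).mp hj)] at h
  exact ⟨B, hB, h⟩

lemma linear_base (P : (Freq →+ V3) → Prop) (q : ℕ) : LinearBound P q (3 * q) := by
  refine ⟨7 ^ (3 * q), by positivity, fun φ S Λ T ν _ hS a R hTR hd => ?_⟩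
  have hT := hS.pos
  have hν := hS.nonneg
  have hR : 0 < R := hT.trans_le hTR
  have hcard : (S.card : ℝ) ≤ ν * (7 * (R / T)) ^ 3 := by
    have h1 : S.card = ∑ i ∈ S.image (cube φ (T / 2)), (S.filter fun k => cube φ (T / 2) k = i).card :=
      Finset.card_eq_sum_card_image _ _
    rw [h1]
    push_cast
    calc _ ≤ ∑ i ∈ S.image (cube φ (T / 2)), ν := by
          refine Finset.sum_le_sum fun i _ => hS.card_le _ (Finset.filter_subset _ _) ?_
          intro k hk l hl
          have := norm_sub_le_of_cube_eq (φ := φ) (s := T / 2) (by positivity)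
            ((Finset.mem_filter.mp hk).2.trans (Finset.mem_filter.mp hl).2.symm)
          linarith
      _ = ν * (S.image (cube φ (T / 2))).card := by rw [Finset.sum_const, nsmul_eq_mul, mul_comm]
      _ ≤ ν * (2 * (R / (T / 2)) + 3) ^ 3 := by
          gcongr; exact card_image_cube_le (by positivity) hR.le hd
      _ ≤ _ := by
          have h2 : 1 ≤ R / T := by rw [one_le_div hT]; exact hTR
          have h3 : R / (T / 2) = 2 * (R / T) := by field_simp
          rw [h3]
          gcongr
          linarith
  have hpt : ∀ x, ‖tp a S x‖ ^ (2 * (q + 1)) ≤ (S.card * mass a S) ^ q * ‖tp a S x‖ ^ 2 := by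
    intro x
    rw [pow_mul, pow_succ]
    gcongr
    exact norm_tp_sq_le a S x
  refine (avg_mono (by fun_prop) (by fun_prop) hpt).trans ?_
  rw [avg_const_mul, avg_norm_tp_sq]
  have hW := mass_nonneg a S
  calc (S.card * mass a S) ^ q * mass a S
      ≤ (ν * (7 * (R / T)) ^ 3 * mass a S) ^ q * mass a S := by gcongr
    _ = _ := by
      have : (3 * (q : ℝ)) = ((3 * q : ℕ) : ℝ) := by push_cast; ring
      rw [this, Real.rpow_natCast]
      rw [mul_pow, mul_pow, ← pow_mul, mul_pow]; ring

lemma sum_pow_succ_le {ι : Type*} (s : Finset ι) (f : ι → ℝ) (hf : ∀ i ∈ s, 0 ≤ f i) (q : ℕ) :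
    ∑ i ∈ s, f i ^ (q + 1) ≤ (∑ i ∈ s, f i) ^ (q + 1) := by
  rw [pow_succ, Finset.mul_sum]
  refine Finset.sum_le_sum fun i hi => ?_
  rw [pow_succ]
  have := hf i hi
  gcongr
  exact Finset.single_le_sum hf hi

lemma norm_mul_pow_le (x y : ℝ) (hx : 0 ≤ x) (hy : 0 ≤ y) {q : ℕ} (hq : q ≠ 0) :
    x ^ (q + 1) * y ^ (q + 1) ≤ x ^ 2 * y ^ (2 * q) + y ^ 2 * x ^ (2 * q) := by
  obtain ⟨r, rfl⟩ : ∃ r, q = r + 1 := Nat.exists_eq_succ_of_ne_zero hq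
  rcases le_total x y with h | h
  · have : x ^ 2 * y ^ (r + 2) * x ^ r ≤ x ^ 2 * y ^ (r + 2) * y ^ r := by gcongr
    have h2 : 0 ≤ y ^ 2 * x ^ (2 * (r + 1)) := by positivity
    calc _ = x ^ 2 * y ^ (r + 2) * x ^ r := by ring
      _ ≤ _ := this
      _ = x ^ 2 * y ^ (2 * (r + 1)) := by ring
      _ ≤ _ := by simpa using h2
  · have : y ^ 2 * x ^ (r + 2) * y ^ r ≤ y ^ 2 * x ^ (r + 2) * x ^ r := by gcongr
    have h2 : 0 ≤ x ^ 2 * y ^ (2 * (r + 1)) := by positivity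
    calc _ = y ^ 2 * x ^ (r + 2) * y ^ r := by ring
      _ ≤ _ := this
      _ = y ^ 2 * x ^ (2 * (r + 1)) := by ring
      _ ≤ _ := by simpa using h2

/-- Linear estimate from the narrow and broad parts. -/
lemma avg_le_narrow_add_broad (a : Freq → ℂ) (S : Finset Freq) (φ : Freq →+ V3) (s : ℝ)
    {q : ℕ} (hq : q ≠ 0) {m X Y : ℝ} (hm : ((S.image (cube φ s)).card : ℝ) ≤ m) (hY : 0 ≤ Y)
    (h1 : ∀ i ∈ S.image (cube φ s),
      avg (fun x => ‖tp a (S.filter fun k => cube φ s k = i) x‖ ^ (2 * (q + 1))) ≤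
        X * mass a (S.filter fun k => cube φ s k = i) ^ (q + 1))
    (hX : 0 ≤ X)
    (h2 : ∀ i ∈ S.image (cube φ s), ∀ j ∈ S.image (cube φ s), ¬ Near i j →
      avg (fun x => ‖tp a (S.filter fun k => cube φ s k = i) x‖ ^ 2 *
        ‖tp a (S.filter fun k => cube φ s k = j) x‖ ^ (2 * q)) ≤ Y) :
    avg (fun x => ‖tp a S x‖ ^ (2 * (q + 1))) ≤
      54 ^ (2 * (q + 1)) * (X * mass a S ^ (q + 1)) +
      (2 * m) ^ (2 * (q + 1)) * (m ^ 2 * (2 * Y)) := by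
  have hm0 : 0 ≤ m := le_trans (by positivity) hm
  set C := S.image (cube φ s) with hC
  set F : (Fin 3 → ℤ) → (Fin 3 → ℝ) → ℂ := fun i => tp a (S.filter fun k => cube φ s k = i) with hF
  have hFc : ∀ i, Continuous (F i) := fun i => continuous_tp _ _
  set D := (C ×ˢ C).filter (fun p => ¬ Near p.1 p.2) with hD
  have hpt : ∀ x, ‖tp a S x‖ ^ (2 * (q + 1)) ≤
      54 ^ (2 * (q + 1)) * ∑ i ∈ C, ‖F i x‖ ^ (2 * (q + 1)) +
      (2 * m) ^ (2 * (q + 1)) * ∑ p ∈ D, (‖F p.1 x‖ ^ 2 * ‖F p.2 x‖ ^ (2 * q) +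
        ‖F p.2 x‖ ^ 2 * ‖F p.1 x‖ ^ (2 * q)) := by
    intro x
    have h3 : ∑ p ∈ D, ‖F p.1 x‖ ^ (q + 1) * ‖F p.2 x‖ ^ (q + 1) ≤
      ∑ p ∈ D, (‖F p.1 x‖ ^ 2 * ‖F p.2 x‖ ^ (2 * q) + ‖F p.2 x‖ ^ 2 * ‖F p.1 x‖ ^ (2 * q)) :=
      Finset.sum_le_sum fun p _ => norm_mul_pow_le _ _ (norm_nonneg _) (norm_nonneg _) hq
    have h4 : 0 ≤ ∑ i ∈ C, ‖F i x‖ ^ (2 * (q + 1)) :=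
      Finset.sum_nonneg fun _ _ => by positivity
    have h5 : 0 ≤ ∑ p ∈ D, ‖F p.1 x‖ ^ (q + 1) * ‖F p.2 x‖ ^ (q + 1) :=
      Finset.sum_nonneg fun _ _ => by positivity
    rw [tp_eq_sum_filter a S (cube φ s) x]
    rcases broad_narrow C (fun i => F i x) Near (fun i _ => card_near_le C i) hm
      (Nat.succ_ne_zero q) with h | h
    · refine h.trans (le_add_of_nonneg_right ?_)
      exact mul_nonneg (by positivity) (h5.trans h3)
    · refine h.trans (le_trans ?_ (le_add_of_nonneg_left (by positivity)))
      gcongr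
  have hsum : ∀ p ∈ D, avg (fun x => ‖F p.1 x‖ ^ 2 * ‖F p.2 x‖ ^ (2 * q) +
        ‖F p.2 x‖ ^ 2 * ‖F p.1 x‖ ^ (2 * q)) ≤ 2 * Y := by
    intro p hp
    obtain ⟨hp1, hp2⟩ := Finset.mem_filter.mp hp
    obtain ⟨hp3, hp4⟩ := Finset.mem_product.mp hp1
    rw [avg_add (by fun_prop) (by fun_prop)]
    refine (add_le_add (h2 _ hp3 _ hp4 hp2) (h2 _ hp4 _ hp3 fun hn => hp2 fun i => ?_)).trans_eq
      (two_mul Y).symm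
    rw [abs_sub_comm]; exact hn i
  refine (avg_mono (by fun_prop) (by fun_prop) hpt).trans ?_
  rw [avg_add (by fun_prop) (by fun_prop), avg_const_mul, avg_const_mul,
    avg_sum _ fun i _ => by fun_prop, avg_sum _ fun i _ => by fun_prop]
  gcongr
  · refine (Finset.sum_le_sum h1).trans ?_
    rw [← Finset.mul_sum]
    gcongr
    refine (sum_pow_succ_le _ _ (fun i _ => mass_nonneg _ _) q).trans (le_of_eq ?_)
    rw [sum_mass_filter]
  · refine (Finset.sum_le_sum hsum).trans ?_
    rw [Finset.sum_const, nsmul_eq_mul]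
    gcongr
    calc (D.card : ℝ) ≤ ((C ×ˢ C).card : ℝ) := by exact_mod_cast Finset.card_filter_le _ _
      _ = (C.card : ℝ) * C.card := by rw [Finset.card_product]; push_cast; ring
      _ ≤ m ^ 2 := by rw [sq]; gcongr

lemma linear_improve {P : (Freq →+ V3) → Prop} {q : ℕ} (hq : q ≠ 0) {η₀ η B : ℝ} (hη₀ : 0 < η₀)
    (hη : η₀ ≤ η) (hB : 1 ≤ B) (hE : LinearBound P q η)
    (hM : BilinearBound P q η (12 * q + 25) B) :
    LinearBound P q (η - 1 / (B + 1) * min η₀ 1) := by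
  obtain ⟨A1, hA1, hE⟩ := hE
  obtain ⟨A2, hA2, hM⟩ := hM
  set g := min η₀ 1 with hg
  have hg0 : 0 < g := lt_min hη₀ one_pos
  have hg1 : g ≤ 1 := min_le_right _ _
  have hgη : g ≤ η := (min_le_left _ _).trans hη
  have hη0 : 0 < η := hη₀.trans_le hη
  set c : ℝ := 12 * q + 25 with hc
  refine ⟨A1 * 2 ^ g + 54 ^ (2 * (q + 1)) * (A1 * 2 ^ η) +
    2 * 2 ^ (2 * (q + 1)) * 125 ^ (2 * q + 4) * 343 ^ (2 * q + 4) * (A2 * 2 ^ η * 2 ^ c),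
    by positivity, fun φ S Λ T ν hP hS a R hTR hd => ?_⟩
  have hT := hS.pos
  have hν := hS.nonneg
  have hW := mass_nonneg a S
  have hR : 0 < R := hT.trans_le hTR
  set x := R / T with hx
  have hx1 : 1 ≤ x := by rw [hx, one_le_div hT]; exact hTR
  have hx0 : 0 < x := by linarith
  set K := x ^ (1 / (B + 1)) with hK
  have hK1 : 1 ≤ K := Real.one_le_rpow hx1 (by positivity)
  have hK0 : 0 < K := by linarith
  have hxK : K ^ (B + 1) = x := by
    rw [hK, ← Real.rpow_mul hx0.le, one_div_mul_cancel (by positivity), Real.rpow_one]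
  have hRx : R = x * T := by rw [hx]; field_simp
  have hexp : x ^ (η - 1 / (B + 1) * g) = x ^ η * K ^ (-g) := by
    rw [hK, ← Real.rpow_mul hx0.le, ← Real.rpow_add hx0]; congr 1; ring
  rw [hexp]
  have h54 : 0 ≤ ν ^ q * x ^ η * K ^ (-g) * mass a S ^ (q + 1) := by positivity
  rcases lt_or_ge K 2 with hK2 | hK2
  · refine (hE φ S Λ T ν hP hS a R hTR hd).trans ?_
    have h1 : (1 : ℝ) ≤ 2 ^ g * K ^ (-g) := by
      rw [Real.rpow_neg hK0.le, ← div_eq_mul_inv, one_le_div (by positivity)]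
      exact Real.rpow_le_rpow hK0.le hK2.le hg0.le
    calc A1 * ν ^ q * x ^ η * mass a S ^ (q + 1)
        ≤ A1 * ν ^ q * x ^ η * mass a S ^ (q + 1) * (2 ^ g * K ^ (-g)) :=
          le_mul_of_one_le_right (by positivity) h1
      _ = (A1 * 2 ^ g) * (ν ^ q * x ^ η * K ^ (-g) * mass a S ^ (q + 1)) := by ring
      _ ≤ (A1 * 2 ^ g + 54 ^ (2 * (q + 1)) * (A1 * 2 ^ η) +
          2 * 2 ^ (2 * (q + 1)) * 125 ^ (2 * q + 4) * 343 ^ (2 * q + 4) * (A2 * 2 ^ η * 2 ^ c)) *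
          (ν ^ q * x ^ η * K ^ (-g) * mass a S ^ (q + 1)) := by
          gcongr
          rw [add_assoc]
          exact le_add_of_nonneg_right (by positivity)
      _ = _ := by ring
  have hs : 0 < R / K := by positivity
  have hs2 : 0 < R / K ^ 2 := by positivity
  have hKx : K * T ≤ R := by
    rw [hRx]; gcongr
    rw [← hxK]
    exact Real.self_le_rpow_of_one_le hK1 (by linarith)
  have hK2x : K ^ 2 * T ≤ R := by
    rw [hRx]; gcongr
    rw [← hxK, ← Real.rpow_natCast]
    exact Real.rpow_le_rpow_of_exponent_le hK1 (by push_cast; linarith)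
  have hm : ((S.image (cube φ (R / K))).card : ℝ) ≤ 125 * K ^ 3 := by
    refine (card_image_cube_le hs hR.le hd).trans ?_
    have : R / (R / K) = K := by field_simp
    rw [this]
    calc (2 * K + 3) ^ 3 ≤ (5 * K) ^ 3 := by gcongr; linarith
      _ = _ := by ring
  have hdi : ∀ i, ∀ k ∈ S.filter (fun k => cube φ (R / K) k = i),
      ∀ l ∈ S.filter (fun k => cube φ (R / K) k = i), ‖φ k - φ l‖ ≤ 2 * (R / K) := by
    intro i k hk l hl
    exact norm_sub_le_of_cube_eq hs
      ((Finset.mem_filter.mp hk).2.trans (Finset.mem_filter.mp hl).2.symm)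
  have hN : ∀ i, (((S.filter (fun k => cube φ (R / K) k = i)).image (cube φ (R / K ^ 2))).card : ℝ)
      ≤ 343 * K ^ 3 := by
    intro i
    refine (card_image_cube_le hs2 (by positivity) (hdi i)).trans ?_
    have : 2 * (R / K) / (R / K ^ 2) = 2 * K := by field_simp
    rw [this]
    calc (2 * (2 * K) + 3) ^ 3 ≤ (7 * K) ^ 3 := by gcongr; linarith
      _ = _ := by ring
  have hcast : ∀ n : ℕ, K ^ n = K ^ (n : ℝ) := fun n => (Real.rpow_natCast K n).symm
  set X := A1 * ν ^ q * (2 * (R / K) / T) ^ η with hXdef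
  set Z := A2 * ν ^ q * (2 * (R / K ^ 2) / T) ^ η * (2 * (R / K ^ 2) / (R / K)) ^ c *
    mass a S ^ (q + 1) with hZdef
  have hXnn : 0 ≤ X := by positivity
  have hZnn : 0 ≤ Z := by positivity
  have main := avg_le_narrow_add_broad a S φ (R / K) hq hm
    (X := X) (Y := (343 * K ^ 3) ^ (2 * q + 4) * Z) (by positivity)
    (fun i _ => hE φ _ Λ T ν hP (hS.mono (Finset.filter_subset _ _)) a (2 * (R / K))
      (by rw [← mul_div_assoc, le_div_iff₀ hK0]; linarith) (hdi i)) hXnn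
    (fun i _ j _ hij => by
      refine avg_split a _ _ (cube φ (R / K ^ 2)) (hN i) (hN j) hq hZnn fun u _ v _ => ?_
      have hsub : ∀ i u, ((S.filter (fun k => cube φ (R / K) k = i)).filter
        (fun k => cube φ (R / K ^ 2) k = u)) ⊆ S := fun i u =>
          (Finset.filter_subset _ _).trans (Finset.filter_subset _ _)
      have hdu : ∀ i u, ∀ k ∈ (S.filter (fun k => cube φ (R / K) k = i)).filter
        (fun k => cube φ (R / K ^ 2) k = u), ∀ l ∈ (S.filter (fun k => cube φ (R / K) k = i)).filter
        (fun k => cube φ (R / K ^ 2) k = u), ‖φ k - φ l‖ ≤ 2 * (R / K ^ 2) := by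
        intro i u k hk l hl
        exact norm_sub_le_of_cube_eq hs2
          ((Finset.mem_filter.mp hk).2.trans (Finset.mem_filter.mp hl).2.symm)
      have hr : 2 * (R / K ^ 2) / (R / K) = 2 / K := by field_simp
      refine (hM φ S Λ T ν hP hS a _ _ (2 * (R / K ^ 2)) (R / K) (hsub i u) (hsub j v) ?_ ?_ ?_
        (hdu i u) (hdu j v) ?_).trans ?_
      · rw [← mul_div_assoc, le_div_iff₀ (by positivity)]; linarith
      · rw [← div_le_one hs, hr, div_le_one hK0]; exact hK2
      · rw [hr]
        have h3 : (1 / K) ^ B ≤ (2 / K) ^ B :=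
          Real.rpow_le_rpow (by positivity) (by gcongr; norm_num) (by linarith)
        have h4 : R / K * (1 / K) ^ B = T := by
          rw [one_div, Real.inv_rpow hK0.le, hRx, ← hxK, Real.rpow_add hK0, Real.rpow_one]
          field_simp
        calc T = R / K * (1 / K) ^ B := h4.symm
          _ ≤ _ := by gcongr
      · intro k hk l hl
        by_contra! hlt
        refine hij ?_
        have h5 := (Finset.mem_filter.mp (Finset.mem_filter.mp hk).1).2
        have h6 := (Finset.mem_filter.mp (Finset.mem_filter.mp hl).1).2
        rw [← h5, ← h6]
        exact near_of_norm hs hlt.le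
      · rw [hZdef]
        gcongr
        rw [pow_succ' (mass a S)]
        have h7 := mass_nonneg a ((S.filter (fun k => cube φ (R / K) k = j)).filter
          (fun k => cube φ (R / K ^ 2) k = v))
        gcongr
        · exact mass_mono a (hsub i u)
        · exact mass_mono a (hsub j v))
  refine main.trans ?_
  have hX2 : X ≤ A1 * 2 ^ η * (ν ^ q * x ^ η * K ^ (-g)) := by
    have h8 : 2 * (R / K) / T = 2 * x * K⁻¹ := by rw [hRx]; field_simp
    rw [hXdef, h8, Real.mul_rpow (by positivity) (by positivity),
      Real.mul_rpow (by positivity) (by positivity), Real.inv_rpow hK0.le, ← Real.rpow_neg hK0.le]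
    have h9 : K ^ (-η) ≤ K ^ (-g) := Real.rpow_le_rpow_of_exponent_le hK1 (by linarith)
    calc A1 * ν ^ q * (2 ^ η * x ^ η * K ^ (-η)) ≤ A1 * ν ^ q * (2 ^ η * x ^ η * K ^ (-g)) := by
          gcongr
      _ = _ := by ring
  have hZ2 : K ^ (12 * q + 24) * Z ≤ A2 * 2 ^ η * 2 ^ c *
      (ν ^ q * x ^ η * K ^ (-g) * mass a S ^ (q + 1)) := by
    have h8 : 2 * (R / K ^ 2) / T = 2 * x * (K ^ 2)⁻¹ := by rw [hRx]; field_simp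
    have h8' : 2 * (R / K ^ 2) / (R / K) = 2 * K⁻¹ := by field_simp
    have h10 : ((K ^ 2)⁻¹) ^ η ≤ 1 :=
      Real.rpow_le_one (by positivity) (inv_le_one_of_one_le₀ (one_le_pow₀ hK1)) hη0.le
    have h11 : K ^ (12 * q + 24) * K⁻¹ ^ c ≤ K ^ (-g) := by
      rw [Real.inv_rpow hK0.le, ← Real.rpow_neg hK0.le, hcast, ← Real.rpow_add hK0]
      refine Real.rpow_le_rpow_of_exponent_le hK1 ?_
      rw [hc]; push_cast; linarith
    rw [hZdef, h8, h8', Real.mul_rpow (by positivity) (by positivity),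
      Real.mul_rpow (by positivity) (by positivity),
      Real.mul_rpow (x := 2) (z := c) (by positivity) (by positivity)]
    calc _ = (A2 * 2 ^ η * 2 ^ c) * (ν ^ q * x ^ η * mass a S ^ (q + 1)) * ((K ^ 2)⁻¹) ^ η *
          (K ^ (12 * q + 24) * K⁻¹ ^ c) := by ring
      _ ≤ (A2 * 2 ^ η * 2 ^ c) * (ν ^ q * x ^ η * mass a S ^ (q + 1)) * 1 * K ^ (-g) := by gcongr
      _ = _ := by ring
  set U := ν ^ q * x ^ η * K ^ (-g) with hU
  have hUnn : 0 ≤ U := by positivity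
  calc _ = 54 ^ (2 * (q + 1)) * (X * mass a S ^ (q + 1)) +
        2 * 2 ^ (2 * (q + 1)) * 125 ^ (2 * q + 4) * 343 ^ (2 * q + 4) *
          (K ^ (12 * q + 24) * Z) := by
        have e1 : (2 * (125 * K ^ 3)) ^ (2 * (q + 1)) =
          2 ^ (2 * (q + 1)) * 125 ^ (2 * (q + 1)) * (K ^ 3) ^ (2 * (q + 1)) := by
          rw [mul_pow, mul_pow]; ring
        have e2 : (343 * K ^ 3) ^ (2 * q + 4) = 343 ^ (2 * q + 4) * (K ^ 3) ^ (2 * q + 4) :=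
          mul_pow _ _ _
        have e3 : K ^ (12 * q + 24) =
          (K ^ 3) ^ (2 * (q + 1)) * ((K ^ 3) ^ 2 * (K ^ 3) ^ (2 * q + 4)) := by
          rw [← pow_add, ← pow_add, ← pow_mul]; congr 1; ring
        have e4 : (125 : ℝ) ^ (2 * q + 4) = 125 ^ (2 * (q + 1)) * 125 ^ 2 := by
          ring
        rw [e1, e2, e3, e4]; ring
    _ ≤ 54 ^ (2 * (q + 1)) * (A1 * 2 ^ η * U * mass a S ^ (q + 1)) +
        2 * 2 ^ (2 * (q + 1)) * 125 ^ (2 * q + 4) * 343 ^ (2 * q + 4) *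
          (A2 * 2 ^ η * 2 ^ c * (U * mass a S ^ (q + 1))) := by gcongr
    _ = (54 ^ (2 * (q + 1)) * (A1 * 2 ^ η) +
        2 * 2 ^ (2 * (q + 1)) * 125 ^ (2 * q + 4) * 343 ^ (2 * q + 4) * (A2 * 2 ^ η * 2 ^ c)) *
          (U * mass a S ^ (q + 1)) := by ring
    _ ≤ (A1 * 2 ^ g + (54 ^ (2 * (q + 1)) * (A1 * 2 ^ η) +
        2 * 2 ^ (2 * (q + 1)) * 125 ^ (2 * q + 4) * 343 ^ (2 * q + 4) * (A2 * 2 ^ η * 2 ^ c))) *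
          (U * mass a S ^ (q + 1)) := by
        refine mul_le_mul_of_nonneg_right ?_ (by positivity)
        have : (0 : ℝ) ≤ A1 * 2 ^ g := by positivity
        linarith
    _ = _ := by rw [hU]; ring

lemma LinearBound.mono {P : (Freq →+ V3) → Prop} {q : ℕ} {η η' : ℝ}
    (h : LinearBound P q η) (hη : η ≤ η') : LinearBound P q η' := by
  obtain ⟨A, hA, h⟩ := h
  refine ⟨A, hA, fun φ S Λ T ν hP hS a R hTR hd => ?_⟩
  have hT := hS.pos
  have hν := hS.nonneg
  have hW := mass_nonneg a S
  refine (h φ S Λ T ν hP hS a R hTR hd).trans ?_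
  have : (R / T) ^ η ≤ (R / T) ^ η' :=
    Real.rpow_le_rpow_of_exponent_le (by rw [one_le_div hT]; exact hTR) hη
  gcongr

/-- The linear estimate holds with an arbitrarily small loss as soon as the bilinear gain can be
improved. -/
theorem linearBound_of_step {P : (Freq →+ V3) → Prop} {q : ℕ} (hq : q ≠ 0)
    (hstep : BilinearStep P q) {η₀ : ℝ} (hη₀ : 0 < η₀) : LinearBound P q η₀ := by
  obtain ⟨B, hB, hM⟩ := bilinear_iterate hq hstep hη₀ (cmax := 12 * q + 25) (by positivity)
  set g := 1 / (B + 1) * min η₀ 1 with hg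
  have hg0 : 0 < g := mul_pos (by positivity) (lt_min hη₀ one_pos)
  have key : ∀ j : ℕ, LinearBound P q (max η₀ (3 * q - j * g)) := by
    intro j
    induction j with
    | zero => exact (linear_base P q).mono (by simp)
    | succ j ih =>
      rcases le_total (3 * (q : ℝ)) η₀ with h | h
      · exact (linear_base P q).mono (h.trans (le_max_left _ _))
      rcases le_total (3 * (q : ℝ) - j * g) η₀ with h3 | h3
      · rw [max_eq_left h3] at ih
        exact ih.mono (le_max_left _ _)
      · rw [max_eq_right h3] at ih
        have hle : 3 * (q : ℝ) - j * g ≤ 3 * q := by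
          have : 0 ≤ (j : ℝ) * g := by positivity
          linarith
        refine (linear_improve hq hη₀ h3 hB ih (hM _ h3 hle ih)).mono ?_
        refine le_trans (le_of_eq ?_) (le_max_right _ _)
        push_cast; ring
  obtain ⟨j, hj⟩ := exists_nat_ge (3 * q / g)
  have := key j
  rwa [max_eq_left] at this
  have := (div_le_iff₀ hg0).mp hj
  linarith

/-- The cell of `φ k` in the family of strips of width `h` orthogonal to `u`. -/
def strip (φ : Freq →+ V3) (u : V3) (h : ℝ) (k : Freq) : ℤ := ⌊inner ℝ (φ k) u / h⌋

lemma abs_inner_sub_le_of_strip_eq {φ : Freq →+ V3} {u : V3} {h : ℝ} (hh : 0 < h) {k l : Freq}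
    (hkl : strip φ u h k = strip φ u h l) : |inner ℝ (φ k - φ l) u| ≤ h := by
  have h2 := (Int.abs_sub_lt_one_of_floor_eq_floor hkl).le
  rw [← sub_div, abs_div, abs_of_pos hh, div_le_one hh] at h2
  rwa [inner_sub_left]

lemma card_abs_sub_le_one_le (C : Finset ℤ) (c : ℤ) :
    (C.filter fun j => |c - j| ≤ 1).card ≤ 3 := by
  have h : (C.filter fun j => |c - j| ≤ 1) ⊆ Finset.Icc (c - 1) (c + 1) := by
    intro j hj
    have := abs_le.mp (Finset.mem_filter.mp hj).2
    rw [Finset.mem_Icc]; omega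
  refine (Finset.card_le_card h).trans ?_
  rw [Int.card_Icc]; omega

lemma orth_strip (a : Freq → ℂ) (I J : Finset Freq) (φ : Freq →+ V3) (u : V3) {s : ℝ} (hs : 0 < s)
    (h : ∀ k ∈ I, ∀ l ∈ I, ∀ z ∈ J, ∀ w ∈ J, k + z = l + w → |inner ℝ (φ k - φ l) u| ≤ s) :
    avg (fun x => ‖tp a I x‖ ^ 2 * ‖tp a J x‖ ^ 2) ≤
      3 * ∑ i ∈ I.image (strip φ u s),
        avg (fun x => ‖tp a (I.filter fun k => strip φ u s k = i) x‖ ^ 2 * ‖tp a J x‖ ^ 2) :=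
  orth_adj a I (strip φ u s) (fun i j => |i - j| ≤ 1) 3 (fun i => card_abs_sub_le_one_le _ i) J a id
    fun k hk l hl z hz w hw hkl => by
      have h1 := h k hk l hl z hz w hw hkl
      rw [inner_sub_left] at h1
      have := abs_floor_sub_le hs (n := 1) (x := inner ℝ (φ k) u) (y := inner ℝ (φ l) u)
        (by simpa using h1)
      exact_mod_cast this

lemma avg_mul_comm (f g : (Fin 3 → ℝ) → ℝ) :
    avg (fun x => f x * g x) = avg (fun x => g x * f x) := by
  congr 1; ext x; exact mul_comm _ _

lemma sum_mass_mul_le {ι : Type*} [DecidableEq ι] {a : Freq → ℂ} {I : Finset Freq} {cell : Freq → ι}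
    {f : ι → ℝ} {X Y m : ℝ} (hm : 0 ≤ m)
    (h : ∀ i ∈ I.image cell, f i ≤ X * (mass a (I.filter fun k => cell k = i) * Y)) :
    m * ∑ i ∈ I.image cell, f i ≤ m * (X * (mass a I * Y)) := by
  gcongr
  refine (Finset.sum_le_sum h).trans (le_of_eq ?_)
  rw [← Finset.mul_sum, ← Finset.sum_mul, sum_mass_filter]

lemma avg_le_of_strips (a : Freq → ℂ) (I J : Finset Freq) (φ : Freq →+ V3) (u : V3) {s X : ℝ}
    (hs : 0 < s)
    (h : ∀ k ∈ I, ∀ l ∈ I, ∀ z ∈ J, ∀ w ∈ J, k + z = l + w → |inner ℝ (φ k - φ l) u| ≤ s)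
    (H : ∀ I' ⊆ I, ∀ J' ⊆ J, (∀ k ∈ I', ∀ l ∈ I', |inner ℝ (φ k - φ l) u| ≤ s) →
      (∀ k ∈ J', ∀ l ∈ J', |inner ℝ (φ k - φ l) u| ≤ s) →
      avg (fun x => ‖tp a I' x‖ ^ 2 * ‖tp a J' x‖ ^ 2) ≤ X * (mass a I' * mass a J')) :
    avg (fun x => ‖tp a I x‖ ^ 2 * ‖tp a J x‖ ^ 2) ≤ 9 * X * (mass a I * mass a J) := by
  have hdi : ∀ (L : Finset Freq) (i : ℤ), ∀ k ∈ L.filter (fun k => strip φ u s k = i),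
      ∀ l ∈ L.filter (fun k => strip φ u s k = i), |inner ℝ (φ k - φ l) u| ≤ s :=
    fun L i k hk l hl => abs_inner_sub_le_of_strip_eq hs
      ((Finset.mem_filter.mp hk).2.trans (Finset.mem_filter.mp hl).2.symm)
  refine (orth_strip a I J φ u hs h).trans ((sum_mass_mul_le (X := 3 * X) (Y := mass a J)
    (by norm_num) fun i _ => ?_).trans (le_of_eq (by ring)))
  rw [avg_mul_comm]
  set I' := I.filter fun k => strip φ u s k = i with hI'
  have hI : I' ⊆ I := Finset.filter_subset _ _
  refine (orth_strip a J I' φ u hs fun k hk l hl z hz w hw hkl => ?_).trans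
    ((sum_mass_mul_le (X := X) (Y := mass a I') (by norm_num) fun j _ => ?_).trans
      (le_of_eq (by ring)))
  · have h2 := h w (hI hw) z (hI hz) l hl k hk (by rw [add_comm w, add_comm z, hkl])
    have h3 : φ k - φ l = φ w - φ z := by
      rw [sub_eq_sub_iff_add_eq_add, ← map_add, hkl, map_add, add_comm]
    rwa [h3]
  · rw [avg_mul_comm, mul_comm (mass a _)]
    exact H I' hI _ (Finset.filter_subset _ _) (hdi I i) (hdi J j)

lemma avg_le_of_cubes (a : Freq → ℂ) (I J : Finset Freq) (φ : Freq →+ V3) {s X : ℝ}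
    (hs : 0 < s)
    (h : ∀ k ∈ I, ∀ l ∈ I, ∀ z ∈ J, ∀ w ∈ J, k + z = l + w → Near (cube φ s k) (cube φ s l))
    (H : ∀ I' ⊆ I, (∀ k ∈ I', ∀ l ∈ I', ‖φ k - φ l‖ ≤ 2 * s) →
      avg (fun x => ‖tp a I' x‖ ^ 2 * ‖tp a J x‖ ^ 2) ≤ X * (mass a I' * mass a J)) :
    avg (fun x => ‖tp a I x‖ ^ 2 * ‖tp a J x‖ ^ 2) ≤ 27 * X * (mass a I * mass a J) := by
  refine (orth_cube a I J φ s h).trans ((sum_mass_mul_le (X := X) (Y := mass a J)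
    (by norm_num) fun i _ => ?_).trans (le_of_eq (by ring)))
  exact H _ (Finset.filter_subset _ _) fun k hk l hl => norm_sub_le_of_cube_eq hs
      ((Finset.mem_filter.mp hk).2.trans (Finset.mem_filter.mp hl).2.symm)

lemma avg_le_of_cubes_both (a : Freq → ℂ) (I J : Finset Freq) (φ : Freq →+ V3) {s X : ℝ}
    (hs : 0 < s)
    (h : ∀ k ∈ I, ∀ l ∈ I, ∀ z ∈ J, ∀ w ∈ J, k + z = l + w →
      Near (cube φ s k) (cube φ s l) ∧ Near (cube φ s z) (cube φ s w))
    (H : ∀ I' ⊆ I, ∀ J' ⊆ J, (∀ k ∈ I', ∀ l ∈ I', ‖φ k - φ l‖ ≤ 2 * s) →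
      (∀ k ∈ J', ∀ l ∈ J', ‖φ k - φ l‖ ≤ 2 * s) →
      avg (fun x => ‖tp a I' x‖ ^ 2 * ‖tp a J' x‖ ^ 2) ≤ X * (mass a I' * mass a J')) :
    avg (fun x => ‖tp a I x‖ ^ 2 * ‖tp a J x‖ ^ 2) ≤ 729 * X * (mass a I * mass a J) := by
  refine (avg_le_of_cubes a I J φ (X := 27 * X) hs
    (fun k hk l hl z hz w hw hkl => (h k hk l hl z hz w hw hkl).1) fun I' hI' hd => ?_).trans
      (le_of_eq (by ring))
  rw [avg_mul_comm, mul_comm (mass a I')]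
  refine avg_le_of_cubes a J I' φ hs (fun k hk l hl z hz w hw hkl =>
    (h z (hI' hz) w (hI' hw) k hk l hl (by rw [add_comm, hkl, add_comm])).2) fun J' hJ' hd' => ?_
  rw [avg_mul_comm, mul_comm (mass a J')]
  exact H I' hI' J' hJ' hd hd'

/-- In a strip, two separated pieces satisfy a transversal orthogonality. -/
lemma near_of_strip {φ : Freq →+ V3} {S : Finset Freq} {Λ T ν ρ ℓ σ s : ℝ} {p u : V3}
    (hS : IsShell φ S Λ T ν) (hp : |‖p‖ ^ 2 - Λ ^ 2| ≤ T ^ 2)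
    (hpu : |‖p - u‖ ^ 2 - Λ ^ 2| ≤ T ^ 2) (hTu : T ≤ ‖u‖) (hu : ‖u‖ ≤ Λ / 10)
    (hℓ : 0 < ℓ) (hℓu : ℓ ≤ ‖u‖) (hTρ : T ≤ ρ) (hTh : T ≤ ρ ^ 2 / ℓ)
    (hσ : 14 * (ρ ^ 2 / ℓ) ≤ σ) (hσ0 : 0 < σ) (hs : 9 * (ρ ^ 2 / ℓ) ≤ s) {L : Finset Freq}
    (hL : L ⊆ S) (hLp : ∀ k ∈ L, ‖φ k - p‖ ≤ ρ)
    (hstrip : ∀ k ∈ L, ∀ l ∈ L, |inner ℝ (φ k - φ l) u| ≤ 4 * ρ ^ 2) {k l z w : Freq}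
    (hk : k ∈ L) (hl : l ∈ L) (hz : z ∈ L) (hw : w ∈ L) (hkl : k + z = l + w)
    (hkw : σ ≤ ‖φ k - φ w‖) : Near (cube φ s k) (cube φ s l) := by
  have hT := hS.pos
  have hTT : T ^ 2 ≤ ρ ^ 2 := by gcongr
  have hin : ∀ k ∈ L, ∀ l ∈ L, |inner ℝ (φ k - φ l) p| ≤ 4 * ρ ^ 2 := fun k hk l hl =>
    (abs_inner_sub_le (hS.shell k (hL hk)) (hS.shell l (hL hl)) (hLp k hk) (hLp l hl)).trans
      (by nlinarith)
  have h6 : ∀ k ∈ L, ∀ l ∈ L, |inner ℝ (φ k - φ l) u| ≤ 6 * ρ ^ 2 := fun k hk l hl =>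
    (hstrip k hk l hl).trans (by nlinarith)
  have h5 : |inner ℝ (φ k - φ l) (φ k - φ w)| ≤ 2 * T ^ 2 := by
    have hz' : φ z = φ l + φ w - φ k := by
      rw [eq_sub_iff_add_eq, ← map_add, ← map_add, add_comm, hkl]
    have e : 2 * inner ℝ (φ k - φ l) (φ k - φ w) =
        ‖φ k‖ ^ 2 + ‖φ z‖ ^ 2 - ‖φ l‖ ^ 2 - ‖φ w‖ ^ 2 := by
      rw [hz', inner_three]
      simp only [norm_sq_three, PiLp.sub_apply, PiLp.add_apply]
      ring
    have e1 := abs_le.mp (hS.shell k (hL hk))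
    have e2 := abs_le.mp (hS.shell l (hL hl))
    have e3 := abs_le.mp (hS.shell z (hL hz))
    have e4 := abs_le.mp (hS.shell w (hL hw))
    rw [abs_le]; constructor <;> linarith
  have hρ : 0 < ρ := hT.trans_le hTρ
  have hs0 : 0 < s := lt_of_lt_of_le (by positivity) hs
  exact near_of_norm hs0 ((norm_le_of_inner_le hp hpu hT.le hTu hu hℓ hℓu (hin k hk l hl)
    (h6 k hk l hl) (hin k hk w hw) (h6 k hk w hw) h5 hTh hσ hkw hσ0).trans hs)

/-- A product of two quadratic quantities from narrow and broad parts. -/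
lemma sq_mul_sq_le_narrow_broad {F G n b n' b' : ℝ} (hF : 0 ≤ F) (hG : 0 ≤ G) (hn : 0 ≤ n)
    (hn' : 0 ≤ n') (hb : 0 ≤ b) (hb' : 0 ≤ b') (h : F ≤ n ∨ F ≤ b) (h' : G ≤ n' ∨ G ≤ b') :
    F * G ≤ n * G + F * n' + b * b' := by
  have h1 : 0 ≤ n * G := by positivity
  have h2 : 0 ≤ F * n' := by positivity
  have h3 : 0 ≤ b * b' := by positivity
  rcases h with h | h
  · have : F * G ≤ n * G := by gcongr
    linarith
  rcases h' with h' | h'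
  · have : F * G ≤ F * n' := by gcongr
    linarith
  · have : F * G ≤ b * b' := by gcongr
    linarith

lemma avg_le_of_strip_pair (a : Freq → ℂ) (I J : Finset Freq) (φ : Freq →+ V3) {σ m X₁ X₂ : ℝ}
    (hσ : 0 < σ) (hX₂ : 0 ≤ X₂) (hmI : ((I.image (cube φ σ)).card : ℝ) ≤ m)
    (hmJ : ((J.image (cube φ σ)).card : ℝ) ≤ m)
    (h1 : ∀ I' ⊆ I, ∀ J' ⊆ J, (∀ k ∈ I', ∀ l ∈ I', ‖φ k - φ l‖ ≤ 2 * σ) →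
      (∀ k ∈ J', ∀ l ∈ J', ‖φ k - φ l‖ ≤ 2 * σ) →
      avg (fun x => ‖tp a I' x‖ ^ 2 * ‖tp a J' x‖ ^ 2) ≤ X₁ * (mass a I' * mass a J'))
    (h2 : ∀ I' ⊆ I, ∀ I'' ⊆ I, (∀ k ∈ I', ∀ l ∈ I'', σ ≤ ‖φ k - φ l‖) →
      avg (fun x => ‖tp a I' x‖ ^ 2 * ‖tp a I'' x‖ ^ 2) ≤ X₂ * (mass a I' * mass a I''))
    (h3 : ∀ J' ⊆ J, ∀ J'' ⊆ J, (∀ k ∈ J', ∀ l ∈ J'', σ ≤ ‖φ k - φ l‖) →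
      avg (fun x => ‖tp a J' x‖ ^ 2 * ‖tp a J'' x‖ ^ 2) ≤ X₂ * (mass a J' * mass a J'')) :
    avg (fun x => ‖tp a I x‖ ^ 2 * ‖tp a J x‖ ^ 2) ≤
      (2 * 54 ^ 2 * 27 * X₁ + 16 * m ^ 8 * X₂) * (mass a I * mass a J) := by
  have hm0 : 0 ≤ m := le_trans (by positivity) hmI
  have hWI := mass_nonneg a I
  have hWJ := mass_nonneg a J
  set F : Finset Freq → (Fin 3 → ℤ) → (Fin 3 → ℝ) → ℂ :=
    fun L i => tp a (L.filter fun k => cube φ σ k = i) with hF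
  have hFc : ∀ L i, Continuous (F L i) := fun L i => continuous_tp _ _
  set C : Finset Freq → Finset (Fin 3 → ℤ) := fun L => L.image (cube φ σ) with hC
  set D : Finset Freq → Finset ((Fin 3 → ℤ) × (Fin 3 → ℤ)) := fun L =>
    (C L ×ˢ C L).filter (fun p => ¬ Near p.1 p.2) with hD
  have hdi : ∀ (L : Finset Freq) i, ∀ k ∈ L.filter (fun k => cube φ σ k = i),
      ∀ l ∈ L.filter (fun k => cube φ σ k = i), ∀ t, |φ k t - φ l t| ≤ σ := by
    intro L i k hk l hl t
    exact abs_coord_sub_le_of_cube_eq hσ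
      ((Finset.mem_filter.mp hk).2.trans (Finset.mem_filter.mp hl).2.symm) t
  have hbn : ∀ L : Finset Freq, ((C L).card : ℝ) ≤ m → ∀ x,
      ‖tp a L x‖ ^ 2 ≤ 54 ^ 2 * ∑ i ∈ C L, ‖F L i x‖ ^ 2 ∨
      ‖tp a L x‖ ^ 2 ≤ (2 * m) ^ 2 * ∑ p ∈ D L, ‖F L p.1 x‖ * ‖F L p.2 x‖ := by
    intro L hL x
    have := broad_narrow (C L) (fun i => F L i x) Near (fun i _ => card_near_le (C L) i) hL
      (n := 1) one_ne_zero
    simp only [mul_one, pow_one] at this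
    rw [tp_eq_sum_filter a L (cube φ σ) x]
    exact this
  have hDcard : ∀ L : Finset Freq, ((C L).card : ℝ) ≤ m → ((D L).card : ℝ) ≤ m ^ 2 := by
    intro L hL
    calc ((D L).card : ℝ) ≤ ((C L ×ˢ C L).card : ℝ) := by exact_mod_cast Finset.card_filter_le _ _
      _ = ((C L).card : ℝ) * (C L).card := by rw [Finset.card_product]; push_cast; ring
      _ ≤ m ^ 2 := by rw [sq]; gcongr
  have hsep : ∀ L : Finset Freq, ∀ p ∈ D L, ∀ k ∈ L.filter (fun k => cube φ σ k = p.1),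
      ∀ l ∈ L.filter (fun k => cube φ σ k = p.2), σ ≤ ‖φ k - φ l‖ := by
    intro L p hp k hk l hl
    by_contra! hlt
    refine (Finset.mem_filter.mp hp).2 ?_
    rw [← (Finset.mem_filter.mp hk).2, ← (Finset.mem_filter.mp hl).2]
    exact near_of_norm hσ hlt.le
  have hnear : ∀ (L : Finset Freq) i, ∀ (L' : Finset Freq), ∀ k ∈ L', ∀ l ∈ L',
      ∀ z ∈ L.filter (fun k => cube φ σ k = i), ∀ w ∈ L.filter (fun k => cube φ σ k = i),
      k + z = l + w → Near (cube φ σ k) (cube φ σ l) := by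
    intro L i L' k _ l _ z hz w hw hkl
    refine near_of_coord hσ fun t => ?_
    have h3 : φ k - φ l = φ w - φ z := by
      rw [sub_eq_sub_iff_add_eq_add, ← map_add, hkl, map_add, add_comm]
    have h4 : φ k t - φ l t = φ w t - φ z t := congrArg (fun v : V3 => v t) h3
    rw [h4]
    exact hdi L i w hw z hz t
  have hpt : ∀ x, ‖tp a I x‖ ^ 2 * ‖tp a J x‖ ^ 2 ≤
      (54 ^ 2 * ∑ i ∈ C I, ‖F I i x‖ ^ 2 * ‖tp a J x‖ ^ 2 +
        54 ^ 2 * ∑ j ∈ C J, ‖F J j x‖ ^ 2 * ‖tp a I x‖ ^ 2) +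
      (2 * m) ^ 4 * ∑ p ∈ D I, ∑ p' ∈ D J,
        (‖F I p.1 x‖ * ‖F I p.2 x‖) * (‖F J p'.1 x‖ * ‖F J p'.2 x‖) := by
    intro x
    refine (sq_mul_sq_le_narrow_broad (by positivity) (by positivity)
      (by positivity)
      (by positivity)
      (mul_nonneg (by positivity) (Finset.sum_nonneg fun _ _ => by positivity))
      (mul_nonneg (by positivity) (Finset.sum_nonneg fun _ _ => by positivity))
      (hbn I hmI x) (hbn J hmJ x)).trans (le_of_eq ?_)
    rw [← Finset.sum_mul, ← Finset.sum_mul, ← Finset.sum_mul_sum]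
    ring
  have hnar : ∀ L L' : Finset Freq, (∀ I' ⊆ L, ∀ J' ⊆ L',
      (∀ k ∈ I', ∀ l ∈ I', ‖φ k - φ l‖ ≤ 2 * σ) → (∀ k ∈ J', ∀ l ∈ J', ‖φ k - φ l‖ ≤ 2 * σ) →
      avg (fun x => ‖tp a I' x‖ ^ 2 * ‖tp a J' x‖ ^ 2) ≤ X₁ * (mass a I' * mass a J')) →
      54 ^ 2 * ∑ i ∈ C L, avg (fun x => ‖F L i x‖ ^ 2 * ‖tp a L' x‖ ^ 2) ≤
      54 ^ 2 * ((27 * X₁) * (mass a L * mass a L')) := by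
    intro L L' H
    refine sum_mass_mul_le (by norm_num) fun i _ => ?_
    rw [avg_mul_comm, mul_comm (mass a _)]
    refine avg_le_of_cubes a L' _ φ hσ (hnear L i L') fun J' hJ' hd => ?_
    rw [avg_mul_comm, mul_comm (mass a _)]
    exact H _ (Finset.filter_subset _ _) _ hJ' (fun k hk l hl => norm_sub_le_of_coord
      (hdi L i k hk l hl)) hd
  have hbr : ∀ p ∈ D I, ∀ p' ∈ D J, avg (fun x => (‖F I p.1 x‖ * ‖F I p.2 x‖) *
      (‖F J p'.1 x‖ * ‖F J p'.2 x‖)) ≤ X₂ * (mass a I * mass a J) := by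
    intro p hp p' hp'
    refine (avg_sq_le_mul (P := X₂ * (mass a I * mass a I)) (Q := X₂ * (mass a J * mass a J))
      (by fun_prop) (by fun_prop) ?_ ?_).trans (le_of_eq ?_)
    · simp only [mul_pow]
      refine (h2 _ (Finset.filter_subset _ _) _ (Finset.filter_subset _ _) (hsep I p hp)).trans ?_
      gcongr
      · exact mass_nonneg _ _
      · exact mass_mono a (Finset.filter_subset _ _)
      · exact mass_mono a (Finset.filter_subset _ _)
    · simp only [mul_pow]
      refine (h3 _ (Finset.filter_subset _ _) _ (Finset.filter_subset _ _) (hsep J p' hp')).trans ?_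
      gcongr
      · exact mass_nonneg _ _
      · exact mass_mono a (Finset.filter_subset _ _)
      · exact mass_mono a (Finset.filter_subset _ _)
    · rw [show X₂ * (mass a I * mass a I) * (X₂ * (mass a J * mass a J)) =
        (X₂ * (mass a I * mass a J)) ^ 2 by ring, Real.sqrt_sq (by positivity)]
  refine (avg_mono (by fun_prop) (by fun_prop) hpt).trans ?_
  rw [avg_add (by fun_prop) (by fun_prop), avg_add (by fun_prop) (by fun_prop), avg_const_mul,
    avg_const_mul, avg_const_mul, avg_sum _ fun i _ => by fun_prop, avg_sum _ fun i _ => by fun_prop,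
    avg_sum _ fun i _ => by fun_prop]
  have e1 := hnar I J h1
  have e2 := hnar J I fun J' hJ' I' hI' hd hd' => by
    rw [avg_mul_comm, mul_comm (mass a _)]
    exact h1 I' hI' J' hJ' hd' hd
  have e3 : (2 * m) ^ 4 * ∑ p ∈ D I, avg (fun x => ∑ p' ∈ D J,
        (‖F I p.1 x‖ * ‖F I p.2 x‖) * (‖F J p'.1 x‖ * ‖F J p'.2 x‖)) ≤
      (2 * m) ^ 4 * (m ^ 2 * (m ^ 2 * (X₂ * (mass a I * mass a J)))) := by
    gcongr
    calc _ ≤ ∑ p ∈ D I, m ^ 2 * (X₂ * (mass a I * mass a J)) := by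
          refine Finset.sum_le_sum fun p hp => ?_
          rw [avg_sum _ fun i _ => by fun_prop]
          refine (Finset.sum_le_sum fun p' hp' => hbr p hp p' hp').trans ?_
          rw [Finset.sum_const, nsmul_eq_mul]
          have := hDcard J hmJ
          gcongr
      _ ≤ _ := by
          rw [Finset.sum_const, nsmul_eq_mul]
          have := hDcard I hmI
          gcongr
  calc _ ≤ 54 ^ 2 * ((27 * X₁) * (mass a I * mass a J)) +
        54 ^ 2 * ((27 * X₁) * (mass a J * mass a I)) +
        (2 * m) ^ 4 * (m ^ 2 * (m ^ 2 * (X₂ * (mass a I * mass a J)))) := by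
        gcongr
    _ = _ := by ring

/-- One step of the bilinear induction on scales in `L⁴`. -/
lemma avg_bilinear_le {φ : Freq →+ V3} {S : Finset Freq} {Λ T ν ρ ℓ K X₁ X₂ : ℝ}
    (hS : IsShell φ S Λ T ν) (a : Freq → ℂ) {I J : Finset Freq} (hI : I ⊆ S) (hJ : J ⊆ S)
    (hℓ : 0 < ℓ) (hTρ : T ≤ ρ) (hρℓ : ρ ≤ ℓ) (hTh : T ≤ ρ ^ 2 / ℓ) (hK : 1 ≤ K)
    (hKr : 14 * (ρ ^ 2 / ℓ) ≤ ρ / K) (hX₂ : 0 ≤ X₂)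
    (hdI : ∀ k ∈ I, ∀ l ∈ I, ‖φ k - φ l‖ ≤ ρ) (hdJ : ∀ k ∈ J, ∀ l ∈ J, ‖φ k - φ l‖ ≤ ρ)
    (hd : ∀ k ∈ I, ∀ l ∈ J, ℓ ≤ ‖φ k - φ l‖)
    (h1 : ∀ I' ⊆ I, ∀ J' ⊆ J, (∀ k ∈ I', ∀ l ∈ I', ‖φ k - φ l‖ ≤ 2 * (ρ / K)) →
      (∀ k ∈ J', ∀ l ∈ J', ‖φ k - φ l‖ ≤ 2 * (ρ / K)) →
      avg (fun x => ‖tp a I' x‖ ^ 2 * ‖tp a J' x‖ ^ 2) ≤ X₁ * (mass a I' * mass a J'))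
    (h2 : ∀ I' ⊆ S, ∀ J' ⊆ S, (∀ k ∈ I', ∀ l ∈ I', ‖φ k - φ l‖ ≤ 20 * (ρ ^ 2 / ℓ)) →
      (∀ k ∈ J', ∀ l ∈ J', ‖φ k - φ l‖ ≤ 20 * (ρ ^ 2 / ℓ)) →
      (∀ k ∈ I', ∀ l ∈ J', ρ / K ≤ ‖φ k - φ l‖) →
      avg (fun x => ‖tp a I' x‖ ^ 2 * ‖tp a J' x‖ ^ 2) ≤ X₂ * (mass a I' * mass a J')) :
    avg (fun x => ‖tp a I x‖ ^ 2 * ‖tp a J x‖ ^ 2) ≤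
      9 * (2 * 54 ^ 2 * 27 * X₁ + 16 * (125 * K ^ 3) ^ 8 * (729 * X₂)) *
        (mass a I * mass a J) := by
  have hT := hS.pos
  have hWI := mass_nonneg a I
  have hWJ := mass_nonneg a J
  have hρ : 0 < ρ := hT.trans_le hTρ
  have hK0 : 0 < K := by linarith
  have hσ : 0 < ρ / K := by positivity
  rcases I.eq_empty_or_nonempty with rfl | ⟨i0, hi0⟩
  · simp [tp, avg_const, mass]
  rcases J.eq_empty_or_nonempty with rfl | ⟨j0, hj0⟩
  · simp [tp, avg_const, mass]
  set u := φ i0 - φ j0 with hu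
  have hℓu : ℓ ≤ ‖u‖ := hd i0 hi0 j0 hj0
  have huΛ : ‖u‖ ≤ Λ / 10 := hS.cap _ (hI hi0) _ (hJ hj0)
  have hpI := hS.shell i0 (hI hi0)
  have hpJ := hS.shell j0 (hJ hj0)
  have hTu : T ≤ ‖u‖ := by linarith
  have hTT : T ^ 2 ≤ ρ ^ 2 := by gcongr
  have hm : ∀ L : Finset Freq, (∀ k ∈ L, ∀ l ∈ L, ‖φ k - φ l‖ ≤ ρ) →
      ((L.image (cube φ (ρ / K))).card : ℝ) ≤ 125 * K ^ 3 := by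
    intro L hL
    refine (card_image_cube_le hσ hρ.le hL).trans ?_
    have : ρ / (ρ / K) = K := by field_simp
    rw [this]
    calc (2 * K + 3) ^ 3 ≤ (5 * K) ^ 3 := by gcongr; linarith
      _ = _ := by ring
  refine avg_le_of_strips a I J φ u (s := 4 * ρ ^ 2) (by positivity)
    (fun k hk l hl z hz w hw hkl => ?_) fun I' hI' J' hJ' hsI hsJ => ?_
  · have e1 := abs_inner_sub_le (hS.shell k (hI hk)) (hS.shell l (hI hl)) (hdI k hk i0 hi0)
      (hdI l hl i0 hi0)
    have e2 := abs_inner_sub_le (hS.shell w (hJ hw)) (hS.shell z (hJ hz)) (hdJ w hw j0 hj0)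
      (hdJ z hz j0 hj0)
    have h3 : φ k - φ l = φ w - φ z := by
      rw [sub_eq_sub_iff_add_eq_add, ← map_add, hkl, map_add, add_comm]
    rw [← h3] at e2
    rw [hu, inner_sub_right]
    have e3 := abs_sub (inner ℝ (φ k - φ l) (φ i0)) (inner ℝ (φ k - φ l) (φ j0))
    nlinarith
  · have hself : ∀ L : Finset Freq, L ⊆ S → ∀ p u : V3, |‖p‖ ^ 2 - Λ ^ 2| ≤ T ^ 2 →
        |‖p - u‖ ^ 2 - Λ ^ 2| ≤ T ^ 2 → T ≤ ‖u‖ → ‖u‖ ≤ Λ / 10 → ℓ ≤ ‖u‖ →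
        (∀ k ∈ L, ‖φ k - p‖ ≤ ρ) →
        (∀ k ∈ L, ∀ l ∈ L, |inner ℝ (φ k - φ l) u| ≤ 4 * ρ ^ 2) →
        ∀ F ⊆ L, ∀ G ⊆ L, (∀ k ∈ F, ∀ l ∈ G, ρ / K ≤ ‖φ k - φ l‖) →
        avg (fun x => ‖tp a F x‖ ^ 2 * ‖tp a G x‖ ^ 2) ≤ 729 * X₂ * (mass a F * mass a G) := by
      intro L hL p u hp hpu hTu huΛ hℓu hLp hLu F hF G hG hFG
      refine avg_le_of_cubes_both a F G φ (s := 10 * (ρ ^ 2 / ℓ)) (by positivity)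
        (fun k hk l hl z hz w hw hkl => ?_) fun F' hF' G' hG' hdF hdG =>
          h2 F' (hF'.trans (hF.trans hL)) G' (hG'.trans (hG.trans hL)) ?_ ?_
          fun k hk l hl => hFG k (hF' hk) l (hG' hl)
      · have h910 : 9 * (ρ ^ 2 / ℓ) ≤ 10 * (ρ ^ 2 / ℓ) := by gcongr; norm_num
        constructor
        · exact near_of_strip hS hp hpu hTu huΛ hℓ hℓu hTρ hTh hKr hσ h910 hL hLp hLu
            (hF hk) (hF hl) (hG hz) (hG hw) hkl (hFG k hk w hw)
        · refine near_of_strip hS hp hpu hTu huΛ hℓ hℓu hTρ hTh hKr hσ h910 hL hLp hLu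
            (hG hz) (hG hw) (hF hk) (hF hl) (by rw [add_comm, hkl, add_comm]) ?_
          rw [norm_sub_rev]; exact hFG l hl z hz
      · intro k hk l hl; have := hdF k hk l hl; linarith
      · intro k hk l hl; have := hdG k hk l hl; linarith
    refine avg_le_of_strip_pair a I' J' φ hσ (by positivity)
      ((Nat.cast_le.mpr (Finset.card_le_card (Finset.image_subset_image hI'))).trans (hm I hdI))
      ((Nat.cast_le.mpr (Finset.card_le_card (Finset.image_subset_image hJ'))).trans (hm J hdJ))
      (fun I'' hI'' J'' hJ'' => h1 I'' (hI''.trans hI') J'' (hJ''.trans hJ'))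
      (hself I' (hI'.trans hI) (φ i0) u hpI ?_ hTu huΛ hℓu
        (fun k hk => hdI k (hI' hk) i0 hi0) hsI)
      (hself J' (hJ'.trans hJ) (φ j0) (-u) hpJ ?_ (by rwa [norm_neg]) (by rwa [norm_neg])
        (by rwa [norm_neg]) (fun k hk => hdJ k (hJ' hk) j0 hj0) ?_)
    · rw [hu, sub_sub_cancel]; exact hpJ
    · rw [hu, sub_neg_eq_add, add_sub_cancel]; exact hpI
    · intro k hk l hl
      rw [inner_neg_right, abs_neg]; exact hsJ k hk l hl

lemma BilinearBound.mul_of_ge {P : (Freq →+ V3) → Prop} {q : ℕ} {η c B r0 : ℝ}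
    (h : BilinearBound P q η 0 1) (hc : 0 ≤ c) (hr0 : 0 < r0) :
    ∃ A : ℝ, 0 < A ∧ ∀ φ S Λ T ν, P φ → IsShell φ S Λ T ν → ∀ (a : Freq → ℂ) (I J : Finset Freq)
    (ρ ℓ : ℝ), I ⊆ S → J ⊆ S → T ≤ ρ → ρ ≤ ℓ → T ≤ ℓ * (ρ / ℓ) ^ B →
    (∀ k ∈ I, ∀ l ∈ I, ‖φ k - φ l‖ ≤ ρ) → (∀ k ∈ J, ∀ l ∈ J, ‖φ k - φ l‖ ≤ ρ) →
    (∀ k ∈ I, ∀ l ∈ J, ℓ ≤ ‖φ k - φ l‖) → r0 ≤ ρ / ℓ →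
    avg (fun x => ‖tp a I x‖ ^ 2 * ‖tp a J x‖ ^ (2 * q)) ≤
      A * ν ^ q * (ρ / T) ^ η * (ρ / ℓ) ^ c * (mass a I * mass a J ^ q) := by
  obtain ⟨A, hA, h⟩ := h
  refine ⟨A * (r0 ^ c)⁻¹, by positivity,
    fun φ S Λ T ν hP hS a I J ρ ℓ hI hJ hTρ hρℓ hBB hdI hdJ hd hr => ?_⟩
  have hT := hS.pos
  have hν := hS.nonneg
  have hρ : 0 < ρ := hT.trans_le hTρ
  have hℓ : 0 < ℓ := hρ.trans_le hρℓ
  have hW := mass_nonneg a I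
  have hW' := mass_nonneg a J
  refine (h φ S Λ T ν hP hS a I J ρ ℓ hI hJ hTρ hρℓ ?_ hdI hdJ hd).trans ?_
  · rw [Real.rpow_one, mul_div_cancel₀ _ hℓ.ne']; exact hTρ
  · have h1 : r0 ^ c ≤ (ρ / ℓ) ^ c := Real.rpow_le_rpow hr0.le hr hc
    rw [Real.rpow_zero, mul_one]
    calc A * ν ^ q * (ρ / T) ^ η * (mass a I * mass a J ^ q)
        = A * (r0 ^ c)⁻¹ * ν ^ q * (ρ / T) ^ η * r0 ^ c * (mass a I * mass a J ^ q) := by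
          field_simp
      _ ≤ _ := by gcongr

set_option maxHeartbeats 1600000 in
theorem bilinearStep_one : BilinearStep (fun _ => True) 1 := by
  intro η₀ cmax hη₀
  set γ : ℝ := min (1 / 4) (η₀ / (|cmax| + 24 + η₀)) with hγ
  have hden : 0 < |cmax| + 24 + η₀ := by positivity
  have hγ0 : 0 < γ := lt_min (by norm_num) (by positivity)
  have hγ4 : γ ≤ 1 / 4 := min_le_left _ _
  have hγη : γ * (|cmax| + 24 + η₀) ≤ η₀ := by
    rw [← le_div_iff₀ hden]; exact min_le_right _ _
  refine ⟨γ * η₀, by positivity, fun η c B hη _ hc hcm hB hE hM => ?_⟩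
  set g := γ * η₀ with hg
  have hg0 : 0 < g := by positivity
  set r0 : ℝ := min ((1 / 2) ^ (1 / γ)) (1 / 400) with hr0
  have hr00 : 0 < r0 := lt_min (by positivity) (by norm_num)
  obtain ⟨A0, hA0, hbase⟩ := (bilinear_base one_ne_zero hE).mul_of_ge (B := 2 * B + 2) (c := c + g)
    (by linarith) hr00
  obtain ⟨A, hA, hM⟩ := hM
  refine ⟨A0 + 9 * (2 * 54 ^ 2 * 27 * (A * (2 ^ η * 2 ^ c)) +
    16 * 125 ^ 8 * 729 * (A * (20 ^ η * 20 ^ c))), by positivity,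
    fun φ S Λ T ν hP hS a I J ρ ℓ hI hJ hTρ hρℓ hBB hdI hdJ hd => ?_⟩
  have hT := hS.pos
  have hν := hS.nonneg
  have hρ : 0 < ρ := hT.trans_le hTρ
  have hℓ : 0 < ℓ := hρ.trans_le hρℓ
  have hWI := mass_nonneg a I
  have hWJ := mass_nonneg a J
  rcases le_total r0 (ρ / ℓ) with hr | hr
  · refine (hbase φ S Λ T ν hP hS a I J ρ ℓ hI hJ hTρ hρℓ hBB hdI hdJ hd hr).trans ?_
    gcongr
    exact le_add_of_nonneg_right (by positivity)
  set r := ρ / ℓ with hrdef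
  have hr1 : 0 < r := by positivity
  have hr400 : r ≤ 1 / 400 := hr.trans (min_le_right _ _)
  have hrle1 : r ≤ 1 := hr400.trans (by norm_num)
  set K := r ^ (-γ) with hK
  have hK0 : 0 < K := by positivity
  have hKinv : K⁻¹ = r ^ γ := by rw [hK, Real.rpow_neg hr1.le, inv_inv]
  have hK2 : 2 ≤ K := by
    have h1 : r ^ γ ≤ 1 / 2 := by
      calc r ^ γ ≤ ((1 / 2) ^ (1 / γ)) ^ γ :=
            Real.rpow_le_rpow hr1.le (hr.trans (min_le_left _ _)) hγ0.le
        _ = 1 / 2 := by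
            rw [← Real.rpow_mul (by norm_num), one_div_mul_cancel hγ0.ne', Real.rpow_one]
    rw [← hKinv, ← one_div, one_div_le_one_div hK0 (by norm_num)] at h1
    exact h1
  have hK1 : 1 ≤ K := by linarith
  have e5 : K * r = r ^ (1 - γ) := by
    rw [hK, show 1 - γ = -γ + 1 by ring, Real.rpow_add hr1, Real.rpow_one]
  have hKr : K * r ≤ 1 / 20 := by
    have h1 : K * r ≤ r ^ (1 / 2 : ℝ) := by
      rw [e5]
      exact Real.rpow_le_rpow_of_exponent_ge hr1 hrle1 (by linarith)
    refine h1.trans ?_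
    rw [← Real.sqrt_eq_rpow, Real.sqrt_le_left (by norm_num)]
    linarith
  have hrK : r ≤ K⁻¹ := by
    rw [hKinv]; nth_rw 1 [← Real.rpow_one r]
    exact Real.rpow_le_rpow_of_exponent_ge hr1 hrle1 (by linarith)
  have hρr : ρ = r * ℓ := by rw [hrdef]; field_simp
  have hρ2 : ρ ^ 2 / ℓ = ρ * r := by rw [hrdef]; field_simp
  have hT1 : T ≤ ρ * r ^ (2 * B + 1) := by
    refine hBB.trans (le_of_eq ?_)
    rw [hρr, show 2 * B + 2 = (2 * B + 1) + 1 by ring, Real.rpow_add hr1, Real.rpow_one]; ring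
  have hpow : ∀ e e' : ℝ, e ≤ e' → r ^ e' ≤ r ^ e := fun e e' h =>
    Real.rpow_le_rpow_of_exponent_ge hr1 hrle1 h
  have hTr : T ≤ ρ * r := by
    refine hT1.trans ?_
    gcongr
    nth_rw 2 [← Real.rpow_one r]
    exact hpow _ _ (by linarith)
  set X₁ := A * ν * (2 * (ρ / K) / T) ^ η * (2 * (ρ / K) / ℓ) ^ c with hX₁
  set X₂ := A * ν * (20 * (ρ * r) / T) ^ η * (20 * (ρ * r) / (ρ / K)) ^ c with hX₂
  have hX₁0 : 0 ≤ X₁ := by positivity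
  have hX₂0 : 0 ≤ X₂ := by positivity
  have main := avg_bilinear_le (X₁ := X₁) (X₂ := X₂) hS a hI hJ hℓ hTρ hρℓ (by rw [hρ2]; exact hTr)
    hK1 (by
      rw [hρ2, le_div_iff₀ hK0]
      calc 14 * (ρ * r) * K = ρ * (14 * (K * r)) := by ring
        _ ≤ ρ * 1 := by gcongr; linarith
        _ = ρ := mul_one ρ) hX₂0 hdI hdJ hd
    (fun I' hI' J' hJ' hdI' hdJ' => by
      have := hM φ S Λ T ν hP hS a I' J' (2 * (ρ / K)) ℓ (hI'.trans hI) (hJ'.trans hJ) ?_ ?_ ?_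
        hdI' hdJ' (fun k hk l hl => hd k (hI' hk) l (hJ' hl))
      · simpa only [mul_one, pow_one] using this
      · rw [div_eq_mul_inv]
        have h0 : 0 ≤ ρ * K⁻¹ := by positivity
        linarith [mul_le_mul_of_nonneg_left hrK hρ.le]
      · refine le_trans ?_ hρℓ
        rw [← mul_div_assoc, div_le_iff₀ hK0]
        linarith [mul_le_mul_of_nonneg_left hK2 hρ.le]
      · have e1 : 2 * (ρ / K) / ℓ = 2 * (r * K⁻¹) := by rw [hρr]; field_simp
        rw [e1]
        have e2 : r ^ (2 * B) ≤ (2 * (r * K⁻¹)) ^ B := by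
          rw [Real.rpow_mul hr1.le]
          refine Real.rpow_le_rpow (by positivity) ?_ (by linarith)
          rw [Real.rpow_two]
          have h0 : 0 ≤ r * K⁻¹ := by positivity
          linarith [mul_le_mul_of_nonneg_left hrK hr1.le]
        calc T ≤ ρ * r ^ (2 * B + 1) := hT1
          _ ≤ ℓ * r ^ (2 * B) := by
              gcongr ?_ * ?_
              exact hpow _ _ (by linarith)
          _ ≤ _ := by gcongr)
    (fun I' hI' J' hJ' hdI' hdJ' hd' => by
      rw [hρ2] at hdI' hdJ'
      have := hM φ S Λ T ν hP hS a I' J' (20 * (ρ * r)) (ρ / K) hI' hJ' ?_ ?_ ?_ hdI' hdJ' hd'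
      · simpa only [mul_one, pow_one] using this
      · linarith [mul_pos hρ hr1]
      · rw [le_div_iff₀ hK0]
        calc 20 * (ρ * r) * K = ρ * (20 * (K * r)) := by ring
          _ ≤ ρ * 1 := by gcongr; linarith
          _ = ρ := mul_one ρ
      · have e1 : 20 * (ρ * r) / (ρ / K) = 20 * K * r := by field_simp
        have e2 : r ^ B ≤ (20 * K * r) ^ B := by
          refine Real.rpow_le_rpow hr1.le ?_ (by linarith)
          linarith [mul_le_mul_of_nonneg_right hK1 hr1.le]
        have e3 : ρ * r ≤ ρ / K := by rw [div_eq_mul_inv]; gcongr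
        rw [e1]
        calc T ≤ ρ * r ^ (2 * B + 1) := hT1
          _ ≤ ρ * r ^ (B + 1) := by gcongr ?_ * ?_; exact hpow _ _ (by linarith)
          _ = ρ * r * r ^ B := by rw [Real.rpow_add hr1, Real.rpow_one]; ring
          _ ≤ _ := by gcongr)
  simp only [mul_one, pow_one]
  refine main.trans ?_
  have hη : 0 < η := by linarith
  set U := ν * (ρ / T) ^ η * r ^ (c + g) with hU
  have hU0 : 0 ≤ U := by positivity
  have hXX1 : X₁ ≤ A * (2 ^ η * 2 ^ c) * U := by
    have e1 : 2 * (ρ / K) / T = 2 * (ρ / T) * r ^ γ := by rw [← hKinv]; field_simp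
    have e2 : 2 * (ρ / K) / ℓ = 2 * r * K⁻¹ := by rw [hρr]; field_simp
    have e3 : K⁻¹ ^ c ≤ 1 :=
      Real.rpow_le_one (by positivity) (inv_le_one_of_one_le₀ hK1) hc
    have e4 : (r ^ γ) ^ η * r ^ c ≤ r ^ (c + g) := by
      rw [← Real.rpow_mul hr1.le, ← Real.rpow_add hr1]
      exact hpow _ _ (by rw [hg]; nlinarith)
    rw [hX₁, e1, e2, Real.mul_rpow (by positivity) (by positivity),
      Real.mul_rpow (by positivity) (by positivity), Real.mul_rpow (by positivity) (by positivity),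
      Real.mul_rpow (by positivity) (by positivity)]
    calc _ = A * (2 ^ η * 2 ^ c) * (ν * (ρ / T) ^ η * ((r ^ γ) ^ η * r ^ c)) * K⁻¹ ^ c := by ring
      _ ≤ A * (2 ^ η * 2 ^ c) * (ν * (ρ / T) ^ η * r ^ (c + g)) * 1 := by gcongr
      _ = _ := by ring
  have hXX2 : K ^ 24 * X₂ ≤ A * (20 ^ η * 20 ^ c) * U := by
    have e1 : 20 * (ρ * r) / T = 20 * (ρ / T) * r := by field_simp
    have e2 : 20 * (ρ * r) / (ρ / K) = 20 * (K * r) := by field_simp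
    have e4 : K ^ 24 * (r ^ η * (K * r) ^ c) ≤ r ^ (c + g) := by
      have e6 : K ^ 24 = r ^ (-γ * 24) := by
        rw [Real.rpow_mul hr1.le, ← hK]; norm_cast
      rw [e5, e6, ← Real.rpow_mul hr1.le, ← Real.rpow_add hr1, ← Real.rpow_add hr1]
      refine hpow _ _ ?_
      have : γ * c ≤ γ * |cmax| := by
        gcongr; exact hcm.trans (le_abs_self _)
      rw [hg]; linarith
    rw [hX₂, e1, e2, Real.mul_rpow (by positivity) (by positivity),
      Real.mul_rpow (by positivity) (by positivity),
      Real.mul_rpow (x := 20) (z := c) (by positivity) (by positivity)]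
    calc _ = A * (20 ^ η * 20 ^ c) * (ν * (ρ / T) ^ η * (K ^ 24 * (r ^ η * (K * r) ^ c))) := by ring
      _ ≤ _ := by rw [hU]; gcongr
  calc 9 * (2 * 54 ^ 2 * 27 * X₁ + 16 * (125 * K ^ 3) ^ 8 * (729 * X₂)) * (mass a I * mass a J)
      = 9 * (2 * 54 ^ 2 * 27 * X₁ + 16 * 125 ^ 8 * 729 * (K ^ 24 * X₂)) *
        (mass a I * mass a J) := by ring
    _ ≤ 9 * (2 * 54 ^ 2 * 27 * (A * (2 ^ η * 2 ^ c) * U) +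
        16 * 125 ^ 8 * 729 * (A * (20 ^ η * 20 ^ c) * U)) * (mass a I * mass a J) := by gcongr
    _ ≤ (A0 + 9 * (2 * 54 ^ 2 * 27 * (A * (2 ^ η * 2 ^ c)) +
        16 * 125 ^ 8 * 729 * (A * (20 ^ η * 20 ^ c)))) * U * (mass a I * mass a J) := by
        refine mul_le_mul_of_nonneg_right ?_ (by positivity)
        rw [add_mul]
        refine le_trans (le_of_eq ?_) (le_add_of_nonneg_left (by positivity))
        ring
    _ = _ := by rw [hU]; ring

lemma avg_le_of_cubes_sq (a : Freq → ℂ) (I J : Finset Freq) (φ : Freq →+ V3) {s X : ℝ}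
    (hs : 0 < s)
    (h : ∀ k ∈ I, ∀ l ∈ I, ∀ z₁ ∈ J, ∀ z₂ ∈ J, ∀ w₁ ∈ J, ∀ w₂ ∈ J,
      k + (z₁ + z₂) = l + (w₁ + w₂) → ‖φ k - φ l‖ ≤ s)
    (H : ∀ I' ⊆ I, (∀ k ∈ I', ∀ l ∈ I', ‖φ k - φ l‖ ≤ 2 * s) →
      avg (fun x => ‖tp a I' x‖ ^ 2 * ‖tp a J x‖ ^ 4) ≤ X * (mass a I' * mass a J ^ 2)) :
    avg (fun x => ‖tp a I x‖ ^ 2 * ‖tp a J x‖ ^ 4) ≤ 27 * X * (mass a I * mass a J ^ 2) := by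
  refine (orth_cube_sq a I J φ s fun k hk l hl z₁ h₁ z₂ h₂ w₁ h₃ w₂ h₄ hkl =>
    near_of_norm hs (h k hk l hl z₁ h₁ z₂ h₂ w₁ h₃ w₂ h₄ hkl)).trans
    ((sum_mass_mul_le (X := X) (Y := mass a J ^ 2)
    (by norm_num) fun i _ => ?_).trans (le_of_eq (by ring)))
  exact H _ (Finset.filter_subset _ _) fun k hk l hl => norm_sub_le_of_cube_eq hs
      ((Finset.mem_filter.mp hk).2.trans (Finset.mem_filter.mp hl).2.symm)

lemma map_sub_eq_of_add_eq (φ : Freq →+ V3) {k l z₁ z₂ w₁ w₂ : Freq}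
    (h : k + (z₁ + z₂) = l + (w₁ + w₂)) : φ k - φ l = (φ w₁ - φ z₁) + (φ w₂ - φ z₂) := by
  have := congrArg φ h
  simp only [map_add] at this
  rw [sub_eq_iff_eq_add, ← sub_eq_zero]
  rw [← sub_eq_zero] at this
  rw [← this]
  abel

/-- Transversal orthogonality on a shell contained in a plane through the origin. -/
lemma norm_sub_le_of_planar {φ : Freq →+ V3} {S : Finset Freq} {Λ T ν ρ ℓ : ℝ} {v : V3}
    (hS : IsShell φ S Λ T ν) (hv : v ≠ 0) (hφ : ∀ k, inner ℝ (φ k) v = 0) {I J : Finset Freq}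
    (hI : I ⊆ S) (hJ : J ⊆ S) (hTρ : T ≤ ρ) (hρℓ : ρ ≤ ℓ)
    (hdI : ∀ k ∈ I, ∀ l ∈ I, ‖φ k - φ l‖ ≤ ρ) (hdJ : ∀ k ∈ J, ∀ l ∈ J, ‖φ k - φ l‖ ≤ ρ)
    (hd : ∀ k ∈ I, ∀ l ∈ J, ℓ ≤ ‖φ k - φ l‖) {k l z₁ z₂ w₁ w₂ : Freq} (hk : k ∈ I) (hl : l ∈ I)
    (hz₁ : z₁ ∈ J) (hz₂ : z₂ ∈ J) (hw₁ : w₁ ∈ J) (hw₂ : w₂ ∈ J)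
    (h : k + (z₁ + z₂) = l + (w₁ + w₂)) : ‖φ k - φ l‖ ≤ 7 * (ρ ^ 2 / ℓ) := by
  have hT := hS.pos
  have hTT : T ^ 2 ≤ ρ ^ 2 := by gcongr
  have hu := hd k hk z₁ hz₁
  have hshI := fun k hk => hS.shell k (hI hk)
  have hshJ := fun k hk => hS.shell k (hJ hk)
  have e1 := abs_inner_sub_le (hshI k hk) (hshI l hl) (hdI k hk k hk) (hdI l hl k hk)
  have e2 := abs_inner_sub_le (hshJ w₁ hw₁) (hshJ z₁ hz₁) (hdJ w₁ hw₁ z₁ hz₁) (hdJ z₁ hz₁ z₁ hz₁)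
  have e3 := abs_inner_sub_le (hshJ w₂ hw₂) (hshJ z₂ hz₂) (hdJ w₂ hw₂ z₁ hz₁) (hdJ z₂ hz₂ z₁ hz₁)
  have e4 : inner ℝ (φ k - φ l) (φ z₁) =
      inner ℝ (φ w₁ - φ z₁) (φ z₁) + inner ℝ (φ w₂ - φ z₂) (φ z₁) := by
    rw [map_sub_eq_of_add_eq φ h, inner_add_left]
  refine norm_le_of_triple_eq_zero (p := φ k) (u := φ k - φ z₁) (hshI k hk)
    (by rw [sub_sub_cancel]; exact hshJ z₁ hz₁) hT.le (by linarith)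
    (hS.cap _ (hI hk) _ (hJ hz₁)) (by linarith) hu (by nlinarith [sq_nonneg ρ]) ?_
    (triple_eq_zero hv (by rw [inner_sub_left, hφ, hφ, sub_zero])
      (by rw [inner_sub_left, hφ, hφ, sub_zero]) (hφ k))
  rw [inner_sub_right, e4]
  rw [abs_le] at *
  constructor <;> linarith [e1.1, e1.2, e2.1, e2.2, e3.1, e3.2]

/-- The frequency map takes values in a plane through the origin. -/
def Planar (φ : Freq →+ V3) : Prop := ∃ v : V3, v ≠ 0 ∧ ∀ k, inner ℝ (φ k) v = 0

/-- One step of the bilinear induction on scales in `L⁶`. -/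
lemma avg_planar_le {φ : Freq →+ V3} {S : Finset Freq} {Λ T ν ρ ℓ X Y : ℝ}
    (hS : IsShell φ S Λ T ν) (hP : Planar φ) (a : Freq → ℂ) {I J : Finset Freq} (hI : I ⊆ S)
    (hJ : J ⊆ S) (hTρ : T ≤ ρ) (hρℓ : ρ ≤ ℓ)
    (hdI : ∀ k ∈ I, ∀ l ∈ I, ‖φ k - φ l‖ ≤ ρ) (hdJ : ∀ k ∈ J, ∀ l ∈ J, ‖φ k - φ l‖ ≤ ρ)
    (hd : ∀ k ∈ I, ∀ l ∈ J, ℓ ≤ ‖φ k - φ l‖)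
    (h1 : avg (fun x => ‖tp a J x‖ ^ 6) ≤ Y * mass a J ^ 3)
    (h2 : ∀ I' ⊆ I, ∀ J' ⊆ J, (∀ k ∈ I', ∀ l ∈ I', ‖φ k - φ l‖ ≤ 56 * (ρ ^ 2 / ℓ)) →
      (∀ k ∈ J', ∀ l ∈ J', ‖φ k - φ l‖ ≤ 56 * (ρ ^ 2 / ℓ)) →
      avg (fun x => ‖tp a J' x‖ ^ 2 * ‖tp a I' x‖ ^ 4) ≤ X * (mass a J' * mass a I' ^ 2)) :
    avg (fun x => ‖tp a I x‖ ^ 2 * ‖tp a J x‖ ^ 4) ≤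
      27 * √(27 * X * Y) * (mass a I * mass a J ^ 2) := by
  obtain ⟨v, hv, hφ⟩ := hP
  have hρ : 0 < ρ := hS.pos.trans_le hTρ
  have hℓ : 0 < ℓ := hρ.trans_le hρℓ
  have hs : 0 < ρ ^ 2 / ℓ := by positivity
  refine avg_le_of_cubes_sq a I J φ (s := 7 * (ρ ^ 2 / ℓ)) (by positivity)
    (fun k hk l hl z₁ h₁ z₂ h₂ w₁ h₃ w₂ h₄ hkl => norm_sub_le_of_planar hS hv hφ hI hJ hTρ hρℓ
      hdI hdJ hd hk hl h₁ h₂ h₃ h₄ hkl) fun I' hI' hdI' => ?_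
  have key := avg_sq_le_mul (f := fun x => ‖tp a J x‖ * ‖tp a I' x‖ ^ 2)
    (g := fun x => ‖tp a J x‖ ^ 3) (by fun_prop) (by fun_prop)
    (P := 27 * X * (mass a J * mass a I' ^ 2)) (Q := Y * mass a J ^ 3) ?_ ?_
  · have e1 : ∀ x, ‖tp a J x‖ * ‖tp a I' x‖ ^ 2 * ‖tp a J x‖ ^ 3 =
        ‖tp a I' x‖ ^ 2 * ‖tp a J x‖ ^ 4 := fun x => by ring
    simp_rw [e1] at key
    refine key.trans (le_of_eq ?_)
    rw [show 27 * X * (mass a J * mass a I' ^ 2) * (Y * mass a J ^ 3) =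
      27 * X * Y * (mass a I' * mass a J ^ 2) ^ 2 by ring, Real.sqrt_mul' _ (sq_nonneg _),
      Real.sqrt_sq]
    exact mul_nonneg (mass_nonneg _ _) (pow_nonneg (mass_nonneg _ _) _)
  · have e1 : ∀ x, (‖tp a J x‖ * ‖tp a I' x‖ ^ 2) ^ 2 = ‖tp a J x‖ ^ 2 * ‖tp a I' x‖ ^ 4 :=
      fun x => by ring
    simp_rw [e1]
    refine avg_le_of_cubes_sq a J I' φ (s := 28 * (ρ ^ 2 / ℓ)) (by positivity)
      (fun k hk l hl z₁ h₁ z₂ h₂ w₁ h₃ w₂ h₄ hkl => ?_) fun J' hJ' hdJ' => ?_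
    · rw [map_sub_eq_of_add_eq φ hkl]
      refine (norm_add_le _ _).trans ?_
      have := hdI' w₁ h₃ z₁ h₁
      have := hdI' w₂ h₄ z₂ h₂
      linarith
    · refine h2 I' hI' J' hJ' (fun k hk l hl => ?_) fun k hk l hl => ?_
      · have := hdI' k hk l hl; linarith
      · have := hdJ' k hk l hl; linarith
  · simp_rw [← pow_mul]; exact h1

theorem bilinearStep_two : BilinearStep Planar 2 := by
  intro η₀ cmax hη₀
  refine ⟨η₀ / 2, by positivity, fun η c B hη _ hc _ hB hE hM => ?_⟩
  have hr00 : (0 : ℝ) < 1 / 56 := by norm_num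
  obtain ⟨A0, hA0, hbase⟩ := (bilinear_base two_ne_zero hE).mul_of_ge (B := 2 * B + 2)
    (c := c + η₀ / 2) (by linarith) hr00
  obtain ⟨E, hEpos, hE⟩ := hE
  obtain ⟨A, hA, hM⟩ := hM
  have hη0 : 0 < η := by linarith
  set Z := √(27 * (A * (56 ^ η * 56 ^ c)) * E) with hZ
  refine ⟨A0 + 27 * Z, by positivity, fun φ S Λ T ν hP hS a I J ρ ℓ hI hJ hTρ hρℓ hBB hdI hdJ hd =>
    ?_⟩
  have hT := hS.pos
  have hν := hS.nonneg
  have hρ : 0 < ρ := hT.trans_le hTρ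
  have hℓ : 0 < ℓ := hρ.trans_le hρℓ
  have hWI := mass_nonneg a I
  have hWJ := mass_nonneg a J
  rcases le_total (1 / 56) (ρ / ℓ) with hr | hr
  · refine (hbase φ S Λ T ν hP hS a I J ρ ℓ hI hJ hTρ hρℓ hBB hdI hdJ hd hr).trans ?_
    gcongr
    exact le_add_of_nonneg_right (by positivity)
  set r := ρ / ℓ with hrdef
  have hr1 : 0 < r := by positivity
  have hrle1 : r ≤ 1 := hr.trans (by norm_num)
  have hρr : ρ = r * ℓ := by rw [hrdef]; field_simp
  have hρ2 : ρ ^ 2 / ℓ = ρ * r := by rw [hrdef]; field_simp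
  have hpow : ∀ e e' : ℝ, e ≤ e' → r ^ e' ≤ r ^ e := fun e e' h =>
    Real.rpow_le_rpow_of_exponent_ge hr1 hrle1 h
  have hrr : ρ * r = ℓ * r ^ (2 : ℝ) := by rw [Real.rpow_two, hρr]; ring
  have hTr : T ≤ ρ * r := by
    refine hBB.trans ?_
    rw [hrr]
    gcongr ?_ * ?_
    exact hpow _ _ (by linarith)
  set X := A * ν ^ 2 * (56 * (ρ * r) / T) ^ η * (56 * (ρ * r) / ℓ) ^ c with hX
  have hX0 : 0 ≤ X := by positivity
  have main := avg_planar_le (X := X) (Y := E * ν ^ 2 * (ρ / T) ^ η) hS hP a hI hJ hTρ hρℓ hdI hdJ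
    hd (hE φ J Λ T ν hP (hS.mono hJ) a ρ hTρ hdJ) (fun I' hI' J' hJ' hdI' hdJ' => by
      rw [hρ2] at hdI' hdJ'
      refine hM φ S Λ T ν hP hS a J' I' (56 * (ρ * r)) ℓ (hJ'.trans hJ) (hI'.trans hI) ?_ ?_ ?_
        hdJ' hdI' fun k hk l hl => by rw [norm_sub_rev]; exact hd l (hI' hl) k (hJ' hk)
      · have : 0 ≤ ρ * r := by positivity
        linarith
      · calc 56 * (ρ * r) = ρ * (56 * r) := by ring
          _ ≤ ρ * 1 := by gcongr; linarith
          _ ≤ ℓ := by linarith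
      · refine hBB.trans ?_
        gcongr ?_ * ?_
        rw [show 56 * (ρ * r) / ℓ = 56 * r ^ 2 by rw [hρr]; field_simp]
        calc r ^ (2 * B + 2) ≤ r ^ (2 * B) := hpow _ _ (by linarith)
          _ = (r ^ 2) ^ B := by rw [Real.rpow_mul hr1.le, Real.rpow_two]
          _ ≤ _ := Real.rpow_le_rpow (by positivity) (by linarith [sq_nonneg r]) (by linarith))
  refine main.trans ?_
  have e0 : 27 * X * (E * ν ^ 2 * (ρ / T) ^ η) =
      27 * (A * (56 ^ η * 56 ^ c)) * E * (ν ^ 2 * (ρ / T) ^ η * r ^ (c + η / 2)) ^ 2 := by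
    have e1 : 56 * (ρ * r) / T = 56 * (ρ / T) * r := by field_simp
    have e2 : 56 * (ρ * r) / ℓ = 56 * r * r := by rw [hρr]; field_simp
    have e3 : (r ^ (c + η / 2)) ^ 2 = r ^ η * (r ^ c * r ^ c) := by
      rw [← Real.rpow_natCast, ← Real.rpow_mul hr1.le, ← Real.rpow_add hr1, ← Real.rpow_add hr1]
      congr 1; push_cast; ring
    rw [hX, e1, e2, Real.mul_rpow (by positivity) (by positivity),
      Real.mul_rpow (by positivity) (by positivity), Real.mul_rpow (by positivity) (by positivity),
      Real.mul_rpow (by positivity) (by positivity), mul_pow, e3]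
    ring
  rw [e0, Real.sqrt_mul' _ (sq_nonneg _), Real.sqrt_sq (by positivity), ← hZ]
  have e4 : r ^ (c + η / 2) ≤ r ^ (c + η₀ / 2) := hpow _ _ (by linarith)
  calc 27 * (Z * (ν ^ 2 * (ρ / T) ^ η * r ^ (c + η / 2))) * (mass a I * mass a J ^ 2)
      ≤ 27 * (Z * (ν ^ 2 * (ρ / T) ^ η * r ^ (c + η₀ / 2))) * (mass a I * mass a J ^ 2) := by gcongr
    _ = 27 * Z * (ν ^ 2 * (ρ / T) ^ η * r ^ (c + η₀ / 2) * (mass a I * mass a J ^ 2)) := by ring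
    _ ≤ (A0 + 27 * Z) * (ν ^ 2 * (ρ / T) ^ η * r ^ (c + η₀ / 2) * (mass a I * mass a J ^ 2)) := by
        gcongr; exact le_add_of_nonneg_left hA0.le
    _ = _ := by ring

/-- The `L⁴` bound for a shell. -/
lemma exists_four_le {η : ℝ} (hη : 0 < η) : ∃ A : ℝ, 0 < A ∧ ∀ φ S Λ T ν, IsShell φ S Λ T ν →
    ∀ (a : Freq → ℂ) (R : ℝ), T ≤ R → (∀ k ∈ S, ∀ l ∈ S, ‖φ k - φ l‖ ≤ R) →
    avg (fun x => ‖tp a S x‖ ^ 4) ≤ A * ν * (R / T) ^ η * mass a S ^ 2 := by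
  obtain ⟨A, hA, h⟩ := linearBound_of_step one_ne_zero bilinearStep_one hη
  refine ⟨A, hA, fun φ S Λ T ν hS a R hTR hR => ?_⟩
  have := h φ S Λ T ν trivial hS a R hTR hR
  rwa [pow_one] at this

/-- The `L⁶` bound for a planar shell. -/
lemma exists_six_le {η : ℝ} (hη : 0 < η) : ∃ A : ℝ, 0 < A ∧ ∀ φ S Λ T ν, Planar φ →
    IsShell φ S Λ T ν → ∀ (a : Freq → ℂ) (R : ℝ), T ≤ R → (∀ k ∈ S, ∀ l ∈ S, ‖φ k - φ l‖ ≤ R) →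
    avg (fun x => ‖tp a S x‖ ^ 6) ≤ A * ν ^ 2 * (R / T) ^ η * mass a S ^ 3 :=
  linearBound_of_step two_ne_zero bilinearStep_two hη

/-- Interpolation between two moments. -/
lemma avg_rpow_interp {f : (Fin 3 → ℝ) → ℝ} (hf : Continuous f) (h0 : ∀ x, 0 ≤ f x)
    {p q θ P Q : ℝ} (hp : 0 < p) (hq : 0 < q) (hθ0 : 0 ≤ θ) (hθ1 : θ ≤ 1) (hP : 0 < P) (hQ : 0 < Q)
    (h1 : avg (fun x => f x ^ p) ≤ P) (h2 : avg (fun x => f x ^ q) ≤ Q) :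
    avg (fun x => f x ^ ((1 - θ) * p + θ * q)) ≤ P ^ (1 - θ) * Q ^ θ := by
  have hc : ∀ e : ℝ, 0 ≤ e → Continuous fun x => f x ^ e := fun e he =>
    hf.rpow_const fun _ => Or.inr he
  have hθ1' : 0 ≤ 1 - θ := by linarith
  have c1 := hc p hp.le
  have c2 := hc q hq.le
  have c3 := hc ((1 - θ) * p + θ * q) (by positivity)
  have hpt : ∀ x, f x ^ ((1 - θ) * p + θ * q) ≤
      (P ^ (1 - θ) * Q ^ θ) * (((1 - θ) * P⁻¹) * f x ^ p + (θ * Q⁻¹) * f x ^ q) := by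
    intro x
    have hx := h0 x
    have e1 : f x ^ ((1 - θ) * p + θ * q) =
        (P ^ (1 - θ) * Q ^ θ) * ((f x ^ p / P) ^ (1 - θ) * (f x ^ q / Q) ^ θ) := by
      rw [Real.div_rpow (by positivity) hP.le, Real.div_rpow (by positivity) hQ.le,
        ← Real.rpow_mul hx, ← Real.rpow_mul hx, mul_comm p, mul_comm q,
        Real.rpow_add_of_nonneg hx (by positivity) (by positivity)]
      field_simp
    rw [e1]
    gcongr
    refine (Real.geom_mean_le_arith_mean2_weighted hθ1' hθ0 (by positivity) (by positivity)
      (by ring)).trans (le_of_eq ?_)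
    ring
  refine (avg_mono c3 (by fun_prop) hpt).trans ?_
  rw [avg_const_mul, avg_add (by fun_prop) (by fun_prop), avg_const_mul, avg_const_mul]
  refine mul_le_of_le_one_right (by positivity) ?_
  calc (1 - θ) * P⁻¹ * avg (fun x => f x ^ p) + θ * Q⁻¹ * avg (fun x => f x ^ q)
      ≤ (1 - θ) * P⁻¹ * P + θ * Q⁻¹ * Q := by gcongr
    _ = 1 := by field_simp; ring

/-- A higher moment is controlled by a lower one and the supremum. -/
lemma avg_six_le_card (a : Freq → ℂ) (S : Finset Freq) {N P : ℝ} (hN : (S.card : ℝ) ≤ N)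
    (h : avg (fun x => ‖tp a S x‖ ^ 4) ≤ P) :
    avg (fun x => ‖tp a S x‖ ^ 6) ≤ N * mass a S * P := by
  have hm := mass_nonneg a S
  have hN0 : 0 ≤ N := le_trans (by positivity) hN
  calc avg (fun x => ‖tp a S x‖ ^ 6) ≤ avg (fun x => (N * mass a S) * ‖tp a S x‖ ^ 4) := by
        refine avg_mono (by fun_prop) (by fun_prop) fun x => ?_
        calc ‖tp a S x‖ ^ 6 = ‖tp a S x‖ ^ 2 * ‖tp a S x‖ ^ 4 := by ring
          _ ≤ (S.card * mass a S) * ‖tp a S x‖ ^ 4 := by gcongr; exact norm_tp_sq_le a S x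
          _ ≤ _ := by gcongr
    _ ≤ _ := by rw [avg_const_mul]; gcongr

/-- Interpolation between the fourth and sixth moments. -/
lemma avg_rpow_le_of_four_six (a : Freq → ℂ) (S : Finset Freq) {s P Y : ℝ} (hs0 : 0 ≤ s)
    (hs1 : s ≤ 2) (hP : 0 < P) (hY : 0 < Y)
    (h4 : avg (fun x => ‖tp a S x‖ ^ 4) ≤ P * mass a S ^ 2)
    (h6 : avg (fun x => ‖tp a S x‖ ^ 6) ≤ P * Y * mass a S ^ 3) :
    avg (fun x => ‖tp a S x‖ ^ (4 + s)) ≤ P * Y ^ (s / 2) * mass a S ^ ((4 + s) / 2) := by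
  rcases (mass_nonneg a S).eq_or_lt with h0 | hm
  · have : (0 : ℝ) ^ (4 + s) = 0 := Real.zero_rpow (by linarith)
    simp only [tp_eq_zero_of_mass h0.symm, norm_zero, this, avg_const]
    rw [← h0]; positivity
  have key := avg_rpow_interp (f := fun x => ‖tp a S x‖) (by fun_prop) (fun x => norm_nonneg _)
    (p := 4) (q := 6) (θ := s / 2) (P := P * mass a S ^ 2) (Q := P * Y * mass a S ^ 3)
    (by norm_num) (by norm_num) (by linarith) (by linarith) (by positivity) (by positivity)
    (by exact_mod_cast h4) (by exact_mod_cast h6)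
  rw [show (1 - s / 2) * 4 + s / 2 * 6 = 4 + s by ring] at key
  refine key.trans (le_of_eq ?_)
  rw [Real.mul_rpow (by positivity) (by positivity), Real.mul_rpow (by positivity) (by positivity),
    Real.mul_rpow (by positivity) (by positivity), ← Real.rpow_natCast, ← Real.rpow_natCast,
    ← Real.rpow_mul hm.le, ← Real.rpow_mul hm.le,
    show (4 + s) / 2 = ((2 : ℕ) : ℝ) * (1 - s / 2) + ((3 : ℕ) : ℝ) * (s / 2) by push_cast; ring,
    Real.rpow_add hm]
  have : P ^ (1 - s / 2) * P ^ (s / 2) = P := by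
    rw [← Real.rpow_add hP]; simp
  linear_combination (Y ^ (s / 2) * mass a S ^ (((2 : ℕ) : ℝ) * (1 - s / 2)) *
    mass a S ^ (((3 : ℕ) : ℝ) * (s / 2))) * this

/-- Combining `N` pieces which each satisfy a sixth moment bound. -/
lemma avg_six_le_of_pieces {ι : Type*} [DecidableEq ι] (a : Freq → ℂ) (S : Finset Freq)
    (g : Freq → ι) {N X : ℝ} (hN : ((S.image g).card : ℝ) ≤ N) (hX : 0 ≤ X)
    (h : ∀ i ∈ S.image g, avg (fun x => ‖tp a (S.filter fun k => g k = i) x‖ ^ 6) ≤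
      X * mass a (S.filter fun k => g k = i) ^ 3) :
    avg (fun x => ‖tp a S x‖ ^ 6) ≤ X * N ^ 3 * mass a S ^ 3 := by
  set F : ι → (Fin 3 → ℝ) → ℂ := fun i x => tp a (S.filter fun k => g k = i) x with hF
  set m : ι → ℝ := fun i => mass a (S.filter fun k => g k = i) with hm
  have hm0 : ∀ i, 0 ≤ m i := fun i => mass_nonneg _ _
  have hFc : ∀ i, Continuous (F i) := fun i => by rw [hF]; fun_prop
  have hM := mass_nonneg a S
  have hN0 : 0 ≤ N := le_trans (by positivity) hN
  have hpt : ∀ x, ‖tp a S x‖ ^ 6 ≤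
      (mass a S ^ 3 * N ^ 2) * ∑ i ∈ S.image g, (m i ^ 3)⁻¹ * ‖F i x‖ ^ 6 := by
    intro x
    have h1 : ‖tp a S x‖ ^ 2 ≤ mass a S * ∑ i ∈ S.image g, (m i)⁻¹ * ‖F i x‖ ^ 2 := by
      rw [tp_eq_sum_filter a S g x, ← sum_mass_filter a S g]
      calc ‖∑ i ∈ S.image g, F i x‖ ^ 2 ≤ (∑ i ∈ S.image g, ‖F i x‖) ^ 2 := by
            gcongr; exact norm_sum_le _ _
        _ ≤ _ := by
            refine Finset.sum_sq_le_sum_mul_sum_of_sq_le_mul _ (fun i _ => hm0 i)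
              (fun i _ => mul_nonneg (inv_nonneg.mpr (hm0 i)) (by positivity)) fun i _ => ?_
            rcases (hm0 i).eq_or_lt with h0 | hp
            · rw [show F i x = 0 from tp_eq_zero_of_mass h0.symm x]; simp
            · refine le_of_eq ?_
              change _ = m i * _
              field_simp
    have h2 : (∑ i ∈ S.image g, (m i)⁻¹ * ‖F i x‖ ^ 2) ^ 3 ≤
        N ^ 2 * ∑ i ∈ S.image g, (m i ^ 3)⁻¹ * ‖F i x‖ ^ 6 := by
      rcases S.eq_empty_or_nonempty with rfl | hne
      · simp
      have hc : 0 < ((S.image g).card : ℝ) := by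
        exact_mod_cast Finset.card_pos.mpr (hne.image g)
      have key := pow_sum_div_card_le_sum_pow (s := S.image g)
        (f := fun i => (m i)⁻¹ * ‖F i x‖ ^ 2) (n := 2)
        (fun i _ => mul_nonneg (inv_nonneg.mpr (hm0 i)) (by positivity))
      rw [div_le_iff₀ (by positivity), mul_comm] at key
      refine key.trans ?_
      have e : ∀ i, ((m i)⁻¹ * ‖F i x‖ ^ 2) ^ (2 + 1) = (m i ^ 3)⁻¹ * ‖F i x‖ ^ 6 := fun i => by
        rw [mul_pow, inv_pow, ← pow_mul]
      simp_rw [e]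
      have : 0 ≤ ∑ i ∈ S.image g, (m i ^ 3)⁻¹ * ‖F i x‖ ^ 6 :=
        Finset.sum_nonneg fun i _ => mul_nonneg (inv_nonneg.mpr (pow_nonneg (hm0 i) _))
          (by positivity)
      gcongr
    calc ‖tp a S x‖ ^ 6 = (‖tp a S x‖ ^ 2) ^ 3 := by ring
      _ ≤ (mass a S * ∑ i ∈ S.image g, (m i)⁻¹ * ‖F i x‖ ^ 2) ^ 3 := by gcongr
      _ = mass a S ^ 3 * (∑ i ∈ S.image g, (m i)⁻¹ * ‖F i x‖ ^ 2) ^ 3 := mul_pow _ _ _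
      _ ≤ mass a S ^ 3 * (N ^ 2 * ∑ i ∈ S.image g, (m i ^ 3)⁻¹ * ‖F i x‖ ^ 6) := by gcongr
      _ = _ := by ring
  refine (avg_mono (by fun_prop) (by fun_prop) hpt).trans ?_
  rw [avg_const_mul, avg_sum _ fun i _ => by fun_prop]
  have h3 : ∑ i ∈ S.image g, avg (fun x => (m i ^ 3)⁻¹ * ‖F i x‖ ^ 6) ≤ N * X := by
    calc _ ≤ ∑ i ∈ S.image g, X := by
          refine Finset.sum_le_sum fun i hi => ?_
          rw [avg_const_mul]
          rcases (hm0 i).eq_or_lt with h0 | hp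
          · rw [← h0]; simpa using hX
          · rw [inv_mul_le_iff₀ (by positivity), mul_comm]; exact h i hi
      _ = (S.image g).card * X := by rw [Finset.sum_const, nsmul_eq_mul]
      _ ≤ _ := by gcongr
  calc _ ≤ (mass a S ^ 3 * N ^ 2) * (N * X) := by gcongr
    _ = _ := by ring

/-- A lower bound for the sixth moment in terms of the threefold sumset. -/
lemma card_pow_six_le (S E : Finset Freq) (h : ∀ k ∈ S, ∀ l ∈ S, ∀ m ∈ S, k + (l + m) ∈ E) :
    (S.card : ℝ) ^ 6 ≤ E.card * avg (fun x => ‖tp (fun _ => 1) S x‖ ^ 6) := by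
  set P := S ×ˢ S ×ˢ S with hP
  have e1 : ∀ x, ‖tp (fun _ => 1) S x‖ ^ 6 =
      ‖∑ p ∈ P, (1 : ℂ) * chr (p.1 + (p.2.1 + p.2.2)) x‖ ^ 2 := by
    intro x
    have : ∑ p ∈ P, (1 : ℂ) * chr (p.1 + (p.2.1 + p.2.2)) x = tp (fun _ => 1) S x ^ 3 := by
      rw [pow_succ', sq, tp, hP, Finset.sum_product, Finset.sum_mul_sum, Finset.sum_mul_sum]
      refine Finset.sum_congr rfl fun k _ => ?_
      rw [Finset.sum_product, ← Finset.mul_sum, Finset.mul_sum]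
      simp only [one_mul, chr_add]
      exact Finset.sum_congr rfl fun _ _ => (Finset.mul_sum _ _ _).symm
    rw [this, norm_pow]; ring
  simp_rw [e1]
  rw [avg_norm_sq_sum_index P (fun _ => (1 : ℂ)) (fun p => p.1 + (p.2.1 + p.2.2)) E (fun p hp => by
    simp only [hP, Finset.mem_product] at hp
    exact h _ hp.1 _ hp.2.1 _ hp.2.2)]
  have e2 : ∀ n, ‖∑ p ∈ P with p.1 + (p.2.1 + p.2.2) = n, (1 : ℂ)‖ ^ 2 =
      (((P.filter fun p => p.1 + (p.2.1 + p.2.2) = n).card : ℕ) : ℝ) ^ 2 := by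
    intro n; simp
  simp_rw [e2]
  have e3 : (S.card : ℝ) ^ 6 =
      (∑ n ∈ E, ((P.filter fun p => p.1 + (p.2.1 + p.2.2) = n).card : ℝ)) ^ 2 := by
    have := Finset.card_eq_sum_card_fiberwise (s := P) (t := E)
      (f := fun p => p.1 + (p.2.1 + p.2.2)) (fun p hp => by
        simp only [hP, Finset.coe_product, Set.mem_prod, Finset.mem_coe] at hp
        exact h _ hp.1 _ hp.2.1 _ hp.2.2)
    rw [← Nat.cast_sum, ← this, hP, Finset.card_product, Finset.card_product]
    push_cast; ring
  rw [e3]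
  exact sq_sum_le_card_mul_sum_sq

open Matrix in
/-- A finite set of lattice points in the parallelepiped spanned by the rows of `D` has at most
`125 |det D|` points. -/
lemma card_le_natAbs_det (D : Matrix (Fin 3) (Fin 3) ℤ) (hD : D.det ≠ 0) (F : Finset Freq)
    (k0 : Freq) (h : ∀ x ∈ F, ∀ i, |((x - k0) ᵥ* D.adjugate) i| ≤ |D.det|) :
    F.card ≤ 125 * D.det.natAbs := by
  classical
  set f : Freq →ₗ[ℤ] Freq := D.vecMulLinear with hf
  have hadj : ∀ c : Freq, (f c) ᵥ* D.adjugate = D.det • c := fun c => by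
    simp [hf, Matrix.vecMul_vecMul, Matrix.mul_adjugate]
  have hinj : Function.Injective f := by
    intro c c' hcc
    have h1 := hadj c
    rw [hcc, hadj c'] at h1
    exact (smul_right_injective _ hD h1).symm
  have hcard : Nat.card (Freq ⧸ LinearMap.range f) = D.det.natAbs := by
    rw [← Submodule.natAbs_det_equiv (LinearMap.range f) (LinearEquiv.ofInjective f hinj)]
    have : ((LinearMap.range f).subtype ∘ₗ
        AddMonoidHom.toIntLinearMap ((LinearEquiv.ofInjective f hinj : Freq ≃ₗ[ℤ] _) :
          Freq →+ LinearMap.range f)) = f := by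
      ext; rfl
    rw [this, hf, ← Matrix.mulVecLin_transpose, ← Matrix.toLin'_apply', LinearMap.det_toLin',
      Matrix.det_transpose]
  have hfin : Finite (Freq ⧸ LinearMap.range f) :=
    Nat.finite_of_card_ne_zero (by rw [hcard]; exact Int.natAbs_ne_zero.mpr hD)
  have := Fintype.ofFinite (Freq ⧸ LinearMap.range f)
  rw [← hcard, Nat.card_eq_fintype_card]
  refine Finset.card_le_mul_card_image_of_maps_to
    (f := fun x => (Submodule.Quotient.mk x : Freq ⧸ LinearMap.range f))
    (t := Finset.univ) (fun _ _ => Finset.mem_univ _) 125 (fun q _ => ?_)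
  rcases (F.filter fun x => (Submodule.Quotient.mk x : Freq ⧸ LinearMap.range f) = q).eq_empty_or_nonempty
    with he | ⟨x0, hx0⟩
  · rw [he]; simp
  obtain ⟨hx0F, hx0q⟩ := Finset.mem_filter.mp hx0
  have hsub : (F.filter fun x => (Submodule.Quotient.mk x : Freq ⧸ LinearMap.range f) = q) ⊆
      (Finset.Icc (fun _ => (-2 : ℤ)) (fun _ => 2) : Finset Freq).image fun c => x0 + f c := by
    intro x hx
    obtain ⟨hxF, hxq⟩ := Finset.mem_filter.mp hx
    obtain ⟨c, hc⟩ := (Submodule.Quotient.eq _).mp (hxq.trans hx0q.symm)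
    rw [Finset.mem_image]
    refine ⟨c, ?_, by rw [hc]; abel⟩
    have h1 : ∀ i, |c i| ≤ 2 := fun i => by
      have h2 := congrFun (hadj c) i
      rw [hc, show x - x0 = (x - k0) - (x0 - k0) by abel, Matrix.sub_vecMul] at h2
      simp only [Pi.sub_apply, Pi.smul_apply, smul_eq_mul] at h2
      have h3 : |D.det| * |c i| ≤ |D.det| * 2 := by
        rw [← abs_mul, ← h2]
        have := h x hxF i
        have := h x0 hx0F i
        have := abs_sub (((x - k0) ᵥ* D.adjugate) i) (((x0 - k0) ᵥ* D.adjugate) i)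
        linarith
      exact le_of_mul_le_mul_left h3 (abs_pos.mpr hD)
    rw [Finset.mem_Icc, Pi.le_def, Pi.le_def]
    exact ⟨fun i => (abs_le.mp (h1 i)).1, fun i => (abs_le.mp (h1 i)).2⟩
  refine (Finset.card_le_card hsub).trans (Finset.card_image_le.trans ?_)
  rw [Pi.card_Icc]; simp

/-- The cross product of integer vectors. -/
def icross (x y : Freq) : Freq :=
  ![x 1 * y 2 - x 2 * y 1, x 2 * y 0 - x 0 * y 2, x 0 * y 1 - x 1 * y 0]

/-- The scalar product of integer vectors. -/
def idot (x y : Freq) : ℤ := x 0 * y 0 + x 1 * y 1 + x 2 * y 2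

lemma card_le_idot_icross {F : Finset Freq} (k0 d₁ d₂ d₃ : Freq)
    (hD : idot d₁ (icross d₂ d₃) ≠ 0)
    (h : ∀ x ∈ F, |idot (x - k0) (icross d₂ d₃)| ≤ |idot d₁ (icross d₂ d₃)| ∧
      |idot (x - k0) (icross d₃ d₁)| ≤ |idot d₁ (icross d₂ d₃)| ∧
      |idot (x - k0) (icross d₁ d₂)| ≤ |idot d₁ (icross d₂ d₃)|) :
    (F.card : ℝ) ≤ 125 * |(idot d₁ (icross d₂ d₃) : ℝ)| := by
  have hdet : (Matrix.of ![d₁, d₂, d₃]).det = idot d₁ (icross d₂ d₃) := by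
    rw [Matrix.det_fin_three]; simp [idot, icross]; ring
  have := card_le_natAbs_det (Matrix.of ![d₁, d₂, d₃]) (by rwa [hdet]) F k0 (fun x hx i => by
    obtain ⟨h1, h2, h3⟩ := h x hx
    rw [hdet]
    fin_cases i
    · convert h1 using 2
      simp [Matrix.vecMul, dotProduct, Fin.sum_univ_three, Matrix.adjugate_fin_three, idot, icross,
        -mul_eq_mul_left_iff, -add_left_inj, -add_right_inj]
      ring
    · convert h2 using 2
      simp [Matrix.vecMul, dotProduct, Fin.sum_univ_three, Matrix.adjugate_fin_three, idot, icross,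
        -mul_eq_mul_left_iff, -add_left_inj, -add_right_inj]
      ring
    · convert h3 using 2
      simp [Matrix.vecMul, dotProduct, Fin.sum_univ_three, Matrix.adjugate_fin_three, idot, icross,
        -mul_eq_mul_left_iff, -add_left_inj, -add_right_inj]
      ring)
  rw [hdet] at this
  rw [← Int.cast_abs, Int.abs_eq_natAbs]
  exact_mod_cast this

section

/-- The cross product in Euclidean space. -/
def vcross (x y : V3) : V3 :=
  !₂[x 1 * y 2 - x 2 * y 1, x 2 * y 0 - x 0 * y 2, x 0 * y 1 - x 1 * y 0]

lemma inner_vcross_vcross (a b c d : V3) :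
    inner ℝ (vcross a b) (vcross c d) =
      inner ℝ a c * inner ℝ b d - inner ℝ a d * inner ℝ b c := by
  simp [inner_three, vcross]; ring

lemma norm_vcross_sq (a b : V3) :
    ‖vcross a b‖ ^ 2 = ‖a‖ ^ 2 * ‖b‖ ^ 2 - (inner ℝ a b) ^ 2 := by
  rw [← real_inner_self_eq_norm_sq, inner_vcross_vcross, real_inner_self_eq_norm_sq,
    real_inner_self_eq_norm_sq, real_inner_comm a b]
  ring

lemma norm_vcross_le (a b : V3) : ‖vcross a b‖ ≤ ‖a‖ * ‖b‖ := by
  apply abs_le_of_sq_le_sq' _ (by positivity) |>.2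
  rw [norm_vcross_sq]; nlinarith [sq_nonneg (inner ℝ a b)]

lemma vcross_vcross (a b c : V3) :
    vcross (vcross a b) c = inner ℝ a c • b - inner ℝ b c • a := by
  ext i
  fin_cases i <;> simp [inner_three, vcross] <;> ring

lemma triple_smul (a b c p : V3) : triple a b c • p =
    inner ℝ a p • vcross b c + inner ℝ b p • vcross c a + inner ℝ c p • vcross a b := by
  ext i
  fin_cases i <;> simp [inner_three, vcross, triple] <;> ring

/-- If `x, y` are almost equidistant from the origin and almost parallel to `w`, they are close to
each other. -/
lemma norm_sub_le_of_vcross {w x y : V3} {Λ T e : ℝ} (hT : 0 ≤ T) (hx : |‖x‖ ^ 2 - Λ ^ 2| ≤ T ^ 2)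
    (hy : |‖y‖ ^ 2 - Λ ^ 2| ≤ T ^ 2) (hΛ : 0 < Λ) (hpx : Λ / 2 ≤ ‖x‖) (hxy : ‖x - y‖ ≤ Λ / 20)
    (hw : 0 < ‖w‖)
    (hwx : ‖vcross w x‖ ≤ e) (hwy : ‖vcross w y‖ ≤ e) : ‖x - y‖ ≤ 10 * (T + e / ‖w‖) := by
  have he : 0 ≤ e := (norm_nonneg _).trans hwx
  have hew : 0 ≤ e / ‖w‖ := by positivity
  rcases le_or_gt ‖x - y‖ T with hle | hlt
  · linarith
  set d := x - y with hd
  have hd0 : 0 < ‖d‖ := hT.trans_lt hlt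
  have h1 : |inner ℝ x d| ≤ T ^ 2 + ‖d‖ ^ 2 / 2 := by
    have h2 : ‖y‖ ^ 2 = ‖x‖ ^ 2 - 2 * inner ℝ x d + ‖d‖ ^ 2 := by
      rw [← norm_sub_sq_real, hd, sub_sub_cancel]
    have := sq_nonneg ‖d‖
    rw [abs_le] at *
    constructor <;> linarith [hx.1, hx.2, hy.1, hy.2]
  have h3 : ‖vcross w d‖ ≤ 2 * e := by
    have : vcross w d = vcross w x - vcross w y := by
      ext i; fin_cases i <;> simp [vcross, hd] <;> ring
    rw [this]; exact (_root_.norm_sub_le _ _).trans (by linarith)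
  have hx0 : 0 < ‖x‖ := by linarith
  have h4 : ‖x‖ ^ 2 * inner ℝ w d = inner ℝ w x * inner ℝ x d +
      inner ℝ (vcross w x) (vcross d x) := by
    rw [inner_vcross_vcross, real_inner_self_eq_norm_sq]; ring
  have h5 : ‖x‖ ^ 2 * |inner ℝ w d| ≤
      ‖w‖ * ‖x‖ * (T ^ 2 + ‖d‖ ^ 2 / 2) + e * (‖d‖ * ‖x‖) := by
    calc ‖x‖ ^ 2 * |inner ℝ w d| = |‖x‖ ^ 2 * inner ℝ w d| := by
          rw [abs_mul, abs_of_nonneg (sq_nonneg ‖x‖)]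
      _ ≤ |inner ℝ w x| * |inner ℝ x d| + |inner ℝ (vcross w x) (vcross d x)| := by
          rw [h4, ← abs_mul]; exact abs_add_le _ _
      _ ≤ _ := by
          gcongr
          · exact abs_real_inner_le_norm w x
          · refine (abs_real_inner_le_norm _ _).trans ?_
            gcongr; exact norm_vcross_le _ _
  have h6 : ‖x‖ * |inner ℝ w d| ≤ ‖w‖ * (T ^ 2 + ‖d‖ ^ 2 / 2) + e * ‖d‖ := by
    refine le_of_mul_le_mul_left ?_ hx0
    linarith
  have h7 : T ^ 2 ≤ Λ / 20 * T := by rw [sq]; gcongr; linarith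
  have h8 : ‖d‖ ^ 2 ≤ Λ / 20 * ‖d‖ := by rw [sq]; gcongr
  have h9 : |inner ℝ w d| ≤ ‖w‖ * T / 10 + ‖w‖ * ‖d‖ / 20 + e / 10 := by
    refine le_of_mul_le_mul_left ?_ (half_pos hΛ)
    calc Λ / 2 * |inner ℝ w d| ≤ ‖x‖ * |inner ℝ w d| := by gcongr
      _ ≤ _ := h6
      _ ≤ ‖w‖ * (Λ / 20 * T + Λ / 20 * ‖d‖ / 2) + e * (Λ / 20) := by gcongr
      _ = _ := by ring
  have h10 : ‖w‖ * ‖d‖ ≤ |inner ℝ w d| + ‖vcross w d‖ := by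
    apply abs_le_of_sq_le_sq' _ (by positivity) |>.2
    have h := norm_vcross_sq w d
    rw [← sq_abs (inner ℝ w d)] at h
    have h' : 0 ≤ |inner ℝ w d| * ‖vcross w d‖ := by positivity
    have h'' : (|inner ℝ w d| + ‖vcross w d‖) ^ 2 =
      |inner ℝ w d| ^ 2 + ‖vcross w d‖ ^ 2 + 2 * (|inner ℝ w d| * ‖vcross w d‖) := by ring
    rw [h'', h, mul_pow]; linarith
  refine le_of_mul_le_mul_left ?_ hw
  have h11 : ‖w‖ * (10 * (T + e / ‖w‖)) = 10 * (‖w‖ * T) + 10 * e := by field_simp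
  have : 0 ≤ ‖w‖ * T := by positivity
  rw [h11]; linarith

lemma abs_inner_of_vcross_eq_zero {a b : V3} (h : vcross a b = 0) :
    |inner ℝ a b| = ‖a‖ * ‖b‖ := by
  have h1 := norm_vcross_sq a b
  rw [h, norm_zero] at h1
  rw [← abs_of_nonneg (by positivity : 0 ≤ ‖a‖ * ‖b‖), ← sq_eq_sq_iff_abs_eq_abs]
  linarith

lemma abs_inner_mul_norm_of_vcross_eq_zero {a b : V3} (h : vcross a b = 0) (p : V3) :
    |inner ℝ p b| * ‖a‖ = |inner ℝ p a| * ‖b‖ := by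
  have h1 : inner ℝ p b * ‖a‖ ^ 2 = inner ℝ p a * inner ℝ a b := by
    have h2 := inner_vcross_vcross p a b a
    have h3 : vcross b a = -vcross a b := by
      ext i; fin_cases i <;> simp [vcross] <;> ring
    rw [h3, h, neg_zero, inner_zero_right, real_inner_self_eq_norm_sq] at h2
    linarith
  rcases eq_or_ne ‖a‖ 0 with h0 | h0
  · rw [norm_eq_zero] at h0; simp [h0]
  have h4 := congrArg abs h1
  rw [abs_mul, abs_mul, abs_inner_of_vcross_eq_zero h, abs_of_nonneg (sq_nonneg ‖a‖)] at h4
  apply mul_right_cancel₀ h0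
  linarith

/-- A lattice `φ` in Euclidean space, with the map `ψ` describing its cross products. -/
structure IsFrame (φ ψ : Freq →+ V3) (K : ℝ) : Prop where
  cross : ∀ x y, ψ (icross x y) = vcross (φ x) (φ y)
  abs_le : ∀ k i, |(k i : ℝ)| ≤ K * ‖φ k‖
  abs_le' : ∀ k i, |(k i : ℝ)| ≤ K * ‖ψ k‖
  idot_le : ∀ x y z, |(idot x (icross y z) : ℝ)| ≤ K * |triple (φ x) (φ y) (φ z)|

/-- The points of `F` are within `T` of each other and of the sphere of radius `Λ`. -/
structure IsCell (φ : Freq →+ V3) (F : Finset Freq) (Λ T : ℝ) : Prop where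
  pos : 0 < T
  pos' : 0 < Λ
  shell : ∀ k ∈ F, |‖φ k‖ ^ 2 - Λ ^ 2| ≤ T ^ 2
  norm_ge : ∀ k ∈ F, Λ / 2 ≤ ‖φ k‖
  norm_sub_le : ∀ k ∈ F, ∀ l ∈ F, ‖φ k - φ l‖ ≤ T

variable {φ ψ : Freq →+ V3} {K Λ T : ℝ} {F : Finset Freq}

lemma IsCell.abs_inner_le (hF : IsCell φ F Λ T) {x y p : Freq} (hx : x ∈ F) (hy : y ∈ F)
    (hp : p ∈ F) : |inner ℝ (φ (x - y)) (φ p)| ≤ 3 / 2 * T ^ 2 := by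
  have := abs_inner_sub_le (hF.shell x hx) (hF.shell y hy) (hF.norm_sub_le x hx p hp)
    (hF.norm_sub_le y hy p hp)
  rw [map_sub]; linarith

lemma IsCell.norm_map_sub_le (hF : IsCell φ F Λ T) {x y : Freq} (hx : x ∈ F) (hy : y ∈ F) :
    ‖φ (x - y)‖ ≤ T := by
  rw [map_sub]; exact hF.norm_sub_le x hx y hy

lemma IsFrame.ne_zero (hφ : IsFrame φ ψ K) {k : Freq} (hk : k ≠ 0) : 0 < ‖φ k‖ := by
  rw [norm_pos_iff]
  intro h
  apply hk
  ext i
  have := hφ.abs_le k i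
  rw [h, norm_zero, mul_zero] at this
  exact_mod_cast abs_nonpos_iff.mp this

lemma IsFrame.ne_zero' (hφ : IsFrame φ ψ K) {k : Freq} (hk : k ≠ 0) : 0 < ‖ψ k‖ := by
  rw [norm_pos_iff]
  intro h
  apply hk
  ext i
  have := hφ.abs_le' k i
  rw [h, norm_zero, mul_zero] at this
  exact_mod_cast abs_nonpos_iff.mp this

/-- A cell which is not contained in a plane has few points. -/
lemma IsCell.card_le_of_idot_ne_zero (hF : IsCell φ F Λ T) (hφ : IsFrame φ ψ K) (hK : 0 ≤ K)
    {k0 x y z : Freq} (hk0 : k0 ∈ F) (hx : x ∈ F) (hy : y ∈ F) (hz : z ∈ F)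
    (h : idot (x - k0) (icross (y - k0) (z - k0)) ≠ 0) :
    F.card * Λ ≤ 1125 * K * T ^ 4 := by
  obtain ⟨⟨a, b, c⟩, hm, hmax⟩ := Finset.exists_max_image (F ×ˢ F ×ˢ F)
    (fun q => |idot (q.1 - k0) (icross (q.2.1 - k0) (q.2.2 - k0))|)
    ⟨(x, y, z), by simp [hx, hy, hz]⟩
  have hmax' : ∀ u ∈ F, ∀ v ∈ F, ∀ w ∈ F, |idot (u - k0) (icross (v - k0) (w - k0))| ≤
      |idot (a - k0) (icross (b - k0) (c - k0))| := fun u hu v hv w hw =>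
    hmax (u, v, w) (by simp [hu, hv, hw])
  simp only [Finset.mem_product] at hm
  obtain ⟨ha, hb, hc⟩ := hm
  have h1 := card_le_idot_icross (F := F) k0 (a - k0) (b - k0) (c - k0) (by
    have := (abs_pos.mpr h).trans_le (hmax' x hx y hy z hz)
    exact abs_pos.mp this) (fun u hu => ⟨hmax' u hu b hb c hc, hmax' u hu c hc a ha,
      hmax' u hu a ha b hb⟩)
  have h2 := hφ.idot_le (a - k0) (b - k0) (c - k0)
  have h3 : |triple (φ (a - k0)) (φ (b - k0)) (φ (c - k0))| * ‖φ k0‖ ≤ 9 / 2 * T ^ 4 := by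
    rw [← Real.norm_eq_abs, ← norm_smul, triple_smul]
    have hT := hF.pos
    have key : ∀ u ∈ F, ∀ v ∈ F, ∀ w ∈ F,
        ‖inner ℝ (φ (u - k0)) (φ k0) • vcross (φ (v - k0)) (φ (w - k0))‖ ≤ 3 / 2 * T ^ 4 := by
      intro u hu v hv w hw
      rw [norm_smul, Real.norm_eq_abs]
      calc _ ≤ (3 / 2 * T ^ 2) * (T * T) := by
            gcongr
            · exact hF.abs_inner_le hu hk0 hk0
            · refine (norm_vcross_le _ _).trans ?_
              have := hF.norm_map_sub_le hv hk0
              have := hF.norm_map_sub_le hw hk0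
              gcongr
        _ = _ := by ring
    refine (norm_add₃_le).trans ?_
    linarith [key a ha b hb c hc, key b hb c hc a ha, key c hc a ha b hb]
  have h4 := hF.norm_ge k0 hk0
  have h5 : |triple (φ (a - k0)) (φ (b - k0)) (φ (c - k0))| * Λ ≤ 9 * T ^ 4 := by
    nlinarith [abs_nonneg (triple (φ (a - k0)) (φ (b - k0)) (φ (c - k0)))]
  have := hF.pos'
  calc F.card * Λ ≤ 125 * (K * |triple (φ (a - k0)) (φ (b - k0)) (φ (c - k0))|) * Λ := by
        gcongr; linarith
    _ = 125 * K * (|triple (φ (a - k0)) (φ (b - k0)) (φ (c - k0))| * Λ) := by ring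
    _ ≤ 125 * K * (9 * T ^ 4) := by gcongr
    _ = _ := by ring

lemma exists_idot_eq_gcd (m : Freq) : ∃ g : ℕ, ∃ m0 e : Freq, m = (g : ℤ) • m0 ∧ idot e m = g := by
  set g₁ : ℕ := Int.gcd (m 0) (m 1) with hg₁
  set g : ℕ := Int.gcd g₁ (m 2) with hg
  have h1 := Int.gcd_eq_gcd_ab (m 0) (m 1)
  have h2 := Int.gcd_eq_gcd_ab g₁ (m 2)
  have d1 : (g : ℤ) ∣ m 0 := (Int.gcd_dvd_left ..).trans (Int.gcd_dvd_left ..)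
  have d2 : (g : ℤ) ∣ m 1 := (Int.gcd_dvd_left ..).trans (Int.gcd_dvd_right ..)
  have d3 : (g : ℤ) ∣ m 2 := Int.gcd_dvd_right ..
  obtain ⟨a, ha⟩ := d1
  obtain ⟨b, hb⟩ := d2
  obtain ⟨c, hc⟩ := d3
  refine ⟨g, ![a, b, c], ![Int.gcdA (m 0) (m 1) * Int.gcdA g₁ (m 2),
    Int.gcdB (m 0) (m 1) * Int.gcdA g₁ (m 2), Int.gcdB g₁ (m 2)], ?_, ?_⟩
  · ext i; fin_cases i <;> simp [ha, hb, hc]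
  · rw [← hg, ← hg₁] at *
    rw [h2, h1]
    simp [idot]; ring

lemma abs_idot_le_of_icross_eq_zero {m m' : Freq} (hm : m ≠ 0) (h : icross m m' = 0)
    (hle : idot m' m' ≤ idot m m) (e : Freq) : |idot e m'| ≤ |idot e m| := by
  have c0 := congrFun h 0
  have c1 := congrFun h 1
  have c2 := congrFun h 2
  simp [icross] at c0 c1 c2
  have k0 : idot e m' * m 0 = idot e m * m' 0 := by
    unfold idot; linear_combination (e 1) * c2 - (e 2) * c1
  have k1 : idot e m' * m 1 = idot e m * m' 1 := by
    unfold idot; linear_combination (e 2) * c0 - (e 0) * c2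
  have k2 : idot e m' * m 2 = idot e m * m' 2 := by
    unfold idot; linear_combination (e 0) * c1 - (e 1) * c0
  have hpos : 0 < idot m m := by
    by_contra! hcon
    unfold idot at hcon
    apply hm
    have := mul_self_nonneg (m 0)
    have := mul_self_nonneg (m 1)
    have := mul_self_nonneg (m 2)
    ext i
    fin_cases i <;> refine mul_self_eq_zero.mp ?_ <;> simp only [Fin.zero_eta, Fin.mk_one, Fin.reduceFinMk] <;> linarith
  rw [← sq_le_sq]
  refine le_of_mul_le_mul_right ?_ hpos
  calc idot e m' ^ 2 * idot m m = (idot e m' * m 0) ^ 2 + (idot e m' * m 1) ^ 2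
        + (idot e m' * m 2) ^ 2 := by rw [idot.eq_def m m]; ring
    _ = idot e m ^ 2 * idot m' m' := by rw [k0, k1, k2, idot.eq_def m' m']; ring
    _ ≤ _ := by gcongr

/-- The direction of a cell contained in a plane but not in a line. -/
lemma IsCell.exists_normal (hF : IsCell φ F Λ T) (hφ : IsFrame φ ψ K)
    {k0 x y : Freq} (hk0 : k0 ∈ F) (hx : x ∈ F) (hy : y ∈ F)
    (h : icross (x - k0) (y - k0) ≠ 0)
    (h0 : ∀ x ∈ F, ∀ y ∈ F, ∀ z ∈ F, idot (x - k0) (icross (y - k0) (z - k0)) = 0) :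
    ∃ m : Freq, m ≠ 0 ∧ F.card * ‖ψ m‖ ≤ 125 * T ^ 2 ∧
      ∀ k ∈ F, F.card * ‖vcross (ψ m) (φ k)‖ ≤ 375 * T ^ 3 := by
  have hT := hF.pos
  obtain ⟨⟨a, b⟩, hab, hmax⟩ := Finset.exists_max_image (F ×ˢ F)
    (fun q => idot (icross (q.1 - k0) (q.2 - k0)) (icross (q.1 - k0) (q.2 - k0)))
    ⟨(x, y), by simp [hx, hy]⟩
  obtain ⟨ha, hb⟩ := Finset.mem_product.mp hab
  have hmax' : ∀ u ∈ F, ∀ v ∈ F,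
      idot (icross (u - k0) (v - k0)) (icross (u - k0) (v - k0)) ≤
      idot (icross (a - k0) (b - k0)) (icross (a - k0) (b - k0)) := fun u hu v hv =>
    hmax (u, v) (by simp [hu, hv])
  set m := icross (a - k0) (b - k0) with hm
  have hm0 : m ≠ 0 := by
    intro hcon
    have h1 := hmax' x hx y hy
    rw [hcon] at h1
    apply h
    have h2 : idot (0 : Freq) 0 = 0 := rfl
    rw [h2] at h1
    unfold idot at h1
    set n := icross (x - k0) (y - k0)
    have := mul_self_nonneg (n 0)
    have := mul_self_nonneg (n 1)
    have := mul_self_nonneg (n 2)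
    ext i
    fin_cases i <;> refine mul_self_eq_zero.mp ?_ <;>
      simp only [Fin.zero_eta, Fin.mk_one, Fin.reduceFinMk] <;> linarith
  obtain ⟨g, m0, e, hg, he⟩ := exists_idot_eq_gcd m
  have hg0 : g ≠ 0 := by rintro rfl; apply hm0; rw [hg]; simp
  have hde : idot (a - k0) (icross (b - k0) e) = g := by
    rw [← he, hm]; simp [idot, icross]; ring
  have key : ∀ u ∈ F, |idot e (icross (u - k0) (b - k0))| ≤ |idot e m| ∧
      |idot e (icross (a - k0) (u - k0))| ≤ |idot e m| := by
    intro u hu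
    have hz := h0 a ha b hb u hu
    constructor
    · refine abs_idot_le_of_icross_eq_zero hm0 ?_ (hmax' u hu b hb) e
      have : icross m (icross (u - k0) (b - k0)) =
          (-idot (a - k0) (icross (b - k0) (u - k0))) • (b - k0) := by
        ext i; fin_cases i <;> simp [hm, icross, idot] <;> ring
      rw [this, hz]; simp
    · refine abs_idot_le_of_icross_eq_zero hm0 ?_ (hmax' a ha u hu) e
      have : icross m (icross (a - k0) (u - k0)) =
          (idot (a - k0) (icross (b - k0) (u - k0))) • (a - k0) := by
        ext i; fin_cases i <;> simp [hm, icross, idot] <;> ring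
      rw [this, hz]; simp
  have hcard := card_le_idot_icross (F := F) k0 (a - k0) (b - k0) e
    (by rw [hde]; exact_mod_cast hg0) (fun u hu => by
      obtain ⟨k1, k2⟩ := key u hu
      rw [he] at k1 k2
      rw [hde]
      refine ⟨?_, ?_, ?_⟩
      · convert k1 using 2; simp [idot, icross]; ring
      · convert k2 using 2; simp [idot, icross]; ring
      · have hz := h0 u hu a ha b hb
        rw [hz]; simp)
  rw [hde] at hcard
  simp only [Int.cast_natCast, Nat.abs_cast] at hcard
  have hψ : vcross (φ (a - k0)) (φ (b - k0)) = (g : ℝ) • ψ m0 := by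
    rw [← hφ.cross, ← hm, hg, map_zsmul, natCast_zsmul, Nat.cast_smul_eq_nsmul]
  have hgn : (0 : ℝ) < g := by positivity
  refine ⟨m0, ?_, ?_, ?_⟩
  · rintro rfl; apply hm0; rw [hg]; simp
  · have h1 : (g : ℝ) * ‖ψ m0‖ ≤ T ^ 2 := by
      calc (g : ℝ) * ‖ψ m0‖ = ‖(g : ℝ) • ψ m0‖ := by rw [norm_smul]; simp
        _ ≤ ‖φ (a - k0)‖ * ‖φ (b - k0)‖ := by rw [← hψ]; exact norm_vcross_le _ _
        _ ≤ T * T := by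
          have := hF.norm_map_sub_le ha hk0
          have := hF.norm_map_sub_le hb hk0
          gcongr
        _ = _ := by ring
    calc F.card * ‖ψ m0‖ ≤ 125 * g * ‖ψ m0‖ := by gcongr
      _ ≤ _ := by linarith
  · intro k hk
    have h1 : (g : ℝ) * ‖vcross (ψ m0) (φ k)‖ ≤ 3 * T ^ 3 := by
      have h2 : vcross ((g : ℝ) • ψ m0) (φ k) = (g : ℝ) • vcross (ψ m0) (φ k) := by
        ext i; fin_cases i <;> simp [vcross] <;> ring
      calc (g : ℝ) * ‖vcross (ψ m0) (φ k)‖ = ‖(g : ℝ) • vcross (ψ m0) (φ k)‖ := by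
            rw [norm_smul]; simp
        _ ≤ ‖inner ℝ (φ (a - k0)) (φ k) • φ (b - k0)‖ +
            ‖inner ℝ (φ (b - k0)) (φ k) • φ (a - k0)‖ := by
          rw [← h2, ← hψ, vcross_vcross]; exact _root_.norm_sub_le _ _
        _ ≤ 3 / 2 * T ^ 2 * T + 3 / 2 * T ^ 2 * T := by
          rw [norm_smul, norm_smul, Real.norm_eq_abs, Real.norm_eq_abs]
          gcongr
          · exact hF.abs_inner_le ha hk0 hk
          · exact hF.norm_map_sub_le hb hk0
          · exact hF.abs_inner_le hb hk0 hk
          · exact hF.norm_map_sub_le ha hk0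
        _ = _ := by ring
    calc F.card * ‖vcross (ψ m0) (φ k)‖ ≤ 125 * g * ‖vcross (ψ m0) (φ k)‖ := by gcongr
      _ ≤ _ := by linarith

/-- The direction of a cell contained in a line. -/
lemma IsCell.exists_direction (hF : IsCell φ F Λ T) (hφ : IsFrame φ ψ K)
    {x₀ y₀ : Freq} (hx₀ : x₀ ∈ F) (hy₀ : y₀ ∈ F) (hne : x₀ ≠ y₀)
    (h0 : ∀ x ∈ F, ∀ y ∈ F, ∀ z ∈ F, icross (x - z) (y - z) = 0) :
    ∃ v : Freq, v ≠ 0 ∧ F.card * ‖φ v‖ ≤ 5 * T ∧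
      ∀ k ∈ F, F.card * |inner ℝ (φ k) (φ v)| ≤ 15 / 2 * T ^ 2 := by
  have hT := hF.pos
  have hoff : (x₀, y₀) ∈ F.offDiag := by simp [hx₀, hy₀, hne]
  obtain ⟨⟨a, b⟩, hab, hmin⟩ := F.offDiag.exists_min_image (fun q => ‖φ (q.1 - q.2)‖) ⟨_, hoff⟩
  obtain ⟨⟨c, d⟩, hcd, hmax⟩ := F.offDiag.exists_max_image (fun q => ‖φ (q.1 - q.2)‖) ⟨_, hoff⟩
  have hLV := hmin _ hcd
  rw [Finset.mem_offDiag] at hab hcd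
  obtain ⟨ha, hb, hab⟩ := hab
  obtain ⟨hc, hd, hcd⟩ := hcd
  dsimp only at ha hb hab hc hd hcd hmin hmax hLV
  have hv : a - b ≠ 0 := sub_ne_zero.mpr hab
  have hV := hφ.ne_zero hv
  set v := a - b with hvdef
  set L := ‖φ (c - d)‖ with hL
  have hpar : ∀ x ∈ F, ∀ y ∈ F, vcross (φ (x - y)) (φ v) = 0 := by
    intro x hx y hy
    have h1 : icross (x - y) v = 0 := by
      have e1 := h0 x hx a ha y hy
      have e2 := h0 x hx b hb y hy
      have : icross (x - y) v = icross (x - y) (a - y) - icross (x - y) (b - y) := by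
        ext i; fin_cases i <;> simp [icross, hvdef] <;> ring
      rw [this, e1, e2, sub_zero]
    rw [← hφ.cross, h1, map_zero]
  have hcard : F.card * ‖φ v‖ ≤ 5 * L := by
    set f : Freq → ℤ := fun x => ⌊inner ℝ (φ x) (φ v) / ‖φ v‖ ^ 2⌋ with hf
    have hinj : Set.InjOn f F := by
      intro x hx y hy hxy
      by_contra hne
      have h1 := Int.abs_sub_lt_one_of_floor_eq_floor hxy
      rw [← sub_div, ← inner_sub_left, ← map_sub, abs_div, abs_inner_of_vcross_eq_zero
        (hpar x hx y hy), abs_of_pos (by positivity : 0 < ‖φ v‖ ^ 2), div_lt_one (by positivity),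
        sq] at h1
      have h2 := hmin (x, y) (Finset.mem_offDiag.mpr ⟨hx, hy, hne⟩)
      dsimp only at h2
      have := lt_of_mul_lt_mul_right h1 hV.le
      linarith
    set n : ℕ := ⌈L / ‖φ v‖⌉₊ with hn
    have hmem : ∀ x ∈ F, f x ∈ Finset.Icc (f a - n) (f a + n) := by
      intro x hx
      have h1 : |f x - f a| ≤ n := by
        refine abs_floor_sub_le (by positivity) ?_
        rw [← inner_sub_left, ← map_sub, abs_inner_of_vcross_eq_zero (hpar x hx a ha)]
        have h2 : ‖φ (x - a)‖ ≤ L := by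
          rcases eq_or_ne x a with rfl | hxa
          · simp [hL]
          · exact hmax (x, a) (Finset.mem_offDiag.mpr ⟨hx, ha, hxa⟩)
        have h3 : L ≤ n * ‖φ v‖ := by rw [← div_le_iff₀ hV]; exact Nat.le_ceil _
        calc ‖φ (x - a)‖ * ‖φ v‖ ≤ (n * ‖φ v‖) * ‖φ v‖ := by gcongr; linarith
          _ = _ := by ring
      rw [abs_le] at h1
      rw [Finset.mem_Icc]; omega
    have h1 := Finset.card_le_card_of_injOn f hmem hinj
    rw [Int.card_Icc, show f a + n + 1 - (f a - n) = ((2 * n + 1 : ℕ) : ℤ) by push_cast; ring,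
      Int.toNat_natCast] at h1
    have h2 : (F.card : ℝ) ≤ 2 * n + 1 := by exact_mod_cast h1
    have h3 : (n : ℝ) < L / ‖φ v‖ + 1 := Nat.ceil_lt_add_one (by positivity)
    have h4 : L / ‖φ v‖ * ‖φ v‖ = L := div_mul_cancel₀ _ hV.ne'
    calc F.card * ‖φ v‖ ≤ (2 * (L / ‖φ v‖ + 1) + 1) * ‖φ v‖ := by gcongr; linarith
      _ = 2 * L + 3 * ‖φ v‖ := by rw [add_mul, mul_assoc, add_mul, h4]; ring
      _ ≤ _ := by linarith
  have hLT : L ≤ T := hF.norm_map_sub_le hc hd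
  have hL0 : 0 < L := by linarith
  refine ⟨v, hv, by linarith, fun k hk => ?_⟩
  have h1 := abs_inner_mul_norm_of_vcross_eq_zero (hpar c hc d hd) (φ k)
  have h2 : |inner ℝ (φ k) (φ (c - d))| ≤ 3 / 2 * T ^ 2 := by
    rw [real_inner_comm]; exact hF.abs_inner_le hc hd hk
  refine le_of_mul_le_mul_right ?_ hL0
  calc F.card * |inner ℝ (φ k) (φ v)| * L
      = (F.card * ‖φ v‖) * |inner ℝ (φ k) (φ (c - d))| := by rw [mul_assoc, h1]; ring
    _ ≤ (5 * L) * (3 / 2 * T ^ 2) := by gcongr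
    _ = _ := by ring

end

open Matrix in
lemma exists_isFrame (B : Matrix (Fin 3) (Fin 3) ℝ) (hB : B.det ≠ 0) :
    ∃ φ ψ : Freq →+ V3, ∃ K : ℝ, 1 ≤ K ∧ IsFrame φ ψ K ∧
      ∀ k, φ k = WithLp.toLp 2 (B *ᵥ fun i => (k i : ℝ)) := by
  have lower : ∀ M : Matrix (Fin 3) (Fin 3) ℝ, M.det ≠ 0 → ∃ K : ℝ, ∀ (k : Freq) (i : Fin 3),
      |(k i : ℝ)| ≤ K * ‖(WithLp.toLp 2 (M *ᵥ fun i => (k i : ℝ)) : V3)‖ := by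
    intro M hM
    refine ⟨∑ i, ∑ j, |M⁻¹ i j|, fun k i => ?_⟩
    set y : V3 := WithLp.toLp 2 (M *ᵥ fun i => (k i : ℝ)) with hy
    have h1 : (k i : ℝ) = ∑ j, M⁻¹ i j * y j := by
      have : M⁻¹ *ᵥ (M *ᵥ fun i => (k i : ℝ)) = fun i => (k i : ℝ) := by
        rw [Matrix.mulVec_mulVec, Matrix.nonsing_inv_mul _ (by rwa [isUnit_iff_ne_zero]),
          Matrix.one_mulVec]
      exact (congrFun this i).symm
    rw [h1]
    calc |∑ j, M⁻¹ i j * y j| ≤ ∑ j, |M⁻¹ i j * y j| := Finset.abs_sum_le_sum_abs _ _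
      _ ≤ ∑ j, |M⁻¹ i j| * ‖y‖ := by
          gcongr with j
          rw [abs_mul]; gcongr; exact abs_coord_le y j
      _ = (∑ j, |M⁻¹ i j|) * ‖y‖ := by rw [Finset.sum_mul]
      _ ≤ _ := by
          refine mul_le_mul_of_nonneg_right ?_ (norm_nonneg y)
          exact Finset.single_le_sum (f := fun i => ∑ j, |M⁻¹ i j|)
            (fun _ _ => by positivity) (Finset.mem_univ i)
  let lat : Matrix (Fin 3) (Fin 3) ℝ → (Freq →+ V3) := fun M =>
    { toFun := fun k => WithLp.toLp 2 (M *ᵥ fun i => (k i : ℝ))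
      map_zero' := by
        ext i; simp [Matrix.mulVec, dotProduct]
      map_add' := fun k l => by
        ext i; simp [Matrix.mulVec, dotProduct, mul_add, Finset.sum_add_distrib] }
  have hdet : (B.adjugateᵀ).det ≠ 0 := by
    rw [Matrix.det_transpose, Matrix.det_adjugate]; positivity
  obtain ⟨K₁, hK₁⟩ := lower B hB
  obtain ⟨K₂, hK₂⟩ := lower _ hdet
  set K := max 1 (max K₁ (max K₂ |B.det|⁻¹)) with hK
  refine ⟨lat B, lat B.adjugateᵀ, K, le_max_left _ _, ⟨?_, ?_, ?_, ?_⟩, fun k => rfl⟩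
  · intro x y
    ext i
    fin_cases i <;>
    · simp [lat, Matrix.mulVec, dotProduct, Fin.sum_univ_three, Matrix.adjugate_fin_three, icross,
        vcross]
      ring
  · intro k i
    refine (hK₁ k i).trans ?_
    change _ ≤ K * ‖(WithLp.toLp 2 (B *ᵥ fun i => (k i : ℝ)) : V3)‖
    gcongr
    exact (le_max_left _ _).trans (le_max_right _ _)
  · intro k i
    refine (hK₂ k i).trans ?_
    change _ ≤ K * ‖(WithLp.toLp 2 (B.adjugateᵀ *ᵥ fun i => (k i : ℝ)) : V3)‖
    gcongr
    exact (le_max_left _ _).trans ((le_max_right _ _).trans (le_max_right _ _))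
  · intro x y z
    have h1 : triple (lat B x) (lat B y) (lat B z) = B.det * idot x (icross y z) := by
      rw [Matrix.det_fin_three]
      simp [lat, Matrix.mulVec, dotProduct, Fin.sum_univ_three, idot, icross, triple]
      ring
    have h2 : |B.det|⁻¹ ≤ K :=
      (le_max_right _ _).trans ((le_max_right _ _).trans (le_max_right _ _))
    have h3 : 0 < |B.det| := abs_pos.mpr hB
    rw [h1, abs_mul, ← mul_assoc]
    have h4 : 1 ≤ K * |B.det| := by
      calc (1 : ℝ) = |B.det|⁻¹ * |B.det| := (inv_mul_cancel₀ h3.ne').symm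
        _ ≤ _ := by gcongr
    exact le_mul_of_one_le_left (abs_nonneg _) h4

open Matrix MatrixOrder ComplexOrder in
lemma exists_frame_of_posDef {A : Matrix (Fin 3) (Fin 3) ℝ} (hA : A.PosDef) :
    ∃ φ ψ : Freq →+ V3, ∃ K : ℝ, 1 ≤ K ∧ IsFrame φ ψ K ∧
      ∀ k, ‖φ k‖ ^ 2 = ∑ i, ∑ j, A i j * k i * k j := by
  obtain ⟨B, hB⟩ := CStarAlgebra.nonneg_iff_eq_star_mul_self.mp hA.posSemidef.nonneg
  have hdet : B.det ≠ 0 := by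
    intro h
    have := hA.det_pos
    rw [hB, Matrix.det_mul, h, mul_zero] at this
    exact lt_irrefl _ this
  obtain ⟨φ, ψ, K, hK, hφ, hφB⟩ := exists_isFrame B hdet
  refine ⟨φ, ψ, K, hK, hφ, fun k => ?_⟩
  rw [hφB, norm_sq_three, hB]
  simp [Matrix.mulVec, dotProduct, Fin.sum_univ_three, Matrix.mul_apply, Matrix.star_apply]
  ring

lemma sum_inv_max_le (N : ℕ) :
    ∑ j ∈ Finset.Icc (-(N : ℤ)) N, (max 1 |(j : ℝ)|)⁻¹ ≤ 4 + 2 * Real.log N := by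
  have hsub : Finset.Icc (-(N : ℤ)) N ⊆
      (Finset.range (N + 1)).image (fun n : ℕ => (n : ℤ)) ∪
      (Finset.range (N + 1)).image (fun n : ℕ => -(n : ℤ)) := by
    intro j hj
    rw [Finset.mem_Icc] at hj
    rw [Finset.mem_union, Finset.mem_image, Finset.mem_image]
    rcases le_total 0 j with h | h
    · exact Or.inl ⟨j.toNat, by rw [Finset.mem_range]; omega, by omega⟩
    · exact Or.inr ⟨(-j).toNat, by rw [Finset.mem_range]; omega, by omega⟩
  have h1 : ∑ n ∈ Finset.range (N + 1), (max 1 (n : ℝ))⁻¹ ≤ 2 + Real.log N := by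
    rw [Finset.sum_range_succ']
    have h2 : ∀ n : ℕ, (max 1 ((n + 1 : ℕ) : ℝ))⁻¹ = ((n : ℝ) + 1)⁻¹ := fun n => by
      rw [max_eq_right (by push_cast; linarith [n.cast_nonneg (α := ℝ)])]; push_cast; rfl
    simp only [h2]
    have h3 := harmonic_le_one_add_log N
    rw [harmonic] at h3
    push_cast at h3
    simp only [Nat.cast_zero, zero_le_one, sup_of_le_left, inv_one]
    linarith
  calc _ ≤ ∑ j ∈ (Finset.range (N + 1)).image (fun n : ℕ => (n : ℤ)) ∪
      (Finset.range (N + 1)).image (fun n : ℕ => -(n : ℤ)), (max 1 |(j : ℝ)|)⁻¹ :=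
        Finset.sum_le_sum_of_subset_of_nonneg hsub fun _ _ _ => by positivity
    _ ≤ ∑ j ∈ (Finset.range (N + 1)).image (fun n : ℕ => (n : ℤ)), (max 1 |(j : ℝ)|)⁻¹ +
        ∑ j ∈ (Finset.range (N + 1)).image (fun n : ℕ => -(n : ℤ)), (max 1 |(j : ℝ)|)⁻¹ := by
        rw [← Finset.sum_union_inter]
        exact le_add_of_nonneg_right (Finset.sum_nonneg fun _ _ => by positivity)
    _ = 2 * ∑ n ∈ Finset.range (N + 1), (max 1 (n : ℝ))⁻¹ := by
        rw [Finset.sum_image (by intro a _ b _ h; simpa using h),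
          Finset.sum_image (by intro a _ b _ h; simpa using h)]
        simp [two_mul]
    _ ≤ _ := by linarith

/-- The sum of `‖χ m‖⁻³` over a lattice grows slower than any power. -/
lemma exists_sum_inv_cube_le {χ : Freq →+ V3} {K : ℝ} (hK : 1 ≤ K)
    (hχ : ∀ k i, |(k i : ℝ)| ≤ K * ‖χ k‖) {η : ℝ} (hη : 0 < η) :
    ∃ C : ℝ, 0 < C ∧ ∀ (M : ℝ) (Z : Finset Freq), 1 ≤ M → (∀ m ∈ Z, m ≠ 0) →
      (∀ m ∈ Z, ‖χ m‖ ≤ M) → ∑ m ∈ Z, (‖χ m‖ ^ 3)⁻¹ ≤ C * M ^ η := by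
  refine ⟨K ^ 3 * (4 + 6 / η * K ^ (η / 3)) ^ 3, by positivity, fun M Z hM hZ0 hZM => ?_⟩
  set N : ℕ := ⌊K * M⌋₊ with hN
  have hKM : 1 ≤ K * M := one_le_mul_of_one_le_of_one_le hK hM
  have hN1 : 1 ≤ N := Nat.one_le_floor_iff _ |>.mpr hKM
  have hNK : (N : ℝ) ≤ K * M := Nat.floor_le (by positivity)
  have hmem : Z ⊆ Fintype.piFinset fun _ : Fin 3 => Finset.Icc (-(N : ℤ)) N := by
    intro m hm
    rw [Fintype.mem_piFinset]
    intro i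
    have h1 : |(m i : ℝ)| ≤ K * M := (hχ m i).trans (by have := hZM m hm; gcongr)
    have h2 : ((m i).natAbs : ℝ) ≤ K * M := by rwa [Nat.cast_natAbs, Int.cast_abs]
    have h3 : (m i).natAbs ≤ N := Nat.le_floor h2
    rw [Finset.mem_Icc]; omega
  have hpt : ∀ m ∈ Z, (‖χ m‖ ^ 3)⁻¹ ≤ K ^ 3 * ∏ i, (max 1 |(m i : ℝ)|)⁻¹ := by
    intro m hm
    have hone : 1 ≤ K * ‖χ m‖ := by
      obtain ⟨i, hi⟩ := Function.ne_iff.mp (hZ0 m hm)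
      refine le_trans ?_ (hχ m i)
      exact_mod_cast Int.one_le_abs hi
    have hχ0 : 0 < ‖χ m‖ := by by_contra! h; nlinarith
    have h1 : ∏ i, max 1 |(m i : ℝ)| ≤ K ^ 3 * ‖χ m‖ ^ 3 := by
      calc ∏ i, max 1 |(m i : ℝ)| ≤ ∏ _i : Fin 3, (K * ‖χ m‖) :=
            Finset.prod_le_prod (fun _ _ => by positivity) fun i _ => max_le hone (hχ m i)
        _ = _ := by simp; ring
    have hpos : 0 < ∏ i, max 1 |(m i : ℝ)| := by positivity
    rw [Finset.prod_inv_distrib, ← div_eq_mul_inv, inv_eq_one_div, div_le_div_iff₀ (by positivity) hpos]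
    linarith
  have hlog : 4 + 2 * Real.log N ≤ (4 + 6 / η * K ^ (η / 3)) * M ^ (η / 3) := by
    have h1 := Real.log_le_rpow_div (x := (N : ℝ)) (by positivity) (ε := η / 3) (by positivity)
    have h2 : (N : ℝ) ^ (η / 3) ≤ K ^ (η / 3) * M ^ (η / 3) := by
      rw [← Real.mul_rpow (by positivity) (by positivity)]
      gcongr
    have h3 : 1 ≤ M ^ (η / 3) := Real.one_le_rpow hM (by positivity)
    have h4 : (N : ℝ) ^ (η / 3) / (η / 3) ≤ 3 / η * (K ^ (η / 3) * M ^ (η / 3)) := by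
      rw [div_div_eq_mul_div, mul_comm, mul_div_right_comm]
      gcongr
    calc 4 + 2 * Real.log N ≤ 4 * M ^ (η / 3) + 2 * (3 / η * (K ^ (η / 3) * M ^ (η / 3))) := by
          linarith
      _ = _ := by ring
  have h0 : 0 ≤ 4 + 2 * Real.log N :=
    add_nonneg (by norm_num) (mul_nonneg (by norm_num) (Real.log_natCast_nonneg N))
  calc ∑ m ∈ Z, (‖χ m‖ ^ 3)⁻¹ ≤ ∑ m ∈ Z, K ^ 3 * ∏ i, (max 1 |(m i : ℝ)|)⁻¹ :=
        Finset.sum_le_sum hpt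
    _ ≤ ∑ m ∈ Fintype.piFinset fun _ : Fin 3 => Finset.Icc (-(N : ℤ)) N,
          K ^ 3 * ∏ i, (max 1 |(m i : ℝ)|)⁻¹ :=
        Finset.sum_le_sum_of_subset_of_nonneg hmem fun _ _ _ => by positivity
    _ = K ^ 3 * (∑ j ∈ Finset.Icc (-(N : ℤ)) N, (max 1 |(j : ℝ)|)⁻¹) ^ 3 := by
        rw [← Finset.mul_sum,
          Finset.sum_prod_piFinset (Finset.Icc (-(N : ℤ)) N) fun _ j => (max 1 |(j : ℝ)|)⁻¹]
        simp
    _ ≤ K ^ 3 * ((4 + 6 / η * K ^ (η / 3)) * M ^ (η / 3)) ^ 3 := by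
        gcongr
        exact (sum_inv_max_le N).trans hlog
    _ = _ := by
        rw [mul_pow, ← Real.rpow_natCast (M ^ (η / 3)), ← Real.rpow_mul (by positivity)]
        norm_num
        ring

section

/-- A piece of a thin shell all of whose cells (cubes of side `T / 2`) have about `ν` points. -/
structure IsPiece (φ : Freq →+ V3) (S : Finset Freq) (Λ T ν : ℝ) : Prop where
  one_le : 1 ≤ T
  le : T ≤ 2 * Λ
  one_le' : 1 ≤ ν
  shell : ∀ k ∈ S, |‖φ k‖ ^ 2 - Λ ^ 2| ≤ T ^ 2
  norm_ge : ∀ k ∈ S, Λ / 2 ≤ ‖φ k‖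
  norm_le : ∀ k ∈ S, ‖φ k‖ ≤ 2 * Λ
  cap : ∀ k ∈ S, ∀ l ∈ S, ‖φ k - φ l‖ ≤ Λ / 20
  card_cell : ∀ c, ((S.filter fun l => cube φ (T / 2) l = c).card : ℝ) ≤ 2 * ν

variable {φ ψ : Freq →+ V3} {K Λ T ν : ℝ} {S : Finset Freq}

lemma IsPiece.pos (hS : IsPiece φ S Λ T ν) : 0 < Λ := by linarith [hS.one_le, hS.le]

lemma IsPiece.card_le_image (hS : IsPiece φ S Λ T ν) {U : Finset Freq} (hU : U ⊆ S) :
    (U.card : ℝ) ≤ 2 * ν * (U.image (cube φ (T / 2))).card := by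
  rw [Finset.card_eq_sum_card_image (cube φ (T / 2)) U]
  push_cast
  calc ∑ c ∈ U.image (cube φ (T / 2)), ((U.filter fun l => cube φ (T / 2) l = c).card : ℝ)
      ≤ ∑ _c ∈ U.image (cube φ (T / 2)), 2 * ν := by
        refine Finset.sum_le_sum fun c _ => le_trans ?_ (hS.card_cell c)
        exact_mod_cast Finset.card_le_card (Finset.filter_subset_filter _ hU)
    _ = _ := by rw [Finset.sum_const, nsmul_eq_mul]; ring

lemma IsPiece.card_le (hS : IsPiece φ S Λ T ν) {U : Finset Freq} (hU : U ⊆ S) {R : ℝ}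
    (hR : 0 ≤ R) (h : ∀ k ∈ U, ∀ l ∈ U, ‖φ k - φ l‖ ≤ R * T) :
    (U.card : ℝ) ≤ 2 * ν * (4 * R + 3) ^ 3 := by
  have hT : 0 < T := zero_lt_one.trans_le hS.one_le
  have h1 := card_image_cube_le (φ := φ) (half_pos hT) (by positivity) h
  have hν := hS.one_le'
  refine (hS.card_le_image hU).trans ?_
  have h2 : 2 * (R * T / (T / 2)) = 4 * R := by field_simp; ring
  rw [h2] at h1
  gcongr

lemma IsPiece.isShell (hS : IsPiece φ S Λ T ν) : IsShell φ S Λ T (686 * ν) where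
  pos := zero_lt_one.trans_le hS.one_le
  shell := hS.shell
  cap := fun k hk l hl => (hS.cap k hk l hl).trans (by linarith [hS.pos])
  card_le := fun U hU h => by
    have := hS.card_le hU zero_le_one (by simpa using h)
    norm_num at this; linarith

/-- The number of points in a piece whose cells are planar. -/
lemma exists_card_planar_le (hφ : IsFrame φ ψ K) (hK : 1 ≤ K) {η : ℝ} (hη : 0 < η) :
    ∃ C : ℝ, 0 < C ∧ ∀ S Λ T ν, IsPiece φ S Λ T ν → ∀ m : (Fin 3 → ℤ) → Freq,
      (∀ k ∈ S, m (cube φ (T / 2) k) ≠ 0) →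
      (∀ k ∈ S, ν * ‖ψ (m (cube φ (T / 2) k))‖ ≤ 125 * T ^ 2) →
      (∀ k ∈ S, ν * ‖vcross (ψ (m (cube φ (T / 2) k))) (φ k)‖ ≤ 375 * T ^ 3) →
      S.card * ν ^ 2 ≤ C * T ^ η * T ^ 6 := by
  obtain ⟨C, hC, hsum⟩ := exists_sum_inv_cube_le hK hφ.abs_le' (half_pos hη)
  refine ⟨2 * 21000 ^ 3 * (C * (125 * K) ^ (η / 2)), by positivity,
    fun S Λ T ν hS m hm0 hm1 hm2 => ?_⟩
  have hT1 := hS.one_le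
  have hT : 0 < T := by linarith
  have hν1 := hS.one_le'
  have hν : 0 < ν := by linarith
  have hΛ := hS.pos
  set cell := cube φ (T / 2) with hcell
  have hψ : ∀ k ∈ S, 0 < ‖ψ (m (cell k))‖ := fun k hk => hφ.ne_zero' (hm0 k hk)
  set Z := (S.image cell).image m with hZ
  have hZmem : ∀ z ∈ Z, ∃ k ∈ S, m (cell k) = z := by
    intro z hz
    obtain ⟨c, hc, rfl⟩ := Finset.mem_image.mp hz
    obtain ⟨k, hk, rfl⟩ := Finset.mem_image.mp hc
    exact ⟨k, hk, rfl⟩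
  have hcells : ∀ z ∈ Z, (((S.image cell).filter fun c => m c = z).card : ℝ) ≤
      21000 ^ 3 * (T ^ 6 / ν ^ 3) * (‖ψ z‖ ^ 3)⁻¹ := by
    intro z hz
    obtain ⟨k0, hk0, hk0z⟩ := hZmem z hz
    have hz0 : 0 < ‖ψ z‖ := by rw [← hk0z]; exact hψ k0 hk0
    set U := S.filter fun k => m (cell k) = z with hU
    have h1 : ((S.image cell).filter fun c => m c = z) = U.image cell := by
      rw [hU, Finset.filter_image]
    set t := T ^ 2 / (ν * ‖ψ z‖) with ht
    have ht0 : 1 ≤ 125 * t := by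
      rw [ht, ← mul_div_assoc, one_le_div (by positivity), ← hk0z]
      exact hm1 k0 hk0
    have h2 := card_image_cube_le (φ := φ) (S := U) (s := T / 2) (R := 10 * (T + 375 * T ^ 3 / ν / ‖ψ z‖))
      (by positivity) (by positivity) (by
        intro k hk l hl
        obtain ⟨hkS, hkz⟩ := Finset.mem_filter.mp hk
        obtain ⟨hlS, hlz⟩ := Finset.mem_filter.mp hl
        refine norm_sub_le_of_vcross hT.le (hS.shell k hkS) (hS.shell l hlS) hΛ (hS.norm_ge k hkS)
          (hS.cap k hkS l hlS) hz0 ?_ ?_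
        · rw [le_div_iff₀ hν, mul_comm, ← hkz]; exact hm2 k hkS
        · rw [le_div_iff₀ hν, mul_comm, ← hlz]; exact hm2 l hlS)
    rw [h1]
    refine h2.trans ?_
    have h3 : 2 * (10 * (T + 375 * T ^ 3 / ν / ‖ψ z‖) / (T / 2)) + 3 = 43 + 15000 * t := by
      rw [ht]; field_simp; ring
    rw [h3]
    calc (43 + 15000 * t) ^ 3 ≤ (21000 * t) ^ 3 := by
          gcongr; linarith
      _ = _ := by rw [ht]; field_simp
  have hν' : S.card * ν ^ 2 ≤ 2 * 21000 ^ 3 * T ^ 6 * ∑ z ∈ Z, (‖ψ z‖ ^ 3)⁻¹ := by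
    have h1 := hS.card_le_image (subset_refl S)
    rw [Finset.card_eq_sum_card_image m (S.image cell)] at h1
    push_cast at h1
    calc S.card * ν ^ 2 ≤ (2 * ν * ∑ z ∈ Z, 21000 ^ 3 * (T ^ 6 / ν ^ 3) * (‖ψ z‖ ^ 3)⁻¹) * ν ^ 2 := by
          gcongr
          refine h1.trans ?_
          gcongr with z hz
          exact hcells z hz
      _ = _ := by rw [← Finset.mul_sum]; field_simp
  have h2 := hsum (125 * K * T ^ 2) Z (by nlinarith [one_le_pow₀ hT1 (n := 2)]) (fun z hz => by
    obtain ⟨k, hk, rfl⟩ := hZmem z hz; exact hm0 k hk) (fun z hz => by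
    obtain ⟨k, hk, rfl⟩ := hZmem z hz
    have := hm1 k hk
    have h5 : 125 * T ^ 2 ≤ 125 * K * T ^ 2 := by nlinarith [sq_nonneg T]
    nlinarith [hψ k hk])
  rw [Real.mul_rpow (by positivity) (by positivity), ← Real.rpow_natCast, ← Real.rpow_mul hT.le,
    show ((2 : ℕ) : ℝ) * (η / 2) = η by push_cast; ring] at h2
  calc _ ≤ 2 * 21000 ^ 3 * T ^ 6 * (C * ((125 * K) ^ (η / 2) * T ^ η)) := hν'.trans (by gcongr)
    _ = _ := by ring

/-- The layer containing a frequency. -/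
def layer (φ : Freq →+ V3) (T ν : ℝ) (v : (Fin 3 → ℤ) → Freq) (k : Freq) : Freq × ℤ :=
  (v (cube φ (T / 2) k),
    ⌊inner ℝ (φ k) (φ (v (cube φ (T / 2) k))) / (ν * ‖φ (v (cube φ (T / 2) k))‖ ^ 2)⌋)

/-- The number of layers in a piece whose cells are contained in lines. -/
lemma exists_card_layer_le (hφ : IsFrame φ ψ K) (hK : 1 ≤ K) {η : ℝ} (hη : 0 < η) :
    ∃ C : ℝ, 0 < C ∧ ∀ S Λ T ν, IsPiece φ S Λ T ν → ∀ v : (Fin 3 → ℤ) → Freq,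
      (∀ k ∈ S, v (cube φ (T / 2) k) ≠ 0) →
      (∀ k ∈ S, ν * ‖φ (v (cube φ (T / 2) k))‖ ≤ 5 * T) →
      (∀ k ∈ S, ν * |inner ℝ (φ k) (φ (v (cube φ (T / 2) k)))| ≤ 15 / 2 * T ^ 2) →
      (S.image (layer φ T ν v)).card * ν ^ 3 ≤ C * T ^ η * T ^ 3 := by
  obtain ⟨C, hC, hsum⟩ := exists_sum_inv_cube_le hK hφ.abs_le hη
  refine ⟨450 * (C * (5 * K) ^ η), by positivity, fun S Λ T ν hS v hv0 hv1 hv2 => ?_⟩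
  have hT1 := hS.one_le
  have hT : 0 < T := by linarith
  have hν1 := hS.one_le'
  have hν : 0 < ν := by linarith
  set cell := cube φ (T / 2) with hcell
  have hV : ∀ k ∈ S, 0 < ‖φ (v (cell k))‖ := fun k hk => hφ.ne_zero (hv0 k hk)
  set Z := S.image fun k => v (cell k) with hZ
  have hlayers : ∀ z ∈ Z, ((((S.image (layer φ T ν v))).filter fun c => c.1 = z).card : ℝ) ≤
      450 * (T ^ 3 / ν ^ 3) * (‖φ z‖ ^ 3)⁻¹ := by
    intro z hz
    obtain ⟨k0, hk0, hk0z⟩ := Finset.mem_image.mp hz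
    have hz0 : 0 < ‖φ z‖ := by rw [← hk0z]; exact hV k0 hk0
    have hzT : ν * ‖φ z‖ ≤ 5 * T := by rw [← hk0z]; exact hv1 k0 hk0
    set t := T ^ 2 / (ν ^ 2 * ‖φ z‖ ^ 2) with ht
    have ht0 : 1 ≤ 25 * t := by
      rw [ht, ← mul_div_assoc, one_le_div (by positivity)]
      calc ν ^ 2 * ‖φ z‖ ^ 2 = (ν * ‖φ z‖) ^ 2 := by ring
        _ ≤ (5 * T) ^ 2 := by gcongr
        _ = _ := by ring
    set n : ℕ := ⌊15 / 2 * t⌋₊ + 1 with hn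
    have hsub : ((S.image (layer φ T ν v)).filter fun c => c.1 = z) ⊆
        (Finset.Icc (-(n : ℤ)) n).image fun h => (z, h) := by
      intro c hc
      obtain ⟨hcS, hcz⟩ := Finset.mem_filter.mp hc
      obtain ⟨k, hk, rfl⟩ := Finset.mem_image.mp hcS
      have hkz : v (cell k) = z := hcz
      rw [Finset.mem_image]
      refine ⟨_, ?_, Prod.ext hcz.symm rfl⟩
      have h1 := hv2 k hk
      rw [hkz] at h1
      have h2 : |inner ℝ (φ k) (φ z) / (ν * ‖φ z‖ ^ 2)| ≤ 15 / 2 * t := by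
        rw [abs_div, abs_of_pos (by positivity : 0 < ν * ‖φ z‖ ^ 2), div_le_iff₀ (by positivity), ht]
        have : 15 / 2 * (T ^ 2 / (ν ^ 2 * ‖φ z‖ ^ 2)) * (ν * ‖φ z‖ ^ 2) = 15 / 2 * T ^ 2 / ν := by
          field_simp
        rw [this, le_div_iff₀ hν]; linarith
      have h3 : 15 / 2 * t < (n : ℝ) := by rw [hn]; push_cast; exact Nat.lt_floor_add_one _
      have h4 : |inner ℝ (φ k) (φ z) / (ν * ‖φ z‖ ^ 2)| ≤ n := h2.trans h3.le
      rw [abs_le] at h4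
      simp only [layer]
      rw [← hcell, hkz, Finset.mem_Icc]
      constructor
      · rw [Int.le_floor]; push_cast; exact h4.1
      · rw [← Int.cast_le (R := ℝ)]; exact (Int.floor_le _).trans (by push_cast; exact h4.2)
    have h1 := (Finset.card_le_card hsub).trans Finset.card_image_le
    rw [Int.card_Icc, show (n : ℤ) + 1 - -n = ((2 * n + 1 : ℕ) : ℤ) by push_cast; ring,
      Int.toNat_natCast] at h1
    have h2 : (n : ℝ) ≤ 15 / 2 * t + 1 := by
      rw [hn]; push_cast; gcongr; exact Nat.floor_le (by positivity)
    calc ((((S.image (layer φ T ν v))).filter fun c => c.1 = z).card : ℝ) ≤ 2 * n + 1 := by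
          exact_mod_cast h1
      _ ≤ 90 * t := by linarith
      _ = 90 * (T ^ 2 / ν ^ 3) * (ν * ‖φ z‖) * (‖φ z‖ ^ 3)⁻¹ := by rw [ht]; field_simp
      _ ≤ 90 * (T ^ 2 / ν ^ 3) * (5 * T) * (‖φ z‖ ^ 3)⁻¹ := by gcongr
      _ = _ := by ring
  have h1 : (S.image (layer φ T ν v)).card * ν ^ 3 ≤ 450 * T ^ 3 * ∑ z ∈ Z, (‖φ z‖ ^ 3)⁻¹ := by
    rw [Finset.card_eq_sum_card_image Prod.fst (S.image (layer φ T ν v)), Finset.image_image]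
    push_cast
    calc _ ≤ (∑ z ∈ Z, 450 * (T ^ 3 / ν ^ 3) * (‖φ z‖ ^ 3)⁻¹) * ν ^ 3 := by
          refine mul_le_mul_of_nonneg_right (Finset.sum_le_sum fun z hz => hlayers z hz) ?_
          positivity
      _ = _ := by rw [← Finset.mul_sum]; field_simp
  have h2 := hsum (5 * K * T) Z (by nlinarith) (fun z hz => by
    obtain ⟨k, hk, rfl⟩ := Finset.mem_image.mp hz; exact hv0 k hk) (fun z hz => by
    obtain ⟨k, hk, rfl⟩ := Finset.mem_image.mp hz
    have := hv1 k hk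
    have h5 : 5 * T ≤ 5 * K * T := by nlinarith
    have := hV k hk
    nlinarith)
  rw [Real.mul_rpow (by positivity) hT.le] at h2
  calc _ ≤ 450 * T ^ 3 * (C * ((5 * K) ^ η * T ^ η)) := h1.trans (by gcongr)
    _ = _ := by ring

end

section

/-- The projection of a lattice along `e`. -/
def projAlong (e : V3) (φ : Freq →+ V3) : Freq →+ V3 where
  toFun k := φ k - inner ℝ (φ k) e • e
  map_zero' := by simp
  map_add' k l := by rw [map_add, inner_add_left, add_smul]; abel

lemma inner_projAlong {e : V3} (he : ‖e‖ = 1) (φ : Freq →+ V3) (k : Freq) :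
    inner ℝ (projAlong e φ k) e = 0 := by
  change inner ℝ (φ k - inner ℝ (φ k) e • e) e = 0
  rw [inner_sub_left, inner_smul_left, real_inner_self_eq_norm_sq, he]
  simp

lemma norm_sq_projAlong {e : V3} (he : ‖e‖ = 1) (φ : Freq →+ V3) (k : Freq) :
    ‖φ k‖ ^ 2 = ‖projAlong e φ k‖ ^ 2 + inner ℝ (φ k) e ^ 2 := by
  change ‖φ k‖ ^ 2 = ‖φ k - inner ℝ (φ k) e • e‖ ^ 2 + inner ℝ (φ k) e ^ 2
  rw [norm_sub_sq_real, inner_smul_right, norm_smul, he, Real.norm_eq_abs, mul_one, sq_abs]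
  ring

variable {φ ψ : Freq →+ V3} {K Λ T ν : ℝ} {S : Finset Freq}

/-- Slices of a piece by slabs project to planar shells. -/
lemma IsPiece.isShell_projAlong (hS : IsPiece φ S Λ T ν) {e : V3} (he : ‖e‖ = 1) {g : Finset Freq}
    (hg : g ⊆ S) {β h : ℝ} (hβ : 0 ≤ β) (hβT : β ≤ 5 * T) (hh : |h| ≤ Λ / 2)
    (h1 : ∀ k ∈ g, |inner ℝ (φ k) e - h| ≤ β) (h2 : ∀ k ∈ g, β * |inner ℝ (φ k) e| ≤ 15 / 2 * T ^ 2) :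
    IsShell (projAlong e φ) g (√(Λ ^ 2 - h ^ 2)) (7 * T) (2 * ν * 55 ^ 3) := by
  have hΛ := hS.pos
  have hT1 := hS.one_le
  have hh2 : h ^ 2 ≤ Λ ^ 2 / 4 := by
    have := pow_le_pow_left₀ (abs_nonneg h) hh 2
    rw [sq_abs] at this; linarith
  have hΛ' : Λ / 2 ≤ √(Λ ^ 2 - h ^ 2) := Real.le_sqrt_of_sq_le (by nlinarith)
  have hle : ∀ k l, ‖projAlong e φ k - projAlong e φ l‖ ≤ ‖φ k - φ l‖ := fun k l => by
    rw [← map_sub, ← map_sub]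
    refine (sq_le_sq₀ (norm_nonneg _) (norm_nonneg _)).mp ?_
    linarith [norm_sq_projAlong he φ (k - l), sq_nonneg (inner ℝ (φ (k - l)) e)]
  refine ⟨by positivity, fun k hk => ?_, fun k hk l hl => ?_, fun U hU hd => ?_⟩
  · rw [Real.sq_sqrt (by nlinarith)]
    have e1 := hS.shell k (hg hk)
    have e2 := norm_sq_projAlong he φ k
    have e3 := h1 k hk
    have e4 := h2 k hk
    have e5 : |inner ℝ (φ k) e ^ 2 - h ^ 2| ≤ 40 * T ^ 2 := by
      calc |inner ℝ (φ k) e ^ 2 - h ^ 2|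
          = |inner ℝ (φ k) e - h| * |2 * inner ℝ (φ k) e - (inner ℝ (φ k) e - h)| := by
            rw [← abs_mul]; congr 1; ring
        _ ≤ β * (2 * |inner ℝ (φ k) e| + β) := by
            gcongr
            refine (abs_sub _ _).trans ?_
            rw [abs_mul, abs_two]; gcongr
        _ ≤ _ := by nlinarith
    rw [abs_le] at e1 e5 ⊢
    constructor <;> nlinarith
  · exact (hle k l).trans ((hS.cap k (hg hk) l (hg hl)).trans (by linarith))
  · have := hS.card_le (hU.trans hg) (R := 13) (by norm_num) fun k hk l hl => ?_
    · norm_num at this ⊢; linarith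
    have e1 := norm_sq_projAlong he φ (k - l)
    have e2 := hd k hk l hl
    have e3 := abs_le.mp (h1 k (hU hk))
    have e4 := abs_le.mp (h1 l (hU hl))
    rw [map_sub, map_sub, inner_sub_left] at e1
    refine abs_le_of_sq_le_sq' ?_ (by positivity) |>.2
    have e5 : (inner ℝ (φ k) e - inner ℝ (φ l) e) ^ 2 ≤ (10 * T) ^ 2 := by
      apply sq_le_sq'  <;> linarith
    have e6 := pow_le_pow_left₀ (norm_nonneg _) e2 2
    rw [e1]
    nlinarith

lemma exists_six_le_slab {η : ℝ} (hη : 0 < η) : ∃ C : ℝ, 0 < C ∧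
    ∀ (φ : Freq →+ V3) S Λ T ν (e : V3) (g : Finset Freq) (β h : ℝ), IsPiece φ S Λ T ν → ‖e‖ = 1 →
      g ⊆ S → 0 ≤ β → β ≤ 5 * T → |h| ≤ Λ / 2 → (∀ k ∈ g, |inner ℝ (φ k) e - h| ≤ β) →
      (∀ k ∈ g, β * |inner ℝ (φ k) e| ≤ 15 / 2 * T ^ 2) →
      ∀ a, avg (fun x => ‖tp a g x‖ ^ 6) ≤ C * ν ^ 2 * Λ ^ η * mass a g ^ 3 := by
  obtain ⟨A, hA, H⟩ := exists_six_le hη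
  refine ⟨A * (2 * 55 ^ 3) ^ 2 * 2 ^ η, by positivity,
    fun φ S Λ T ν e g β h hS he hg hβ hβT hh h1 h2 a => ?_⟩
  have hΛ := hS.pos
  have hT1 := hS.one_le
  have hν1 := hS.one_le'
  have hm := mass_nonneg a g
  have := H (projAlong e φ) g _ _ _
    ⟨e, by rintro rfl; simp at he, fun k => inner_projAlong he φ k⟩
    (hS.isShell_projAlong he hg hβ hβT hh h1 h2) a (14 * Λ) (by linarith [hS.le])
    (fun k hk l hl => by
      have h3 : ∀ k ∈ g, ‖projAlong e φ k‖ ≤ 2 * Λ := fun k hk => by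
        refine le_trans ?_ (hS.norm_le k (hg hk))
        refine abs_le_of_sq_le_sq' ?_ (by positivity) |>.2
        nlinarith [norm_sq_projAlong he φ k, sq_nonneg (inner ℝ (φ k) e)]
      linarith [norm_sub_le (projAlong e φ k) (projAlong e φ l), h3 k hk, h3 l hl])
  refine this.trans ?_
  have h4 : (14 * Λ / (7 * T)) ^ η ≤ 2 ^ η * Λ ^ η := by
    rw [← Real.mul_rpow (by norm_num) hΛ.le]
    refine Real.rpow_le_rpow (by positivity) ?_ hη.le
    rw [div_le_iff₀ (by positivity)]; nlinarith
  calc _ ≤ A * (2 * ν * 55 ^ 3) ^ 2 * (2 ^ η * Λ ^ η) * mass a g ^ 3 := by gcongr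
    _ = _ := by ring

/-- The number of lattice points of a ball in a slab. -/
lemma card_slab_le (hφ : IsFrame φ ψ K) {v : Freq} (hv : v ≠ 0) {E : Finset Freq} {R β h : ℝ}
    (hR : 1 ≤ R) (hβ : 0 ≤ β) (hE : ∀ k ∈ E, ‖φ k‖ ≤ R) (hK : 1 ≤ K)
    (h1 : ∀ k ∈ E, |inner ℝ (φ k) (φ v) - h * ‖φ v‖| ≤ β * ‖φ v‖) :
    (E.card : ℝ) ≤ (3 * K * R) ^ 2 * (6 * K * β + 2) := by
  have hV := hφ.ne_zero hv
  set V := ‖φ v‖ with hVdef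
  set c : Fin 3 → ℝ := fun i => inner ℝ (φ (Pi.single i 1)) (φ v) with hc
  obtain ⟨j, hj⟩ : ∃ j, V ≤ 3 * K * |c j| := by
    by_contra! hcon
    have e1 : v = ∑ i, v i • (Pi.single i 1 : Freq) := by
      ext i; simp [Pi.single_apply]
    have e2 : V ^ 2 = ∑ i, v i * c i := by
      rw [hVdef, ← real_inner_self_eq_norm_sq]
      have e3 : inner ℝ (φ v) (φ v) = ∑ i, inner ℝ (φ (v i • (Pi.single i 1 : Freq))) (φ v) := by
        rw [← sum_inner, ← map_sum, ← e1]
      rw [e3]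
      refine Finset.sum_congr rfl fun i _ => ?_
      rw [map_zsmul, ← Int.cast_smul_eq_zsmul ℝ, real_inner_smul_left]
    have e3 : ∑ i, v i * c i ≤ ∑ i, K * V * |c i| := by
      refine Finset.sum_le_sum fun i _ => (le_abs_self _).trans ?_
      rw [abs_mul]; gcongr; exact hφ.abs_le v i
    rw [← e2, Fin.sum_univ_three] at e3
    nlinarith [hcon 0, hcon 1, hcon 2]
  have hcj : 0 < |c j| := by
    by_contra! hcon
    nlinarith [abs_nonneg (c j)]
  set f : Freq → ℤ × (Fin 2 → ℤ) :=
    fun k => (⌊inner ℝ (φ k) (φ v) / |c j|⌋, fun i => k (j.succAbove i)) with hf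
  have hinj : ∀ k l, f k = f l → k = l := by
    intro k l hkl
    have e1 : ∀ i, (k - l) (j.succAbove i) = 0 := fun i => by
      have := congrFun (congrArg Prod.snd hkl) i
      simp only [hf] at this
      simp [this]
    have e2 : k - l = (k - l) j • (Pi.single j 1 : Freq) := by
      ext i
      rcases Fin.eq_self_or_eq_succAbove j i with rfl | ⟨i', rfl⟩
      · simp
      · rw [e1]; simp [Fin.succAbove_ne]
    have e3 := Int.abs_sub_lt_one_of_floor_eq_floor (congrArg Prod.fst hkl)
    rw [← sub_div, ← inner_sub_left, ← map_sub, e2, map_zsmul, ← Int.cast_smul_eq_zsmul ℝ,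
      real_inner_smul_left, abs_div, abs_mul, abs_abs, mul_div_assoc,
      div_self hcj.ne', mul_one, ← Int.cast_abs] at e3
    have e4 : |(k - l) j| < 1 := by exact_mod_cast e3
    rw [Int.abs_lt_one_iff] at e4
    rw [e4, zero_smul] at e2
    exact sub_eq_zero.mp e2
  set N : ℕ := ⌊K * R⌋₊ with hN
  set b : Fin 2 → ℤ := fun _ => N with hb
  set B := Finset.Icc ⌊(h * V - β * V) / |c j|⌋ ⌊(h * V + β * V) / |c j|⌋ ×ˢ Finset.Icc (-b) b
    with hB
  have hsub : E.image f ⊆ B := by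
    intro y hy
    obtain ⟨k, hk, rfl⟩ := Finset.mem_image.mp hy
    have e1 := abs_le.mp (h1 k hk)
    have e2 : ∀ i, |k i| ≤ (N : ℤ) := fun i => by
      have := (hφ.abs_le k i).trans (mul_le_mul_of_nonneg_left (hE k hk) (by linarith))
      rw [← Int.cast_abs, ← Int.natCast_natAbs, Int.cast_natCast] at this
      rw [← Int.natCast_natAbs]
      exact_mod_cast Nat.le_floor this
    rw [hB, Finset.mem_product, Finset.mem_Icc, Finset.mem_Icc]
    refine ⟨⟨Int.floor_le_floor ?_, Int.floor_le_floor ?_⟩, fun i => ?_, fun i => ?_⟩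
    · gcongr; linarith
    · gcongr; linarith
    · exact (abs_le.mp (e2 _)).1
    · exact (abs_le.mp (e2 _)).2
  have e1 := Finset.card_le_card hsub
  rw [Finset.card_image_of_injective E (fun k l => hinj k l), hB, Finset.card_product, Pi.card_Icc,
    Int.card_Icc] at e1
  have e2 : ∏ i, (Finset.Icc ((-b) i) (b i)).card = (2 * N + 1) ^ 2 := by
    simp only [Int.card_Icc, hb, Pi.neg_apply, Finset.prod_const, Finset.card_univ, Fintype.card_fin]
    congr 1; omega
  rw [e2] at e1
  set x := (h * V - β * V) / |c j| with hx
  set y := (h * V + β * V) / |c j| with hy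
  have hyx : y - x ≤ 6 * K * β := by
    rw [hx, hy, ← sub_div, div_le_iff₀ hcj]
    nlinarith
  have hxy : x ≤ y := by rw [hx, hy]; gcongr; nlinarith
  have e3 : ((⌊y⌋ + 1 - ⌊x⌋).toNat : ℝ) ≤ 6 * K * β + 2 := by
    have e4 : ((⌊y⌋ + 1 - ⌊x⌋).toNat : ℤ) = ⌊y⌋ + 1 - ⌊x⌋ :=
      Int.toNat_of_nonneg (by have := Int.floor_le_floor hxy; omega)
    have e5 : ((⌊y⌋ + 1 - ⌊x⌋).toNat : ℝ) = ((⌊y⌋ + 1 - ⌊x⌋ : ℤ) : ℝ) := by exact_mod_cast e4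
    rw [e5]; push_cast
    linarith [Int.floor_le y, Int.lt_floor_add_one x]
  have hKR : 1 ≤ K * R := by nlinarith
  have e4 : (2 * N + 1 : ℝ) ≤ 3 * K * R := by
    have : (N : ℝ) ≤ K * R := Nat.floor_le (by positivity)
    linarith
  calc (E.card : ℝ) ≤ (⌊y⌋ + 1 - ⌊x⌋).toNat * (2 * N + 1 : ℝ) ^ 2 := by exact_mod_cast e1
    _ ≤ (6 * K * β + 2) * (3 * K * R) ^ 2 := by gcongr
    _ = _ := by ring

lemma one_le_mul_norm (h : ∀ (k : Freq) i, |(k i : ℝ)| ≤ K * ‖φ k‖) {v : Freq} (hv : v ≠ 0) :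
    1 ≤ K * ‖φ v‖ := by
  obtain ⟨i, hi⟩ := Function.ne_iff.mp hv
  have : (1 : ℝ) ≤ |(v i : ℝ)| := by exact_mod_cast Int.one_le_abs hi
  exact this.trans (h v i)

/-- Bounds for a layer of a piece. -/
lemma exists_layer_le (hφ : IsFrame φ ψ K) (hK : 1 ≤ K) {η : ℝ} (hη : 0 < η) :
    ∃ C : ℝ, 0 < C ∧ ∀ S Λ T ν (g : Finset Freq) v (n : ℤ), IsPiece φ S Λ T ν → 20 * T ≤ Λ →
      30 * K * T ^ 2 ≤ ν * Λ → g ⊆ S → v ≠ 0 → ν * ‖φ v‖ ≤ 5 * T →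
      (∀ k ∈ g, ν * |inner ℝ (φ k) (φ v)| ≤ 15 / 2 * T ^ 2) →
      (∀ k ∈ g, ⌊inner ℝ (φ k) (φ v) / (ν * ‖φ v‖ ^ 2)⌋ = n) →
      (∀ a, avg (fun x => ‖tp a g x‖ ^ 6) ≤ C * ν ^ 2 * Λ ^ η * mass a g ^ 3) ∧
      (g.card : ℝ) ^ 3 ≤ C * ν ^ 2 * Λ ^ η * (Λ ^ 2 * T) := by
  obtain ⟨C, hC, H⟩ := exists_six_le_slab hη
  refine ⟨C * ((18 * K) ^ 2 * (92 * K)), by positivity,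
    fun S Λ T ν g v n hS hTΛ hνΛ hg hv hvT h1 h2 => ?_⟩
  have hΛ := hS.pos
  have hT1 := hS.one_le
  have hν1 := hS.one_le'
  have hM : 1 ≤ (18 * K) ^ 2 * (92 * K) := by
    have : 1 ≤ (18 * K) ^ 2 := one_le_pow₀ (by linarith)
    nlinarith
  rcases g.eq_empty_or_nonempty with rfl | ⟨k0, hk0⟩
  · refine ⟨fun a => ?_, ?_⟩
    · simp [tp, mass, avg_const]
    · simp; positivity
  have hV := hφ.ne_zero hv
  have hKV := one_le_mul_norm hφ.abs_le hv
  set V := ‖φ v‖ with hVdef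
  set e : V3 := V⁻¹ • φ v with he
  have he1 : ‖e‖ = 1 := by rw [he, norm_smul, ← hVdef, Real.norm_eq_abs, abs_of_pos (by positivity)]; field_simp
  have hu : ∀ k, inner ℝ (φ k) e = inner ℝ (φ k) (φ v) / V := fun k => by
    rw [he, real_inner_smul_right]; field_simp
  set β := ν * V with hβ
  have hβ0 : 0 < β := by positivity
  have h3 : ∀ k ∈ g, |inner ℝ (φ k) e - β * n| ≤ β := by
    intro k hk
    have e1 := Int.floor_le (inner ℝ (φ k) (φ v) / (ν * V ^ 2))
    have e2 := Int.lt_floor_add_one (inner ℝ (φ k) (φ v) / (ν * V ^ 2))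
    have e3 : inner ℝ (φ k) (φ v) / (ν * V ^ 2) = inner ℝ (φ k) e / β := by
      rw [hu, hβ]; field_simp
    rw [h2 k hk, e3] at e1 e2
    rw [le_div_iff₀ hβ0] at e1
    rw [div_lt_iff₀ hβ0] at e2
    rw [abs_le]; constructor <;> nlinarith
  have h4 : ∀ k ∈ g, β * |inner ℝ (φ k) e| ≤ 15 / 2 * T ^ 2 := by
    intro k hk
    rw [hu, abs_div, abs_of_pos hV, hβ]
    convert h1 k hk using 1
    field_simp
  have h5 : |β * n| ≤ Λ / 2 := by
    have e1 := h3 k0 hk0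
    have e2 := h4 k0 hk0
    have e3 : |inner ℝ (φ k0) e| ≤ Λ / 4 := by
      have : ν * |inner ℝ (φ k0) e| ≤ ν * (Λ / 4) := by
        have e4 : ν * |inner ℝ (φ k0) e| ≤ K * (β * |inner ℝ (φ k0) e|) := by
          rw [hβ]
          have := mul_le_mul_of_nonneg_right hKV
            (mul_nonneg (zero_le_one.trans hν1) (abs_nonneg (inner ℝ (φ k0) e)))
          linarith
        nlinarith
      exact le_of_mul_le_mul_left this (by linarith)
    have e4 := abs_sub_abs_le_abs_sub (β * n) (inner ℝ (φ k0) e)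
    rw [abs_sub_comm] at e4
    linarith
  have h6 := H φ S Λ T ν e g β (β * n) hS he1 hg hβ0.le hvT h5 h3 h4
  refine ⟨fun a => (h6 a).trans ?_, ?_⟩
  · have hm := mass_nonneg a g
    gcongr; nlinarith
  set E := (g ×ˢ g ×ˢ g).image fun p => p.1 + (p.2.1 + p.2.2) with hE
  have h7 := card_pow_six_le g E fun k hk l hl m hm =>
    Finset.mem_image.mpr ⟨(k, l, m), by simp [hk, hl, hm], rfl⟩
  have h8 : (E.card : ℝ) ≤ (3 * K * (6 * Λ)) ^ 2 * (6 * K * (3 * β) + 2) := by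
    refine card_slab_le hφ hv (h := 3 * (β * n)) (by linarith) (by positivity) (fun k hk => ?_) hK
      fun k hk => ?_
    · obtain ⟨⟨k1, k2, k3⟩, hp, rfl⟩ := Finset.mem_image.mp hk
      simp only [Finset.mem_product] at hp
      have e1 := hS.norm_le k1 (hg hp.1)
      have e2 := hS.norm_le k2 (hg hp.2.1)
      have e3 := hS.norm_le k3 (hg hp.2.2)
      simp only [map_add]
      linarith [norm_add_le (φ k1) (φ k2 + φ k3), norm_add_le (φ k2) (φ k3)]
    · obtain ⟨⟨k1, k2, k3⟩, hp, rfl⟩ := Finset.mem_image.mp hk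
      simp only [Finset.mem_product] at hp
      have e1 := h3 k1 hp.1
      have e2 := h3 k2 hp.2.1
      have e3 := h3 k3 hp.2.2
      have e4 : inner ℝ (φ (k1 + (k2 + k3))) (φ v) =
          (inner ℝ (φ k1) e + (inner ℝ (φ k2) e + inner ℝ (φ k3) e)) * V := by
        rw [hu, hu, hu, map_add, map_add, inner_add_left, inner_add_left]; field_simp
      simp only [e4]
      rw [← hVdef, ← sub_mul, abs_mul, abs_of_pos hV]
      gcongr
      rw [abs_le] at e1 e2 e3 ⊢
      constructor <;> linarith
  have h9 : mass (fun _ => 1) g = g.card := by simp [mass]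
  have h10 := h6 fun _ => 1
  rw [h9] at h10
  have hc : (0 : ℝ) < g.card := by exact_mod_cast Finset.card_pos.mpr ⟨k0, hk0⟩
  have h11 : (g.card : ℝ) ^ 3 * g.card ^ 3 ≤
      (C * ((18 * K) ^ 2 * (92 * K)) * ν ^ 2 * Λ ^ η * (Λ ^ 2 * T)) * g.card ^ 3 := by
    have e1 : 6 * K * (3 * β) + 2 ≤ 92 * K * T := by nlinarith
    calc (g.card : ℝ) ^ 3 * g.card ^ 3 = (g.card : ℝ) ^ 6 := by ring
      _ ≤ ((3 * K * (6 * Λ)) ^ 2 * (92 * K * T)) * (C * ν ^ 2 * Λ ^ η * g.card ^ 3) := by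
          refine h7.trans (mul_le_mul (h8.trans ?_) h10 ?_ (by positivity))
          · gcongr
          · exact avg_nonneg fun x => by positivity
      _ = _ := by ring
  exact le_of_mul_le_mul_right h11 (by positivity)

end

section

section Numerics
variable {Λ D ν c s : ℝ}

lemma eq_exp_of_pos {x : ℝ} (hx : 0 < x) : ∃ y, x = Real.exp y := ⟨Real.log x, (Real.exp_log hx).symm⟩

lemma mul_rpow_half_le_of_le (hΛ : 0 < Λ) (hD : 0 < D) (hν : 0 < ν) (hc : ν ≤ c)
    (hs : Λ ^ (s / 2) ≤ D) : ν * (Λ * D) ^ (s / 2) ≤ c * D ^ (1 + s / 2) := by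
  have hc0 : 0 ≤ c := hν.le.trans hc
  rw [Real.mul_rpow hΛ.le hD.le, Real.rpow_add hD, Real.rpow_one]
  gcongr

lemma mul_rpow_half_le_of_mul_le (hΛ : 0 < Λ) (hD : 0 < D) (hν : 0 < ν) (hc : ν * Λ ≤ c * D ^ (2 : ℝ)) :
    ν * (Λ * D) ^ (s / 2) ≤ c * (Λ ^ (s / 2 - 1) * D ^ (2 + s / 2)) := by
  rw [Real.mul_rpow hΛ.le hD.le, Real.rpow_add hD, Real.rpow_sub hΛ, Real.rpow_one]
  calc ν * (Λ ^ (s / 2) * D ^ (s / 2)) = ν * Λ * (Λ ^ (s / 2) / Λ * D ^ (s / 2)) := by field_simp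
    _ ≤ c * D ^ (2 : ℝ) * (Λ ^ (s / 2) / Λ * D ^ (s / 2)) := by gcongr
    _ = _ := by ring

lemma mul_rpow_half_le_of_planar (hD : 0 < D) (hν : 0 < ν) (hc1 : 1 ≤ c) (hc : ν ≤ c * D)
    (hs0 : 0 ≤ s) (hs : s ≤ 1) : ν * (D ^ (3 : ℝ) * ν ^ (-2 : ℝ)) ^ (s / 2) ≤ c * D ^ (1 + s / 2) := by
  obtain ⟨d, rfl⟩ := eq_exp_of_pos hD
  obtain ⟨n, rfl⟩ := eq_exp_of_pos hν
  obtain ⟨c, rfl⟩ := eq_exp_of_pos (zero_lt_one.trans_le hc1)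
  rw [Real.one_le_exp_iff] at hc1
  simp only [← Real.exp_mul, ← Real.exp_add, Real.exp_le_exp] at *
  nlinarith [mul_nonneg (sub_nonneg.mpr hs) (sub_nonneg.mpr hc), mul_nonneg hs0 hc1]

lemma mul_rpow_half_le_of_line (hD : 1 ≤ D) (hν : 0 < ν) (hc1 : 1 ≤ c) (hDν : D ^ (1 / 4 : ℝ) ≤ ν)
    (hc : ν ≤ c * D ^ (1 / 2 : ℝ)) (hs0 : 0 ≤ s) (hs : s ≤ 1) :
    ν * (D ^ (9 / 2 : ℝ) * ν ^ (-8 : ℝ)) ^ (s / 2) ≤ c * D ^ (1 + s / 2) := by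
  obtain ⟨d, rfl⟩ := eq_exp_of_pos (zero_lt_one.trans_le hD)
  obtain ⟨n, rfl⟩ := eq_exp_of_pos hν
  obtain ⟨c, rfl⟩ := eq_exp_of_pos (zero_lt_one.trans_le hc1)
  rw [Real.one_le_exp_iff] at hc1 hD
  simp only [← Real.exp_mul, ← Real.exp_add, Real.exp_le_exp] at *
  rcases le_total s (1 / 4) with h | h
  · nlinarith [mul_nonneg (sub_nonneg.mpr h) (sub_nonneg.mpr hc), mul_nonneg hs0 hc1,
      mul_nonneg hs0 hD]
  · nlinarith [mul_nonneg (sub_nonneg.mpr h) (sub_nonneg.mpr hDν), mul_nonneg (sub_nonneg.mpr hs) hD]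

lemma mul_rpow_half_le_of_line' (hΛ : 0 < Λ) (hD : 1 ≤ D) (hν : 1 ≤ ν) (hDν : ν ≤ D ^ (1 / 4 : ℝ))
    (hΛD : Λ ^ (s / 2) ≤ D) (hs0 : 0 ≤ s) (hs : s ≤ 1) :
    ν * (D ^ (5 / 3 : ℝ) * Λ ^ (2 / 3 : ℝ) * ν ^ (-(7 / 3) : ℝ)) ^ (s / 2) ≤ D ^ (1 + s / 2) := by
  obtain ⟨d, rfl⟩ := eq_exp_of_pos (zero_lt_one.trans_le hD)
  obtain ⟨n, rfl⟩ := eq_exp_of_pos (zero_lt_one.trans_le hν)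
  obtain ⟨L, rfl⟩ := eq_exp_of_pos hΛ
  rw [Real.one_le_exp_iff] at hν hD
  simp only [← Real.exp_mul, ← Real.exp_add, Real.exp_le_exp] at *
  nlinarith [mul_nonneg (sub_nonneg.mpr hs) hD, mul_nonneg hs0 hν]

end Numerics

variable {φ ψ : Freq →+ V3} {K Λ T ν : ℝ} {S : Finset Freq}

/-- The `L⁴` bound for a piece, with the resulting bound for exponents between `4` and `5`. -/
lemma exists_piece_rpow_le {η : ℝ} (hη : 0 < η) : ∃ C : ℝ, 1 ≤ C ∧
    ∀ (φ : Freq →+ V3) S Λ T ν, IsPiece φ S Λ T ν → 1 ≤ Λ → ∀ (a : Freq → ℂ) (s B Y : ℝ), 0 ≤ s →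
      s ≤ 1 → 1 ≤ B → 0 < Y → ((S.card : ℝ) ≤ B * Y ∨
        avg (fun x => ‖tp a S x‖ ^ 6) ≤ B * (ν * Y) * mass a S ^ 3) →
      avg (fun x => ‖tp a S x‖ ^ (4 + s)) ≤
        C * Λ ^ η * B * (ν * Y ^ (s / 2)) * mass a S ^ ((4 + s) / 2) := by
  obtain ⟨A, hA, H⟩ := exists_four_le hη
  refine ⟨A * 686 * 2 ^ η + 1, by linarith [show 0 < A * 686 * 2 ^ η by positivity],
    fun φ S Λ T ν hS hΛ1 a s B Y hs0 hs1 hB hY h => ?_⟩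
  set C := A * 686 * 2 ^ η + 1 with hC
  have hC1 : 1 ≤ C := by linarith [show 0 < A * 686 * 2 ^ η by positivity]
  have hΛ := hS.pos
  have hT1 := hS.one_le
  have hν1 := hS.one_le'
  have hm := mass_nonneg a S
  have hU : 1 ≤ Λ ^ η := Real.one_le_rpow hΛ1 hη.le
  have h4 : avg (fun x => ‖tp a S x‖ ^ 4) ≤ C * Λ ^ η * ν * mass a S ^ 2 := by
    have := H φ S Λ T _ hS.isShell a (2 * Λ) hS.le
      fun k hk l hl => (hS.cap k hk l hl).trans (by linarith)
    have h1 : (2 * Λ / T) ^ η ≤ 2 ^ η * Λ ^ η := by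
      rw [← Real.mul_rpow (by norm_num) hΛ.le]
      refine Real.rpow_le_rpow (by positivity) ?_ hη.le
      exact div_le_self (by positivity) hT1
    calc _ ≤ A * (686 * ν) * (2 ^ η * Λ ^ η) * mass a S ^ 2 := this.trans (by gcongr)
      _ = (A * 686 * 2 ^ η) * Λ ^ η * ν * mass a S ^ 2 := by ring
      _ ≤ _ := by gcongr; linarith
  have h6 : avg (fun x => ‖tp a S x‖ ^ 6) ≤ C * Λ ^ η * ν * (B * Y) * mass a S ^ 3 := by
    rcases h with h | h
    · refine (avg_six_le_card a S h h4).trans (le_of_eq (by ring))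
    · refine h.trans ?_
      have : 1 ≤ C * Λ ^ η := one_le_mul_of_one_le_of_one_le hC1 hU
      calc _ = 1 * (B * (ν * Y) * mass a S ^ 3) := by ring
        _ ≤ C * Λ ^ η * (B * (ν * Y) * mass a S ^ 3) := by gcongr
        _ = _ := by ring
  have h5 := avg_rpow_le_of_four_six a S hs0 (hs1.trans one_le_two) (by positivity)
    (by positivity) h4 h6
  refine h5.trans ?_
  have h7 : (B * Y) ^ (s / 2) ≤ B * Y ^ (s / 2) := by
    rw [Real.mul_rpow (by positivity) hY.le]
    gcongr
    calc B ^ (s / 2) ≤ B ^ (1 : ℝ) := Real.rpow_le_rpow_of_exponent_le hB (by linarith)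
      _ = B := Real.rpow_one B
  calc _ ≤ C * Λ ^ η * ν * (B * Y ^ (s / 2)) * mass a S ^ ((4 + s) / 2) := by gcongr
    _ = _ := by ring

end

section

/-- The frequencies of `S` in the cell of `k`. -/
def cellAt (φ : Freq →+ V3) (S : Finset Freq) (T : ℝ) (k : Freq) : Finset Freq :=
  S.filter fun l => cube φ (T / 2) l = cube φ (T / 2) k

lemma mem_cellAt_self {φ : Freq →+ V3} {S : Finset Freq} {T : ℝ} {k : Freq} (hk : k ∈ S) :
    k ∈ cellAt φ S T k := by simp [cellAt, hk]

/-- The affine span of `F` is three-dimensional. -/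
def Spatial (F : Finset Freq) : Prop :=
  ∃ w ∈ F, ∃ x ∈ F, ∃ y ∈ F, ∃ z ∈ F, idot (x - w) (icross (y - w) (z - w)) ≠ 0

/-- `F` is not contained in a line. -/
def Noncollinear (F : Finset Freq) : Prop := ∃ z ∈ F, ∃ x ∈ F, ∃ y ∈ F, icross (x - z) (y - z) ≠ 0

/-- A piece of the shell of radius `Λ` and width `D / Λ` whose occupied cells all have about `ν`
points. -/
structure IsUniform (φ : Freq →+ V3) (S : Finset Freq) (Λ D ν N : ℝ) : Prop
    extends IsPiece φ S Λ (2 * D ^ (1 / 2 : ℝ)) ν where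
  nonempty : S.Nonempty
  one_le_width : 1 ≤ D
  width_le : D ≤ Λ
  le_card : ∀ k ∈ S, ν ≤ (cellAt φ S (2 * D ^ (1 / 2 : ℝ)) k).card
  card_le_mul : (S.card : ℝ) ≤ N * (Λ * D)

variable {φ ψ : Freq →+ V3} {K Λ T ν D N : ℝ} {S : Finset Freq}

lemma IsPiece.isCell (hS : IsPiece φ S Λ T ν) (k : Freq) : IsCell φ (cellAt φ S T k) Λ T where
  pos := zero_lt_one.trans_le hS.one_le
  pos' := hS.pos
  shell := fun l hl => hS.shell l (Finset.mem_filter.mp hl).1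
  norm_ge := fun l hl => hS.norm_ge l (Finset.mem_filter.mp hl).1
  norm_sub_le := fun l hl m hm => by
    have hT := hS.one_le
    have := norm_sub_le_of_cube_eq (φ := φ) (s := T / 2) (by linarith)
      ((Finset.mem_filter.mp hl).2.trans (Finset.mem_filter.mp hm).2.symm)
    linarith

lemma two_mul_rpow_half_sq (hD : 0 ≤ D) : (2 * D ^ (1 / 2 : ℝ)) ^ 2 = 4 * D := by
  rw [mul_pow, ← Real.sqrt_eq_rpow, Real.sq_sqrt hD]; norm_num

lemma two_mul_rpow_half_rpow_le {η : ℝ} (hη : 0 < η) (hη1 : η ≤ 1) (hD : 1 ≤ D) (hΛ : D ≤ Λ) :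
    (2 * D ^ (1 / 2 : ℝ)) ^ η ≤ 2 * Λ ^ η := by
  rw [Real.mul_rpow (by norm_num) (by positivity)]
  have h1 : (2 : ℝ) ^ η ≤ 2 := by
    calc (2 : ℝ) ^ η ≤ 2 ^ (1 : ℝ) := Real.rpow_le_rpow_of_exponent_le one_le_two hη1
      _ = 2 := Real.rpow_one 2
  have h2 : D ^ (1 / 2 : ℝ) ≤ D := by
    calc D ^ (1 / 2 : ℝ) ≤ D ^ (1 : ℝ) := Real.rpow_le_rpow_of_exponent_le hD (by norm_num)
      _ = D := Real.rpow_one D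
  gcongr
  exact h2.trans hΛ

lemma exists_spatial_le (hφ : IsFrame φ ψ K) (hK : 1 ≤ K) {η : ℝ} (hη : 0 < η) :
    ∃ C : ℝ, 1 ≤ C ∧ ∀ S Λ D ν N, IsUniform φ S Λ D ν N → 1 ≤ N →
      (∃ k ∈ S, Spatial (cellAt φ S (2 * D ^ (1 / 2 : ℝ)) k)) → ∀ (a : Freq → ℂ) (s : ℝ), 0 ≤ s → s ≤ 1 →
      avg (fun x => ‖tp a S x‖ ^ (4 + s)) ≤ C * Λ ^ η * N * (Λ ^ (s / 2 - 1) * D ^ (2 + s / 2)) *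
        mass a S ^ ((4 + s) / 2) := by
  obtain ⟨C, hC, H⟩ := exists_piece_rpow_le hη
  refine ⟨C * (18000 * K), by nlinarith, fun S Λ D ν N hS hN ⟨k, hk, w, hw, x, hx, y, hy, z, hz, h⟩
    a s hs0 hs1 => ?_⟩
  have hΛ := hS.pos
  have hD := hS.one_le_width
  have hm := mass_nonneg a S
  have hν1 := hS.one_le'
  have h1 := H φ S Λ _ ν hS.toIsPiece (hD.trans hS.width_le) a s N (Λ * D) hs0 hs1 hN (by positivity)
    (Or.inl hS.card_le_mul)
  have h2 := (hS.isCell k).card_le_of_idot_ne_zero hφ (by linarith) hw hx hy hz h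
  have h3 : ν * Λ ≤ 18000 * K * D ^ (2 : ℝ) := by
    calc ν * Λ ≤ _ := mul_le_mul_of_nonneg_right (hS.le_card k hk) hΛ.le
      _ ≤ _ := h2
      _ = 1125 * K * ((2 * D ^ (1 / 2 : ℝ)) ^ 2) ^ 2 := by ring
      _ = _ := by rw [two_mul_rpow_half_sq (by linarith), Real.rpow_two]; ring
  have h4 := mul_rpow_half_le_of_mul_le (s := s) hΛ (by linarith) (by linarith) h3
  calc _ ≤ C * Λ ^ η * N * (18000 * K * (Λ ^ (s / 2 - 1) * D ^ (2 + s / 2))) *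
        mass a S ^ ((4 + s) / 2) := h1.trans (by gcongr)
    _ = _ := by ring

lemma exists_planar_le (hφ : IsFrame φ ψ K) (hK : 1 ≤ K) {η : ℝ} (hη : 0 < η) (hη1 : η ≤ 1) :
    ∃ C : ℝ, 1 ≤ C ∧ ∀ S Λ D ν N, IsUniform φ S Λ D ν N →
      (∀ k ∈ S, ¬ Spatial (cellAt φ S (2 * D ^ (1 / 2 : ℝ)) k)) →
      (∀ k ∈ S, Noncollinear (cellAt φ S (2 * D ^ (1 / 2 : ℝ)) k)) → ∀ (a : Freq → ℂ) (s : ℝ), 0 ≤ s → s ≤ 1 →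
      avg (fun x => ‖tp a S x‖ ^ (4 + s)) ≤ C * (Λ ^ η) ^ 2 * D ^ (1 + s / 2) *
        mass a S ^ ((4 + s) / 2) := by
  obtain ⟨C, hC, H⟩ := exists_piece_rpow_le hη
  obtain ⟨C', hC', H'⟩ := exists_card_planar_le hφ hK hη
  refine ⟨C * (128 * C' + 1) * (500 * K), ?_, fun S Λ D ν N hS hsp hnc a s hs0 hs1 => ?_⟩
  · have : 1 ≤ C * (128 * C' + 1) := by nlinarith
    nlinarith
  have hΛ := hS.pos
  have hD := hS.one_le_width
  have hm := mass_nonneg a S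
  have hν1 := hS.one_le'
  have hν : 0 < ν := by linarith
  have hU : 1 ≤ Λ ^ η := Real.one_le_rpow (hD.trans hS.width_le) hη.le
  set T := 2 * D ^ (1 / 2 : ℝ) with hT
  have hT2 : T ^ 2 = 4 * D := two_mul_rpow_half_sq (by linarith)
  have key : ∀ c, ∃ m : Freq, c ∈ S.image (cube φ (T / 2)) → m ≠ 0 ∧ ν * ‖ψ m‖ ≤ 125 * T ^ 2 ∧
      ∀ k ∈ S, cube φ (T / 2) k = c → ν * ‖vcross (ψ m) (φ k)‖ ≤ 375 * T ^ 3 := by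
    intro c
    by_cases hc : c ∈ S.image (cube φ (T / 2))
    · obtain ⟨k, hk, rfl⟩ := Finset.mem_image.mp hc
      obtain ⟨z, hz, x, hx, y, hy, h⟩ := hnc k hk
      have h0 := hsp k hk
      unfold Spatial at h0
      push Not at h0
      obtain ⟨m, hm0, hm1, hm2⟩ := (hS.isCell k).exists_normal hφ hz hx hy h (h0 z hz)
      refine ⟨m, fun _ => ⟨hm0, le_trans ?_ hm1, fun l hl hlk => le_trans ?_ (hm2 l ?_)⟩⟩
      · gcongr; exact hS.le_card k hk
      · gcongr; exact hS.le_card k hk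
      · exact Finset.mem_filter.mpr ⟨hl, hlk⟩
    · exact ⟨0, fun h => absurd h hc⟩
  choose m hm using key
  have hmem : ∀ k ∈ S, cube φ (T / 2) k ∈ S.image (cube φ (T / 2)) := fun k hk =>
    Finset.mem_image_of_mem _ hk
  have h1 := H' S Λ T ν hS.toIsPiece m (fun k hk => (hm _ (hmem k hk)).1)
    (fun k hk => (hm _ (hmem k hk)).2.1) (fun k hk => (hm _ (hmem k hk)).2.2 k hk rfl)
  have h2 : (S.card : ℝ) ≤ ((128 * C' + 1) * Λ ^ η) * (D ^ (3 : ℝ) * ν ^ (-2 : ℝ)) := by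
    have e1 : D ^ (3 : ℝ) = D ^ 3 := by norm_cast
    have e2 : ν ^ (-2 : ℝ) = (ν ^ 2)⁻¹ := by rw [Real.rpow_neg hν.le]; norm_cast
    rw [e1, e2, ← mul_assoc, ← div_eq_mul_inv, le_div_iff₀ (by positivity)]
    have e3 := two_mul_rpow_half_rpow_le hη hη1 hD hS.width_le
    rw [← hT] at e3
    calc S.card * ν ^ 2 ≤ _ := h1
      _ ≤ C' * (2 * Λ ^ η) * (T ^ 2) ^ 3 := by rw [← pow_mul]; gcongr
      _ = (128 * C') * Λ ^ η * D ^ 3 := by rw [hT2]; ring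
      _ ≤ _ := by gcongr; linarith
  have h3 : ν ≤ 500 * K * D := by
    obtain ⟨k, hk⟩ := hS.nonempty
    obtain ⟨e1, e2, -⟩ := hm _ (hmem k hk)
    have e3 := one_le_mul_norm hφ.abs_le' e1
    calc ν ≤ ν * (K * ‖ψ (m (cube φ (T / 2) k))‖) := le_mul_of_one_le_right hν.le e3
      _ = K * (ν * ‖ψ (m (cube φ (T / 2) k))‖) := by ring
      _ ≤ K * (125 * T ^ 2) := by gcongr
      _ = _ := by rw [hT2]; ring
  have h4 := mul_rpow_half_le_of_planar (by linarith) hν (by linarith) h3 hs0 hs1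
  have h5 := H φ S Λ T ν hS.toIsPiece (hD.trans hS.width_le) a s _ _ hs0 hs1
    (one_le_mul_of_one_le_of_one_le (by linarith) hU) (by positivity) (Or.inl h2)
  calc _ ≤ C * Λ ^ η * ((128 * C' + 1) * Λ ^ η) * (500 * K * D ^ (1 + s / 2)) *
        mass a S ^ ((4 + s) / 2) := h5.trans (by gcongr)
    _ = _ := by ring

lemma exists_collinear_le (hφ : IsFrame φ ψ K) (hK : 1 ≤ K) {η : ℝ} (hη : 0 < η) (hη1 : η ≤ 1)
    {C₀ : ℝ} (hC₀ : 1 ≤ C₀) :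
    ∃ C : ℝ, 1 ≤ C ∧ ∀ S Λ D ν, IsUniform φ S Λ D ν (C₀ * Λ ^ η) →
      (∀ k ∈ S, ¬ Noncollinear (cellAt φ S (2 * D ^ (1 / 2 : ℝ)) k)) → ∀ (a : Freq → ℂ) (s : ℝ), 0 ≤ s → s ≤ 1 →
      Λ ^ (s / 2) ≤ D →
      avg (fun x => ‖tp a S x‖ ^ (4 + s)) ≤ C * (Λ ^ η) ^ 6 * D ^ (1 + s / 2) *
        mass a S ^ ((4 + s) / 2) := by
  obtain ⟨C, hC, H⟩ := exists_piece_rpow_le hη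
  obtain ⟨C₁, hC₁, H₁⟩ := exists_card_layer_le hφ hK hη
  obtain ⟨C₂, hC₂, H₂⟩ := exists_layer_le hφ hK hη
  set c := 120 * K + C₀ * 1600 ^ 3 with hc
  have hc1 : 1 ≤ c := by linarith
  set N₁ := 16 * C₁ + 1 with hN₁
  set N₂ := C₂ + 1 with hN₂
  have hN₁' : 1 ≤ N₁ := by linarith
  have hN₂' : 1 ≤ N₂ := by linarith
  set Ctot := C * C₀ * c * N₁ ^ 3 * (2 * N₂) with hCtot
  refine ⟨Ctot, ?_, fun S Λ D ν hS hcol a s hs0 hs1 hsD => ?_⟩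
  · have : 1 ≤ N₁ ^ 3 := one_le_pow₀ hN₁'
    have e1 : 1 ≤ C * C₀ := one_le_mul_of_one_le_of_one_le hC hC₀
    have e2 := one_le_mul_of_one_le_of_one_le e1 hc1
    have e3 := one_le_mul_of_one_le_of_one_le e2 this
    exact one_le_mul_of_one_le_of_one_le e3 (by linarith)
  have hΛ := hS.pos
  have hD := hS.one_le_width
  have hm := mass_nonneg a S
  have hν1 := hS.one_le'
  have hν : 0 < ν := by linarith
  have hΛ1 := hD.trans hS.width_le
  have hU : 1 ≤ Λ ^ η := Real.one_le_rpow hΛ1 hη.le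
  have hCtot1 : ∀ n ≤ 5, ∀ M, M ≤ C₀ * N₁ ^ 3 * (2 * N₂) → ∀ X, 0 ≤ X →
      C * Λ ^ η * (M * (Λ ^ η) ^ n) * (c * X) ≤ Ctot * (Λ ^ η) ^ 6 * X := by
    intro n hn M hM X hX
    calc C * Λ ^ η * (M * (Λ ^ η) ^ n) * (c * X)
        ≤ C * Λ ^ η * ((C₀ * N₁ ^ 3 * (2 * N₂)) * (Λ ^ η) ^ 5) * (c * X) := by gcongr
      _ = _ := by rw [hCtot]; ring
  have hone : ∀ x y z : ℝ, 1 ≤ x → 1 ≤ y → 1 ≤ z → x ≤ x * y * z ∧ y ≤ x * y * z ∧ y * z ≤ x * y * z := by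
    intro x y z hx hy hz
    have e1 := one_le_mul_of_one_le_of_one_le hy hz
    have e2 := one_le_mul_of_one_le_of_one_le hx hz
    refine ⟨?_, ?_, ?_⟩ <;> nlinarith
  obtain ⟨hM1, hM2, hM3⟩ := hone C₀ (N₁ ^ 3) (2 * N₂) hC₀ (one_le_pow₀ hN₁') (by linarith)
  have fin : ∀ n ≤ 5, ∀ M, 1 ≤ M → M ≤ C₀ * N₁ ^ 3 * (2 * N₂) → ∀ Y, 0 < Y →
      ν * Y ^ (s / 2) ≤ c * D ^ (1 + s / 2) → ((S.card : ℝ) ≤ M * (Λ ^ η) ^ n * Y ∨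
        avg (fun x => ‖tp a S x‖ ^ 6) ≤ M * (Λ ^ η) ^ n * (ν * Y) * mass a S ^ 3) →
      avg (fun x => ‖tp a S x‖ ^ (4 + s)) ≤ Ctot * (Λ ^ η) ^ 6 * D ^ (1 + s / 2) *
        mass a S ^ ((4 + s) / 2) := by
    intro n hn M hM1 hM Y hY hνY h
    refine (H φ S Λ _ ν hS.toIsPiece hΛ1 a s _ Y hs0 hs1
      (one_le_mul_of_one_le_of_one_le hM1 (one_le_pow₀ hU)) hY h).trans ?_
    have := hCtot1 n hn M hM (D ^ (1 + s / 2)) (by positivity)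
    refine mul_le_mul_of_nonneg_right (le_trans ?_ this) (by positivity)
    gcongr
  rcases le_or_gt ν c with hνc | hνc
  · refine fin 1 (by norm_num) C₀ hC₀ hM1 (Λ * D) (by positivity) ?_ (Or.inl ?_)
    · exact mul_rpow_half_le_of_le hΛ (by linarith) hν hνc hsD
    · rw [pow_one]; exact hS.card_le_mul
  set T := 2 * D ^ (1 / 2 : ℝ) with hT
  have hT2 : T ^ 2 = 4 * D := two_mul_rpow_half_sq (by linarith)
  have hT0 : 0 < T := by positivity
  have key : ∀ z, ∃ v : Freq, z ∈ S.image (cube φ (T / 2)) → v ≠ 0 ∧ ν * ‖φ v‖ ≤ 5 * T ∧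
      ∀ k ∈ S, cube φ (T / 2) k = z → ν * |inner ℝ (φ k) (φ v)| ≤ 15 / 2 * T ^ 2 := by
    intro z
    by_cases hz : z ∈ S.image (cube φ (T / 2))
    · obtain ⟨k, hk, rfl⟩ := Finset.mem_image.mp hz
      have h0 := hcol k hk
      unfold Noncollinear at h0
      push Not at h0
      have h1 : 1 < (cellAt φ S T k).card := by
        have : (1 : ℝ) < (cellAt φ S T k).card := by
          have := hS.le_card k hk
          linarith
        exact_mod_cast this
      obtain ⟨x, hx, y, hy, hxy⟩ := Finset.one_lt_card.mp h1
      obtain ⟨v, hv0, hv1, hv2⟩ := (hS.isCell k).exists_direction hφ hx hy hxy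
        fun x hx y hy z hz => h0 z hz x hx y hy
      refine ⟨v, fun _ => ⟨hv0, le_trans ?_ hv1, fun l hl hlk => le_trans ?_ (hv2 l ?_)⟩⟩
      · gcongr; exact hS.le_card k hk
      · gcongr; exact hS.le_card k hk
      · exact Finset.mem_filter.mpr ⟨hl, hlk⟩
    · exact ⟨0, fun h => absurd h hz⟩
  choose v hv using key
  have hmem : ∀ k ∈ S, cube φ (T / 2) k ∈ S.image (cube φ (T / 2)) := fun k hk =>
    Finset.mem_image_of_mem _ hk
  have hv0 : ∀ k ∈ S, v (cube φ (T / 2) k) ≠ 0 := fun k hk => (hv _ (hmem k hk)).1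
  have hv1 : ∀ k ∈ S, ν * ‖φ (v (cube φ (T / 2) k))‖ ≤ 5 * T := fun k hk => (hv _ (hmem k hk)).2.1
  have hv2 : ∀ k ∈ S, ν * |inner ℝ (φ k) (φ (v (cube φ (T / 2) k)))| ≤ 15 / 2 * T ^ 2 :=
    fun k hk => (hv _ (hmem k hk)).2.2 k hk rfl
  have h1 := H₁ S Λ T ν hS.toIsPiece v hv0 hv1 hv2
  obtain ⟨k₀, hk₀⟩ := hS.nonempty
  have hνD : ν ≤ c * D ^ (1 / 2 : ℝ) := by
    have e3 := one_le_mul_norm hφ.abs_le (hv0 k₀ hk₀)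
    calc ν ≤ ν * (K * ‖φ (v (cube φ (T / 2) k₀))‖) := le_mul_of_one_le_right hν.le e3
      _ = K * (ν * ‖φ (v (cube φ (T / 2) k₀))‖) := by ring
      _ ≤ K * (5 * T) := mul_le_mul_of_nonneg_left (hv1 k₀ hk₀) (by linarith)
      _ = (10 * K) * D ^ (1 / 2 : ℝ) := by rw [hT]; ring
      _ ≤ _ := by gcongr; linarith
  have hΛ2 : 1600 < Λ := by
    by_contra! hcon
    have e1 : ν ≤ S.card := (hS.le_card k₀ hk₀).trans (by
      exact_mod_cast Finset.card_le_card (Finset.filter_subset _ _))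
    have e2 : Λ ^ η ≤ Λ := by
      calc Λ ^ η ≤ Λ ^ (1 : ℝ) := Real.rpow_le_rpow_of_exponent_le hΛ1 hη1
        _ = Λ := Real.rpow_one Λ
    have e3 : C₀ * Λ ^ η * (Λ * D) ≤ C₀ * 1600 * (1600 * 1600) := by
      gcongr
      · exact e2.trans hcon
      · exact hS.width_le.trans hcon
    linarith [hS.card_le_mul]
  have hTΛ : 20 * T ≤ Λ := by
    refine (sq_le_sq₀ (by positivity) hΛ.le).mp ?_
    rw [mul_pow, hT2]
    nlinarith [hS.width_le]
  have hνΛ : 30 * K * T ^ 2 ≤ ν * Λ := by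
    rw [hT2]
    calc 30 * K * (4 * D) = 120 * K * D := by ring
      _ ≤ ν * Λ := by
        gcongr
        · linarith
        · exact hS.width_le
  have hlay : ∀ i ∈ S.image (layer φ T ν v),
      (∀ a, avg (fun x => ‖tp a (S.filter fun k => layer φ T ν v k = i) x‖ ^ 6) ≤
        C₂ * ν ^ 2 * Λ ^ η * mass a (S.filter fun k => layer φ T ν v k = i) ^ 3) ∧
      ((S.filter fun k => layer φ T ν v k = i).card : ℝ) ^ 3 ≤ C₂ * ν ^ 2 * Λ ^ η * (Λ ^ 2 * T) := by
    intro i hi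
    obtain ⟨k₁, hk₁, rfl⟩ := Finset.mem_image.mp hi
    have e1 : ∀ k, layer φ T ν v k = layer φ T ν v k₁ →
        v (cube φ (T / 2) k) = v (cube φ (T / 2) k₁) := fun k hk => congrArg Prod.fst hk
    refine H₂ S Λ T ν _ (v (cube φ (T / 2) k₁)) (layer φ T ν v k₁).2 hS.toIsPiece hTΛ hνΛ
      (Finset.filter_subset _ _) (hv0 k₁ hk₁) (hv1 k₁ hk₁) (fun k hk => ?_) fun k hk => ?_
    · obtain ⟨hkS, hki⟩ := Finset.mem_filter.mp hk
      rw [← e1 k hki]; exact hv2 k hkS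
    · obtain ⟨hkS, hki⟩ := Finset.mem_filter.mp hk
      rw [← e1 k hki, ← hki]; rfl
  have hN : ((S.image (layer φ T ν v)).card : ℝ) ≤ N₁ * Λ ^ η * (D ^ (3 / 2 : ℝ) * ν ^ (-3 : ℝ)) := by
    have e2 : ν ^ (-3 : ℝ) = (ν ^ 3)⁻¹ := by rw [Real.rpow_neg hν.le]; norm_cast
    have e4 : D ^ (3 / 2 : ℝ) = (D ^ (1 / 2 : ℝ)) ^ 3 := by
      rw [← Real.rpow_natCast, ← Real.rpow_mul (by linarith)]; norm_num
    rw [e2, e4, ← mul_assoc, ← div_eq_mul_inv, le_div_iff₀ (by positivity)]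
    have e3 := two_mul_rpow_half_rpow_le hη hη1 hD hS.width_le
    rw [← hT] at e3
    calc _ ≤ _ := h1
      _ ≤ C₁ * (2 * Λ ^ η) * T ^ 3 := by gcongr
      _ = (16 * C₁) * Λ ^ η * (D ^ (1 / 2 : ℝ)) ^ 3 := by rw [hT]; ring
      _ ≤ _ := by gcongr; linarith
  rcases le_or_gt ν (D ^ (1 / 4 : ℝ)) with hνs | hνs
  · refine fin 2 (by norm_num) (N₁ ^ 3 * (2 * N₂))
      (one_le_mul_of_one_le_of_one_le (one_le_pow₀ hN₁') (by linarith)) hM3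
      (D ^ (5 / 3 : ℝ) * Λ ^ (2 / 3 : ℝ) * ν ^ (-(7 / 3) : ℝ)) (by positivity) ?_ (Or.inl ?_)
    · refine (mul_rpow_half_le_of_line' hΛ hD hν1 hνs hsD hs0 hs1).trans ?_
      exact le_mul_of_one_le_left (by positivity) hc1
    set M := 2 * N₂ * Λ ^ η * (ν ^ (2 / 3 : ℝ) * Λ ^ (2 / 3 : ℝ) * D ^ (1 / 6 : ℝ)) with hM
    have hg : ∀ i ∈ S.image (layer φ T ν v),
        ((S.filter fun k => layer φ T ν v k = i).card : ℝ) ≤ M := by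
      intro i hi
      refine (pow_le_pow_iff_left₀ (by positivity) (by positivity) (three_ne_zero)).mp ?_
      refine (hlay i hi).2.trans ?_
      have e1 : M ^ 3 = 8 * N₂ ^ 3 * (Λ ^ η) ^ 3 * (ν ^ 2 * Λ ^ 2 * D ^ (1 / 2 : ℝ)) := by
        have e2 : ∀ x : ℝ, 0 ≤ x → (x ^ (2 / 3 : ℝ)) ^ 3 = x ^ 2 := fun x hx => by
          rw [← Real.rpow_natCast, ← Real.rpow_mul hx, ← Real.rpow_natCast]; norm_num
        have e3 : (D ^ (1 / 6 : ℝ)) ^ 3 = D ^ (1 / 2 : ℝ) := by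
          rw [← Real.rpow_natCast, ← Real.rpow_mul (by linarith)]; norm_num
        rw [hM, mul_pow, mul_pow, mul_pow, mul_pow, mul_pow, e2 ν hν.le, e2 Λ hΛ.le, e3]; norm_num
      rw [e1]
      calc C₂ * ν ^ 2 * Λ ^ η * (Λ ^ 2 * T) = 2 * C₂ * Λ ^ η * (ν ^ 2 * Λ ^ 2 * D ^ (1 / 2 : ℝ)) := by
            rw [hT]; ring
        _ ≤ _ := by
            gcongr
            · norm_num
            · calc C₂ ≤ N₂ := by linarith
                _ ≤ N₂ ^ 3 := le_self_pow₀ hN₂' three_ne_zero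
            · exact le_self_pow₀ hU three_ne_zero
    rw [Finset.card_eq_sum_card_image (layer φ T ν v) S]
    push_cast
    have hexp : D ^ (5 / 3 : ℝ) * Λ ^ (2 / 3 : ℝ) * ν ^ (-(7 / 3) : ℝ) =
        (D ^ (3 / 2 : ℝ) * ν ^ (-3 : ℝ)) * (ν ^ (2 / 3 : ℝ) * Λ ^ (2 / 3 : ℝ) * D ^ (1 / 6 : ℝ)) := by
      rw [show (5 / 3 : ℝ) = 3 / 2 + 1 / 6 by norm_num, show (-(7 / 3) : ℝ) = -3 + 2 / 3 by norm_num,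
        Real.rpow_add (by linarith), Real.rpow_add hν]
      ring
    calc _ ≤ ∑ _i ∈ S.image (layer φ T ν v), M := Finset.sum_le_sum fun i hi => by exact_mod_cast hg i hi
      _ = (S.image (layer φ T ν v)).card * M := by rw [Finset.sum_const, nsmul_eq_mul]
      _ ≤ (N₁ ^ 3 * Λ ^ η * (D ^ (3 / 2 : ℝ) * ν ^ (-3 : ℝ))) * M := by
          gcongr
          refine hN.trans ?_
          gcongr
          exact le_self_pow₀ hN₁' three_ne_zero
      _ = _ := by rw [hexp, hM]; ring
  · refine fin 4 (by norm_num) (N₁ ^ 3 * (2 * N₂))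
      (one_le_mul_of_one_le_of_one_le (one_le_pow₀ hN₁') (by linarith)) hM3
      (D ^ (9 / 2 : ℝ) * ν ^ (-8 : ℝ)) (by positivity)
      (mul_rpow_half_le_of_line hD hν hc1 hνs.le hνD hs0 hs1) (Or.inr ?_)
    refine (avg_six_le_of_pieces a S (layer φ T ν v) hN (by positivity)
      fun i hi => (hlay i hi).1 a).trans ?_
    have e1 : ν ^ 2 * (D ^ (3 / 2 : ℝ) * ν ^ (-3 : ℝ)) ^ 3 = ν * (D ^ (9 / 2 : ℝ) * ν ^ (-8 : ℝ)) := by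
      have e2 : (D ^ (3 / 2 : ℝ)) ^ 3 = D ^ (9 / 2 : ℝ) := by
        rw [← Real.rpow_natCast, ← Real.rpow_mul (by linarith)]; norm_num
      have e3 : ν ^ 2 * (ν ^ (-3 : ℝ)) ^ 3 = ν * ν ^ (-8 : ℝ) := by
        rw [Real.rpow_neg hν.le, Real.rpow_neg hν.le, show (3 : ℝ) = (3 : ℕ) by norm_num,
          show (8 : ℝ) = (8 : ℕ) by norm_num, Real.rpow_natCast, Real.rpow_natCast]
        field_simp
      rw [mul_pow, e2]
      linear_combination D ^ (9 / 2 : ℝ) * e3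
    calc C₂ * ν ^ 2 * Λ ^ η * (N₁ * Λ ^ η * (D ^ (3 / 2 : ℝ) * ν ^ (-3 : ℝ))) ^ 3 * mass a S ^ 3
        = N₁ ^ 3 * C₂ * (Λ ^ η) ^ 4 * (ν ^ 2 * (D ^ (3 / 2 : ℝ) * ν ^ (-3 : ℝ)) ^ 3) * mass a S ^ 3 := by
          ring
      _ ≤ N₁ ^ 3 * (2 * N₂) * (Λ ^ η) ^ 4 * (ν * (D ^ (9 / 2 : ℝ) * ν ^ (-8 : ℝ))) * mass a S ^ 3 := by
          rw [e1]; gcongr; linarith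

end

section

lemma sum_rpow_le_of_card_le {ι : Type*} (s : Finset ι) {f : ι → ℝ} (hf : ∀ i ∈ s, 0 ≤ f i) {N q : ℝ}
    (hN : (s.card : ℝ) ≤ N) (hq : 0 < q) : (∑ i ∈ s, f i) ^ q ≤ N ^ q * ∑ i ∈ s, f i ^ q := by
  have hN0 : 0 ≤ N := le_trans (by positivity) hN
  rcases s.eq_empty_or_nonempty with rfl | hs
  · simp [Real.zero_rpow hq.ne']
  obtain ⟨i, hi, hmax⟩ := s.exists_max_image f hs
  calc (∑ i ∈ s, f i) ^ q ≤ (N * f i) ^ q := by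
        refine Real.rpow_le_rpow (Finset.sum_nonneg hf) ?_ hq.le
        calc ∑ i ∈ s, f i ≤ ∑ _j ∈ s, f i := Finset.sum_le_sum hmax
          _ = s.card * f i := by rw [Finset.sum_const, nsmul_eq_mul]
          _ ≤ N * f i := mul_le_mul_of_nonneg_right hN (hf i hi)
    _ = N ^ q * f i ^ q := Real.mul_rpow hN0 (hf i hi)
    _ ≤ _ := by
        gcongr
        exact Finset.single_le_sum (f := fun i => f i ^ q)
          (fun j hj => Real.rpow_nonneg (hf j hj) q) hi

/-- Combining bounds for the parts of a partition. -/
lemma avg_rpow_le_of_pieces {ι : Type*} [DecidableEq ι] (a : Freq → ℂ) (S : Finset Freq)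
    (g : Freq → ι) {N X q : ℝ} (hN : ((S.image g).card : ℝ) ≤ N) (hN1 : 1 ≤ N) (hX : 0 ≤ X)
    (hq : 0 < q) (hq5 : q ≤ 5)
    (h : ∀ i ∈ S.image g, avg (fun x => ‖tp a (S.filter fun k => g k = i) x‖ ^ q) ≤
      X * mass a (S.filter fun k => g k = i) ^ (q / 2)) :
    avg (fun x => ‖tp a S x‖ ^ q) ≤ N ^ 6 * X * mass a S ^ (q / 2) := by
  have hc : ∀ I : Finset Freq, Continuous fun x => ‖tp a I x‖ ^ q := fun I =>
    (continuous_tp a I).norm.rpow_const fun _ => Or.inr hq.le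
  have hm := mass_nonneg a S
  calc avg (fun x => ‖tp a S x‖ ^ q)
      ≤ avg (fun x => N ^ q * ∑ i ∈ S.image g, ‖tp a (S.filter fun k => g k = i) x‖ ^ q) := by
        refine avg_mono (hc S) (continuous_const.mul (continuous_finsetSum _ fun i _ => hc _))
          fun x => ?_
        refine le_trans ?_ (sum_rpow_le_of_card_le _ (fun i _ => norm_nonneg _) hN hq)
        refine Real.rpow_le_rpow (norm_nonneg _) ?_ hq.le
        rw [tp_eq_sum_filter a S g x]
        exact norm_sum_le _ _
    _ = N ^ q * ∑ i ∈ S.image g, avg (fun x => ‖tp a (S.filter fun k => g k = i) x‖ ^ q) := by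
        rw [avg_const_mul, avg_sum _ fun i _ => hc _]
    _ ≤ N ^ q * ∑ _i ∈ S.image g, X * mass a S ^ (q / 2) := by
        gcongr with i hi
        refine (h i hi).trans ?_
        have := mass_nonneg a (S.filter fun k => g k = i)
        gcongr
        exact mass_mono a (Finset.filter_subset _ _)
    _ = (N ^ q * (S.image g).card) * X * mass a S ^ (q / 2) := by
        rw [Finset.sum_const, nsmul_eq_mul]; ring
    _ ≤ N ^ 6 * X * mass a S ^ (q / 2) := by
        gcongr
        calc N ^ q * (S.image g).card ≤ N ^ (5 : ℝ) * N := by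
              gcongr
          _ = N ^ 6 := by norm_cast

variable {φ ψ : Freq →+ V3} {K Λ T ν D N : ℝ} {S : Finset Freq}

lemma cellAt_congr {k l : Freq} (h : cube φ (T / 2) l = cube φ (T / 2) k) :
    cellAt φ S T l = cellAt φ S T k := by unfold cellAt; rw [h]

open Classical in
/-- The dyadic size and the type of the cell of `k`. -/
def cellLabel (φ : Freq →+ V3) (S : Finset Freq) (T : ℝ) (k : Freq) : ℕ × Fin 3 :=
  (Nat.log 2 (cellAt φ S T k).card,
    if Spatial (cellAt φ S T k) then 0 else if Noncollinear (cellAt φ S T k) then 1 else 2)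

lemma cellAt_filter_cellLabel {i : ℕ × Fin 3} {k : Freq} (hk : cellLabel φ S T k = i) :
    cellAt φ (S.filter fun l => cellLabel φ S T l = i) T k = cellAt φ S T k := by
  ext l
  simp only [cellAt, Finset.mem_filter]
  refine ⟨fun h => ⟨h.1.1, h.2⟩, fun h => ⟨⟨h.1, ?_⟩, h.2⟩⟩
  rw [← hk, cellLabel, cellLabel, cellAt_congr h.2]

/-- A part of a shell contained in a cap. -/
structure IsCap (φ : Freq →+ V3) (S : Finset Freq) (Λ D N : ℝ) : Prop where
  one_le_width : 1 ≤ D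
  width_le : D ≤ Λ
  shell : ∀ k ∈ S, |‖φ k‖ ^ 2 - Λ ^ 2| ≤ 4 * D
  norm_ge : ∀ k ∈ S, Λ / 2 ≤ ‖φ k‖
  norm_le : ∀ k ∈ S, ‖φ k‖ ≤ 2 * Λ
  cap : ∀ k ∈ S, ∀ l ∈ S, ‖φ k - φ l‖ ≤ Λ / 20
  card_le_mul : (S.card : ℝ) ≤ N * (Λ * D)

lemma IsCap.isUniform (hS : IsCap φ S Λ D N) {i : ℕ × Fin 3}
    (hi : i ∈ S.image (cellLabel φ S (2 * D ^ (1 / 2 : ℝ)))) :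
    IsUniform φ (S.filter fun l => cellLabel φ S (2 * D ^ (1 / 2 : ℝ)) l = i) Λ D (2 ^ i.1) N where
  one_le := by
    have : 1 ≤ D ^ (1 / 2 : ℝ) := Real.one_le_rpow hS.one_le_width (by norm_num)
    linarith
  le := by
    have : D ^ (1 / 2 : ℝ) ≤ D := by
      calc D ^ (1 / 2 : ℝ) ≤ D ^ (1 : ℝ) :=
            Real.rpow_le_rpow_of_exponent_le hS.one_le_width (by norm_num)
        _ = D := Real.rpow_one D
    linarith [hS.width_le]
  one_le' := one_le_pow₀ one_le_two
  shell := fun k hk => by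
    rw [two_mul_rpow_half_sq (by linarith [hS.one_le_width])]
    exact hS.shell k (Finset.mem_filter.mp hk).1
  norm_ge := fun k hk => hS.norm_ge k (Finset.mem_filter.mp hk).1
  norm_le := fun k hk => hS.norm_le k (Finset.mem_filter.mp hk).1
  cap := fun k hk l hl => hS.cap k (Finset.mem_filter.mp hk).1 l (Finset.mem_filter.mp hl).1
  card_cell := fun c => by
    set T := 2 * D ^ (1 / 2 : ℝ) with hT
    set S' := S.filter fun l => cellLabel φ S T l = i with hS'
    rcases (S'.filter fun l => cube φ (T / 2) l = c).eq_empty_or_nonempty with h | ⟨k, hk⟩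
    · rw [h]; simp
    obtain ⟨hkS, rfl⟩ := Finset.mem_filter.mp hk
    have hki := (Finset.mem_filter.mp hkS).2
    have h1 : (S'.filter fun l => cube φ (T / 2) l = cube φ (T / 2) k) = cellAt φ S T k :=
      cellAt_filter_cellLabel hki
    rw [h1, ← hki]
    have h2 := (Nat.lt_pow_succ_log_self one_lt_two (cellAt φ S T k).card).le
    rw [pow_succ] at h2
    rw [mul_comm]
    exact_mod_cast h2
  nonempty := by
    obtain ⟨k, hk, rfl⟩ := Finset.mem_image.mp hi
    exact ⟨k, by simp [hk]⟩
  one_le_width := hS.one_le_width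
  width_le := hS.width_le
  le_card := fun k hk => by
    obtain ⟨hkS, hki⟩ := Finset.mem_filter.mp hk
    rw [cellAt_filter_cellLabel hki, ← hki]
    have := Nat.pow_log_le_self 2 (Finset.card_pos.mpr ⟨k, mem_cellAt_self (φ := φ)
      (T := 2 * D ^ (1 / 2 : ℝ)) hkS⟩).ne'
    exact_mod_cast this
  card_le_mul := by
    refine le_trans ?_ hS.card_le_mul
    exact_mod_cast Finset.card_le_card (Finset.filter_subset _ _)

lemma exists_uniform_le (hφ : IsFrame φ ψ K) (hK : 1 ≤ K) {η : ℝ} (hη : 0 < η) (hη1 : η ≤ 1)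
    {C₀ : ℝ} (hC₀ : 1 ≤ C₀) :
    ∃ C : ℝ, 1 ≤ C ∧ ∀ S Λ D, IsCap φ S Λ D (C₀ * Λ ^ η) →
      ∀ i ∈ S.image (cellLabel φ S (2 * D ^ (1 / 2 : ℝ))), ∀ (a : Freq → ℂ) (s : ℝ), 0 ≤ s → s ≤ 1 →
      Λ ^ (s / 2) ≤ D →
      avg (fun x => ‖tp a (S.filter fun l => cellLabel φ S (2 * D ^ (1 / 2 : ℝ)) l = i) x‖ ^ (4 + s)) ≤
        C * (Λ ^ η) ^ 6 * (D ^ (1 + s / 2) + Λ ^ (s / 2 - 1) * D ^ (2 + s / 2)) *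
        mass a (S.filter fun l => cellLabel φ S (2 * D ^ (1 / 2 : ℝ)) l = i) ^ ((4 + s) / 2) := by
  obtain ⟨C₁, hC₁, H₁⟩ := exists_spatial_le hφ hK hη
  obtain ⟨C₂, hC₂, H₂⟩ := exists_planar_le hφ hK hη hη1
  obtain ⟨C₃, hC₃, H₃⟩ := exists_collinear_le hφ hK hη hη1 hC₀
  refine ⟨C₁ * C₀ + C₂ + C₃, by nlinarith, fun S Λ D hS i hi a s hs0 hs1 hsD => ?_⟩
  have hU := hS.isUniform hi
  set T := 2 * D ^ (1 / 2 : ℝ) with hT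
  set S' := S.filter fun l => cellLabel φ S T l = i with hS'
  have hD := hU.one_le_width
  have hΛ := hU.pos
  have hm := mass_nonneg a S'
  have hη' : 1 ≤ Λ ^ η := Real.one_le_rpow (hD.trans hU.width_le) hη.le
  have hCC : 0 < C₁ * C₀ := by positivity
  have hX : 0 ≤ D ^ (1 + s / 2) := by positivity
  have hY : 0 ≤ Λ ^ (s / 2 - 1) * D ^ (2 + s / 2) := by positivity
  have hcell : ∀ k ∈ S', cellAt φ S' T k = cellAt φ S T k := fun k hk =>
    cellAt_filter_cellLabel (Finset.mem_filter.mp hk).2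
  have hlab : ∀ k ∈ S', (cellLabel φ S T k).2 = i.2 := fun k hk => by
    rw [(Finset.mem_filter.mp hk).2]
  by_cases h1 : ∃ k ∈ S', Spatial (cellAt φ S' T k)
  · refine (H₁ S' Λ D _ _ hU (one_le_mul_of_one_le_of_one_le hC₀ hη') h1 a s hs0 hs1).trans ?_
    refine mul_le_mul_of_nonneg_right ?_ (by positivity)
    calc C₁ * Λ ^ η * (C₀ * Λ ^ η) * (Λ ^ (s / 2 - 1) * D ^ (2 + s / 2))
        = C₁ * C₀ * (Λ ^ η) ^ 2 * (0 + Λ ^ (s / 2 - 1) * D ^ (2 + s / 2)) := by ring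
      _ ≤ _ := by gcongr <;> linarith
  push Not at h1
  have hns : ∀ k ∈ S', ¬ Spatial (cellAt φ S T k) := fun k hk => hcell k hk ▸ h1 k hk
  by_cases h2 : ∀ k ∈ S', Noncollinear (cellAt φ S' T k)
  · refine (H₂ S' Λ D _ _ hU h1 h2 a s hs0 hs1).trans ?_
    refine mul_le_mul_of_nonneg_right ?_ (by positivity)
    calc C₂ * (Λ ^ η) ^ 2 * D ^ (1 + s / 2) = C₂ * (Λ ^ η) ^ 2 * (D ^ (1 + s / 2) + 0) := by ring
      _ ≤ _ := by gcongr <;> linarith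
  push Not at h2
  obtain ⟨k, hk, hkc⟩ := h2
  have h3 : ∀ l ∈ S', ¬ Noncollinear (cellAt φ S' T l) := by
    intro l hl hlc
    have e1 := (hlab l hl).trans (hlab k hk).symm
    rw [hcell l hl] at hlc
    rw [hcell k hk] at hkc
    simp [cellLabel, hns l hl, hns k hk, hlc, hkc] at e1
  refine (H₃ S' Λ D _ hU h3 a s hs0 hs1 hsD).trans ?_
  refine mul_le_mul_of_nonneg_right ?_ (by positivity)
  calc C₃ * (Λ ^ η) ^ 6 * D ^ (1 + s / 2) = C₃ * (Λ ^ η) ^ 6 * (D ^ (1 + s / 2) + 0) := by ring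
    _ ≤ _ := by gcongr; linarith

/-- The number of labels of the cells of a cap. -/
lemma exists_card_cellLabel_le {η : ℝ} (hη : 0 < η) (hη1 : η ≤ 1) {C₀ : ℝ} (hC₀ : 1 ≤ C₀) :
    ∃ C : ℝ, 1 ≤ C ∧ ∀ (φ : Freq →+ V3) S Λ D T, IsCap φ S Λ D (C₀ * Λ ^ η) →
      ((S.image (cellLabel φ S T)).card : ℝ) ≤ C * (Λ ^ η) ^ 3 := by
  refine ⟨3 * (C₀ / (η * Real.log 2) + 1), ?_, fun φ S Λ D T hS => ?_⟩
  · have : 0 ≤ C₀ / (η * Real.log 2) := by positivity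
    linarith
  have hD := hS.one_le_width
  have hΛ1 : 1 ≤ Λ := hD.trans hS.width_le
  have hΛ : 0 < Λ := by linarith
  have hU : 1 ≤ Λ ^ η := Real.one_le_rpow hΛ1 hη.le
  set n := Nat.log 2 S.card with hn
  have hsub : S.image (cellLabel φ S T) ⊆ Finset.range (n + 1) ×ˢ Finset.univ := by
    intro y hy
    obtain ⟨k, hk, rfl⟩ := Finset.mem_image.mp hy
    have : Nat.log 2 (cellAt φ S T k).card ≤ n :=
      Nat.log_mono_right (Finset.card_le_card (Finset.filter_subset _ _))
    simp only [Finset.mem_product, Finset.mem_range, Finset.mem_univ, and_true]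
    exact Nat.lt_succ_of_le this
  have h1 : ((S.image (cellLabel φ S T)).card : ℝ) ≤ (n + 1) * 3 := by
    have := Finset.card_le_card hsub
    rw [Finset.card_product, Finset.card_range, Finset.card_univ, Fintype.card_fin] at this
    exact_mod_cast this
  rcases S.eq_empty_or_nonempty with rfl | hne
  · simp; positivity
  have h2 : (n : ℝ) * Real.log 2 ≤ C₀ * (Λ ^ η) ^ 3 / η := by
    have e1 : (2 : ℝ) ^ n ≤ S.card := by
      exact_mod_cast Nat.pow_log_le_self 2 (Finset.card_pos.mpr hne).ne'
    have e2 : Λ ^ η ≤ Λ := by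
      calc Λ ^ η ≤ Λ ^ (1 : ℝ) := Real.rpow_le_rpow_of_exponent_le hΛ1 hη1
        _ = Λ := Real.rpow_one Λ
    have e3 : (2 : ℝ) ^ n ≤ C₀ * Λ ^ 3 := by
      calc (2 : ℝ) ^ n ≤ C₀ * Λ ^ η * (Λ * D) := e1.trans hS.card_le_mul
        _ ≤ C₀ * Λ * (Λ * Λ) := by gcongr; exact hS.width_le
        _ = _ := by ring
    calc (n : ℝ) * Real.log 2 = Real.log (2 ^ n) := by rw [Real.log_pow]
      _ ≤ Real.log (C₀ * Λ ^ 3) := Real.log_le_log (by positivity) e3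
      _ ≤ (C₀ * Λ ^ 3) ^ η / η := Real.log_le_rpow_div (by positivity) hη
      _ ≤ _ := by
        gcongr
        rw [Real.mul_rpow (by positivity) (by positivity), ← Real.rpow_natCast, ← Real.rpow_natCast,
          ← Real.rpow_mul hΛ.le, ← Real.rpow_mul hΛ.le, mul_comm η]
        gcongr
        calc C₀ ^ η ≤ C₀ ^ (1 : ℝ) := Real.rpow_le_rpow_of_exponent_le hC₀ hη1
          _ = C₀ := Real.rpow_one C₀
  have h3 : (n : ℝ) ≤ C₀ / (η * Real.log 2) * (Λ ^ η) ^ 3 := by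
    rw [div_mul_eq_mul_div, le_div_iff₀ (by positivity)]
    rw [le_div_iff₀ hη] at h2
    linarith
  have h4 : 1 ≤ (Λ ^ η) ^ 3 := one_le_pow₀ hU
  linarith

lemma exists_cap_le (hφ : IsFrame φ ψ K) (hK : 1 ≤ K) {η : ℝ} (hη : 0 < η) (hη1 : η ≤ 1)
    {C₀ : ℝ} (hC₀ : 1 ≤ C₀) :
    ∃ C : ℝ, 1 ≤ C ∧ ∀ S Λ D, IsCap φ S Λ D (C₀ * Λ ^ η) →
      ∀ (a : Freq → ℂ) (s : ℝ), 0 ≤ s → s ≤ 1 → Λ ^ (s / 2) ≤ D →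
      avg (fun x => ‖tp a S x‖ ^ (4 + s)) ≤
        C * (Λ ^ η) ^ 24 * (D ^ (1 + s / 2) + Λ ^ (s / 2 - 1) * D ^ (2 + s / 2)) *
        mass a S ^ ((4 + s) / 2) := by
  obtain ⟨C₁, hC₁, H₁⟩ := exists_uniform_le hφ hK hη hη1 hC₀
  obtain ⟨C₂, hC₂, H₂⟩ := exists_card_cellLabel_le hη hη1 hC₀
  refine ⟨C₂ ^ 6 * C₁, one_le_mul_of_one_le_of_one_le (one_le_pow₀ hC₂) hC₁,
    fun S Λ D hS a s hs0 hs1 hsD => ?_⟩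
  have hD := hS.one_le_width
  have hΛ1 : 1 ≤ Λ := hD.trans hS.width_le
  have hU : 1 ≤ Λ ^ η := Real.one_le_rpow hΛ1 hη.le
  have := avg_rpow_le_of_pieces a S (cellLabel φ S (2 * D ^ (1 / 2 : ℝ))) (q := 4 + s)
    (H₂ φ S Λ D _ hS) (one_le_mul_of_one_le_of_one_le hC₂ (one_le_pow₀ hU)) (by positivity)
    (by linarith) (by linarith) fun i hi => H₁ S Λ D hS i hi a s hs0 hs1 hsD
  refine this.trans (le_of_eq ?_)
  ring

/-- The bound for exponents between `4` and `5`. -/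
lemma exists_shell_le (hφ : IsFrame φ ψ K) (hK : 1 ≤ K) {η : ℝ} (hη : 0 < η) (hη1 : η ≤ 1)
    {C₀ : ℝ} (hC₀ : 1 ≤ C₀) :
    ∃ C : ℝ, 1 ≤ C ∧ ∀ (S : Finset Freq) Λ δ, 1 < Λ → 0 < δ → δ < 1 → 1 ≤ Λ * δ →
      (∀ k ∈ S, |‖φ k‖ - Λ| < δ) → (S.card : ℝ) ≤ C₀ * Λ ^ η * (Λ * (Λ * δ)) →
      ∀ (a : Freq → ℂ) (s : ℝ), 0 ≤ s → s ≤ 1 → Λ ^ (s / 2) ≤ Λ * δ →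
      avg (fun x => ‖tp a S x‖ ^ (4 + s)) ≤
        C * (Λ ^ η) ^ 24 * ((Λ * δ) ^ (1 + s / 2) + Λ ^ (s / 2 - 1) * (Λ * δ) ^ (2 + s / 2)) *
        mass a S ^ ((4 + s) / 2) := by
  obtain ⟨C, hC, H⟩ := exists_cap_le hφ hK hη hη1 hC₀
  refine ⟨(323 ^ 3) ^ 6 * C + (C₀ * 16) ^ 3, ?_,
    fun S Λ δ hΛ1 hδ0 hδ1 hD hS hcard a s hs0 hs1 hsD => ?_⟩
  · have : 0 < C₀ * 16 := by positivity
    have : 0 < (C₀ * 16) ^ 3 := by positivity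
    nlinarith
  have hΛ : 0 < Λ := by linarith
  have hm := mass_nonneg a S
  have hU : 1 ≤ Λ ^ η := Real.one_le_rpow hΛ1.le hη.le
  set D := Λ * δ with hDdef
  have hDΛ : D ≤ Λ := by nlinarith
  set X := D ^ (1 + s / 2) + Λ ^ (s / 2 - 1) * D ^ (2 + s / 2) with hX
  have hX1 : 1 ≤ X := by
    have e1 : 1 ≤ D ^ (1 + s / 2) := Real.one_le_rpow hD (by linarith)
    have e2 : 0 ≤ Λ ^ (s / 2 - 1) * D ^ (2 + s / 2) := by positivity
    linarith
  have hpos : 0 < (C₀ * 16) ^ 3 := by positivity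
  rcases lt_or_ge Λ 2 with h2 | h2
  · have e1 : (S.card : ℝ) ≤ C₀ * 16 := by
      refine hcard.trans ?_
      have e2 : Λ ^ η ≤ Λ := by
        calc Λ ^ η ≤ Λ ^ (1 : ℝ) := Real.rpow_le_rpow_of_exponent_le hΛ1.le hη1
          _ = Λ := Real.rpow_one Λ
      calc C₀ * Λ ^ η * (Λ * D) ≤ C₀ * 2 * (2 * 2) := by
            gcongr <;> linarith
        _ ≤ _ := by linarith
    have e2 : ∀ x, ‖tp a S x‖ ^ (4 + s) ≤ (C₀ * 16) ^ 3 * mass a S ^ ((4 + s) / 2) := by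
      intro x
      have e3 := norm_tp_sq_le a S x
      calc ‖tp a S x‖ ^ (4 + s) = (‖tp a S x‖ ^ 2) ^ ((4 + s) / 2) := by
            rw [← Real.rpow_natCast, ← Real.rpow_mul (norm_nonneg _)]; congr 1; push_cast; ring
        _ ≤ ((C₀ * 16) * mass a S) ^ ((4 + s) / 2) := by
            gcongr
            exact e3.trans (by gcongr)
        _ = (C₀ * 16) ^ ((4 + s) / 2) * mass a S ^ ((4 + s) / 2) :=
            Real.mul_rpow (by positivity) hm
        _ ≤ _ := by
            gcongr
            calc (C₀ * 16) ^ ((4 + s) / 2) ≤ (C₀ * 16) ^ (3 : ℝ) :=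
                  Real.rpow_le_rpow_of_exponent_le (by linarith) (by linarith)
              _ = _ := by norm_cast
    calc _ ≤ avg (fun _ => (C₀ * 16) ^ 3 * mass a S ^ ((4 + s) / 2)) :=
          avg_mono ((continuous_tp a S).norm.rpow_const fun _ => Or.inr (by linarith))
            continuous_const e2
      _ = (C₀ * 16) ^ 3 * 1 ^ 24 * 1 * mass a S ^ ((4 + s) / 2) := by rw [avg_const]; ring
      _ ≤ _ := by
          gcongr
          have : 0 ≤ ((323 : ℝ) ^ 3) ^ 6 * C := by positivity
          linarith
  have hnorm : ∀ k ∈ S, Λ - 1 ≤ ‖φ k‖ ∧ ‖φ k‖ ≤ Λ + 1 := fun k hk => by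
    have := abs_lt.mp (hS k hk)
    constructor <;> linarith
  have hcaps : ((S.image (cube φ (Λ / 40))).card : ℝ) ≤ 323 ^ 3 := by
    refine (card_image_cube_le (φ := φ) (s := Λ / 40) (R := 4 * Λ) (by positivity) (by positivity)
      fun k hk l hl => ?_).trans (le_of_eq ?_)
    · linarith [norm_sub_le (φ k) (φ l), (hnorm k hk).2, (hnorm l hl).2]
    · congr 1; field_simp; norm_num
  have hpiece : ∀ i ∈ S.image (cube φ (Λ / 40)),
      IsCap φ (S.filter fun k => cube φ (Λ / 40) k = i) Λ D (C₀ * Λ ^ η) := by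
    intro i _
    have hmem : ∀ k ∈ S.filter fun k => cube φ (Λ / 40) k = i, k ∈ S := fun k hk =>
      (Finset.mem_filter.mp hk).1
    refine ⟨hD, hDΛ, fun k hk => ?_, fun k hk => ?_, fun k hk => ?_, fun k hk l hl => ?_, ?_⟩
    · have e1 := hS k (hmem k hk)
      have e2 := hnorm k (hmem k hk)
      have e3 : ‖φ k‖ ^ 2 - Λ ^ 2 = (‖φ k‖ - Λ) * (‖φ k‖ + Λ) := by ring
      rw [e3, abs_mul, abs_of_nonneg (by positivity : 0 ≤ ‖φ k‖ + Λ)]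
      calc |‖φ k‖ - Λ| * (‖φ k‖ + Λ) ≤ δ * (4 * Λ) := by
            gcongr; linarith
        _ = _ := by rw [hDdef]; ring
    · linarith [(hnorm k (hmem k hk)).1]
    · linarith [(hnorm k (hmem k hk)).2]
    · have := norm_sub_le_of_cube_eq (φ := φ) (s := Λ / 40) (by positivity)
        ((Finset.mem_filter.mp hk).2.trans (Finset.mem_filter.mp hl).2.symm)
      linarith
    · refine le_trans ?_ hcard
      exact_mod_cast Finset.card_le_card (Finset.filter_subset _ _)
  have := avg_rpow_le_of_pieces a S (cube φ (Λ / 40)) (q := 4 + s) hcaps (by norm_num)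
    (by positivity) (by linarith) (by linarith) fun i hi => H _ Λ D (hpiece i hi) a s hs0 hs1 hsD
  calc _ ≤ _ := this
    _ = ((323 ^ 3) ^ 6 * C) * (Λ ^ η) ^ 24 * X * mass a S ^ ((4 + s) / 2) := by ring
    _ ≤ _ := by gcongr; linarith

end

/-- Moments between the second and the fourth. -/
lemma avg_rpow_le_of_four (a : Freq → ℂ) (S : Finset Freq) {p B : ℝ} (hp : 2 ≤ p) (hp4 : p ≤ 4)
    (hB : 1 ≤ B) (h : avg (fun x => ‖tp a S x‖ ^ (4 : ℝ)) ≤ B * mass a S ^ 2) :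
    avg (fun x => ‖tp a S x‖ ^ p) ≤ B ^ (p / 2 - 1) * mass a S ^ (p / 2) := by
  rcases (mass_nonneg a S).eq_or_lt with h0 | hm
  · simp [tp_eq_zero_of_mass h0.symm, ← h0, avg_const,
      Real.zero_rpow (show p ≠ 0 by linarith), Real.zero_rpow (show p / 2 ≠ 0 by linarith)]
  have key := avg_rpow_interp (f := fun x => ‖tp a S x‖) (by fun_prop) (fun x => norm_nonneg _)
    (p := 2) (q := 4) (θ := p / 2 - 1) (P := mass a S) (Q := B * mass a S ^ 2)
    (by norm_num) (by norm_num) (by linarith) (by linarith) hm (by positivity)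
    (by simpa using (avg_norm_tp_sq a S).le) h
  rw [show (1 - (p / 2 - 1)) * 2 + (p / 2 - 1) * 4 = p by ring] at key
  refine key.trans (le_of_eq ?_)
  rw [Real.mul_rpow (by positivity) (by positivity), ← Real.rpow_natCast, ← Real.rpow_mul hm.le,
    mul_left_comm, ← Real.rpow_add hm]
  congr 2
  push_cast; ring

/-- Moments above the fifth. -/
lemma avg_rpow_le_of_five (a : Freq → ℂ) (S : Finset Freq) {p B N : ℝ} (hp : 5 ≤ p)
    (hN : (S.card : ℝ) ≤ N) (h : avg (fun x => ‖tp a S x‖ ^ (5 : ℝ)) ≤ B * mass a S ^ (5 / 2 : ℝ)) :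
    avg (fun x => ‖tp a S x‖ ^ p) ≤ N ^ ((p - 5) / 2) * B * mass a S ^ (p / 2) := by
  have hN0 : 0 ≤ N := le_trans (by positivity) hN
  have hm := mass_nonneg a S
  have hc : ∀ e : ℝ, 0 ≤ e → Continuous fun x => ‖tp a S x‖ ^ e := fun e he =>
    (continuous_tp a S).norm.rpow_const fun _ => Or.inr he
  calc avg (fun x => ‖tp a S x‖ ^ p)
      ≤ avg (fun x => (N * mass a S) ^ ((p - 5) / 2) * ‖tp a S x‖ ^ (5 : ℝ)) := by
        refine avg_mono (hc p (by linarith)) (continuous_const.mul (hc 5 (by norm_num)))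
          fun x => ?_
        calc ‖tp a S x‖ ^ p = (‖tp a S x‖ ^ 2) ^ ((p - 5) / 2) * ‖tp a S x‖ ^ (5 : ℝ) := by
              rw [← Real.rpow_natCast, ← Real.rpow_mul (norm_nonneg _),
                ← Real.rpow_add_of_nonneg (norm_nonneg _) (by push_cast; linarith) (by norm_num)]
              congr 1; push_cast; ring
          _ ≤ _ := by
              gcongr
              exact (norm_tp_sq_le a S x).trans (by gcongr)
    _ = (N * mass a S) ^ ((p - 5) / 2) * avg (fun x => ‖tp a S x‖ ^ (5 : ℝ)) := avg_const_mul _ _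
    _ ≤ (N * mass a S) ^ ((p - 5) / 2) * (B * mass a S ^ (5 / 2 : ℝ)) := by gcongr
    _ = N ^ ((p - 5) / 2) * B * (mass a S ^ ((p - 5) / 2) * mass a S ^ (5 / 2 : ℝ)) := by
        rw [Real.mul_rpow hN0 hm]; ring
    _ = _ := by
        rw [← Real.rpow_add_of_nonneg hm (by linarith) (by norm_num)]
        congr 2; ring

/-- The moment bound for a shell. -/
lemma exists_shell_moment_le {φ ψ : Freq →+ V3} {K η C₀ p : ℝ} (hφ : IsFrame φ ψ K) (hK : 1 ≤ K)
    (hη : 0 < η) (hη1 : η ≤ 1) (hC₀ : 1 ≤ C₀) (hp : 2 ≤ p) :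
    ∃ C, 1 ≤ C ∧ ∀ (S : Finset Freq) (Λ δ : ℝ), 1 < Λ → 0 < δ → δ < 1 →
      (Λ ^ (1 / 2 : ℝ) ≤ Λ * δ ∨ (4 < p ∧ p ≤ 5 ∧ Λ ^ ((p - 4) / 2) ≤ Λ * δ)) →
      (∀ k ∈ S, |‖φ k‖ - Λ| < δ) → (S.card : ℝ) ≤ C₀ * Λ ^ η * (Λ * (Λ * δ)) → ∀ a : Freq → ℂ,
      avg (fun x => ‖tp a S x‖ ^ p) ≤ C * Λ ^ (η * (24 + p)) *
        ((Λ * δ) ^ (p / 2 - 1) + Λ ^ (p - 3) * δ ^ (p / 2)) * mass a S ^ (p / 2) := by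
  obtain ⟨C, hC, h⟩ := exists_shell_le hφ hK hη hη1 hC₀
  refine ⟨2 * C * C₀ ^ p, ?_, fun S Λ δ hΛ hδ hδ1 hD hS hcard a => ?_⟩
  · have := Real.one_le_rpow hC₀ (show 0 ≤ p by linarith)
    nlinarith
  have hΛ0 : 0 < Λ := by linarith
  have hm := mass_nonneg a S
  have hD1 : 1 ≤ Λ * δ := by
    rcases hD with hD | ⟨h4, _, hD⟩
    · exact (Real.one_le_rpow hΛ.le (by norm_num)).trans hD
    · exact (Real.one_le_rpow hΛ.le (by linarith)).trans hD
  have hDΛ : Λ * δ ≤ Λ := by nlinarith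
  have hC₀p : 1 ≤ C₀ ^ p := Real.one_le_rpow hC₀ (by linarith)
  have hL : 1 ≤ Λ ^ η := Real.one_le_rpow hΛ.le hη.le
  have hL24 : (Λ ^ η) ^ 24 ≤ Λ ^ (η * (24 + p)) := by
    rw [← Real.rpow_natCast, ← Real.rpow_mul hΛ0.le]
    exact Real.rpow_le_rpow_of_exponent_le hΛ.le (by push_cast; nlinarith)
  have hY : ∀ s : ℝ, Λ ^ (s / 2 - 1) * (Λ * δ) ^ (2 + s / 2) = Λ ^ (1 + s) * δ ^ (2 + s / 2) := by
    intro s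
    rw [Real.mul_rpow hΛ0.le hδ.le, ← mul_assoc, ← Real.rpow_add hΛ0]
    congr 2; ring
  have mid : ∀ s : ℝ, 0 ≤ s → s ≤ 1 → Λ ^ (s / 2) ≤ Λ * δ →
      avg (fun x => ‖tp a S x‖ ^ (4 + s)) ≤ C * (Λ ^ η) ^ 24 *
        ((Λ * δ) ^ (1 + s / 2) + Λ ^ (1 + s) * δ ^ (2 + s / 2)) * mass a S ^ ((4 + s) / 2) := by
    intro s h0 h1 hs
    rw [← hY]
    exact h S Λ δ hΛ hδ hδ1 hD1 hS hcard a s h0 h1 hs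
  rcases le_or_gt p 4 with hp4 | hp4
  · have h4 := mid 0 le_rfl zero_le_one (by simpa using hD1)
    have hB : avg (fun x => ‖tp a S x‖ ^ (4 : ℝ)) ≤
        (2 * C * (Λ ^ η) ^ 24 * (Λ * δ)) * mass a S ^ 2 := by
      norm_num at h4 ⊢
      refine h4.trans (mul_le_mul_of_nonneg_right ?_ (by positivity))
      calc C * (Λ ^ η) ^ 24 * (Λ * δ + Λ * δ ^ 2) ≤ C * (Λ ^ η) ^ 24 * (Λ * δ + Λ * δ) := by
            gcongr; nlinarith
        _ = _ := by ring
    have hM : 1 ≤ 2 * C * (Λ ^ η) ^ 24 := by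
      nlinarith [one_le_pow₀ hL (n := 24)]
    refine (avg_rpow_le_of_four a S hp hp4 (by nlinarith) hB).trans ?_
    gcongr
    calc (2 * C * (Λ ^ η) ^ 24 * (Λ * δ)) ^ (p / 2 - 1)
        = (2 * C * (Λ ^ η) ^ 24) ^ (p / 2 - 1) * (Λ * δ) ^ (p / 2 - 1) :=
          Real.mul_rpow (by positivity) (by positivity)
      _ ≤ (2 * C * (Λ ^ η) ^ 24) * (Λ * δ) ^ (p / 2 - 1) := by
          gcongr
          exact Real.rpow_le_self_of_one_le hM (by linarith)
      _ ≤ (2 * C * C₀ ^ p * Λ ^ (η * (24 + p))) *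
            ((Λ * δ) ^ (p / 2 - 1) + Λ ^ (p - 3) * δ ^ (p / 2)) := by
          have h1 : 2 * C * (Λ ^ η) ^ 24 ≤ 2 * C * C₀ ^ p * Λ ^ (η * (24 + p)) :=
            mul_le_mul (le_mul_of_one_le_right (by positivity) hC₀p) hL24 (by positivity)
              (by positivity)
          have h2 : 0 ≤ Λ ^ (p - 3) * δ ^ (p / 2) := by positivity
          exact mul_le_mul h1 (by linarith) (by positivity) (by positivity)
  rcases le_or_gt p 5 with hp5 | hp5
  · have hs : Λ ^ ((p - 4) / 2) ≤ Λ * δ := by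
      rcases hD with hD | ⟨_, _, hD⟩
      · exact (Real.rpow_le_rpow_of_exponent_le hΛ.le (by linarith)).trans hD
      · exact hD
    have := mid (p - 4) (by linarith) (by linarith) hs
    rw [show 4 + (p - 4) = p by ring, show 1 + (p - 4) / 2 = p / 2 - 1 by ring,
      show 1 + (p - 4) = p - 3 by ring, show 2 + (p - 4) / 2 = p / 2 by ring] at this
    refine this.trans ?_
    gcongr
    nlinarith
  · have hD : Λ ^ (1 / 2 : ℝ) ≤ Λ * δ := by
      rcases hD with hD | ⟨_, h5, _⟩
      · exact hD
      · linarith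
    have h5 := mid 1 zero_le_one le_rfl hD
    have hXY : (Λ * δ) ^ (1 + 1 / 2 : ℝ) ≤ Λ ^ (1 + 1 : ℝ) * δ ^ (2 + 1 / 2 : ℝ) := by
      have e : (Λ * δ) ^ (2 + 1 / 2 : ℝ) = Λ * δ * (Λ * δ) ^ (1 + 1 / 2 : ℝ) := by
        rw [← Real.rpow_one_add' (by positivity) (by norm_num)]; norm_num
      rw [← hY, e, ← mul_assoc]
      refine le_mul_of_one_le_left (by positivity) ?_
      calc (1 : ℝ) = Λ ^ (1 / 2 - 1 : ℝ) * Λ ^ (1 / 2 : ℝ) := by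
            rw [← Real.rpow_add hΛ0]; norm_num
        _ ≤ _ := by gcongr
    have hB : avg (fun x => ‖tp a S x‖ ^ (5 : ℝ)) ≤
        (2 * C * (Λ ^ η) ^ 24 * (Λ ^ (2 : ℝ) * δ ^ (5 / 2 : ℝ))) * mass a S ^ (5 / 2 : ℝ) := by
      rw [show (1 + 1 : ℝ) = 2 by norm_num, show (2 + 1 / 2 : ℝ) = 5 / 2 by norm_num] at hXY h5
      rw [show (4 + 1 : ℝ) = 5 by norm_num] at h5
      refine h5.trans (mul_le_mul_of_nonneg_right ?_ (by positivity))
      calc _ ≤ C * (Λ ^ η) ^ 24 * (Λ ^ (2 : ℝ) * δ ^ (5 / 2 : ℝ) +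
              Λ ^ (2 : ℝ) * δ ^ (5 / 2 : ℝ)) := by gcongr
        _ = _ := by ring
    refine (avg_rpow_le_of_five a S hp5.le hcard hB).trans (mul_le_mul_of_nonneg_right ?_ (by positivity))
    have e1 : (C₀ * Λ ^ η * (Λ * (Λ * δ))) ^ ((p - 5) / 2) =
        C₀ ^ ((p - 5) / 2) * Λ ^ (η * ((p - 5) / 2)) * (Λ ^ (p - 5) * δ ^ ((p - 5) / 2)) := by
      rw [show Λ * (Λ * δ) = Λ ^ (2 : ℝ) * δ by rw [Real.rpow_two]; ring,
        Real.mul_rpow (by positivity) (by positivity), Real.mul_rpow (by positivity) (by positivity),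
        Real.mul_rpow (by positivity) (by positivity), ← Real.rpow_mul hΛ0.le,
        ← Real.rpow_mul hΛ0.le, show 2 * ((p - 5) / 2) = p - 5 by ring]
    have e2 : Λ ^ (p - 5) * δ ^ ((p - 5) / 2) * (Λ ^ (2 : ℝ) * δ ^ (5 / 2 : ℝ)) =
        Λ ^ (p - 3) * δ ^ (p / 2) := by
      rw [mul_mul_mul_comm, ← Real.rpow_add hΛ0, ← Real.rpow_add hδ]
      congr 2 <;> ring
    calc (C₀ * Λ ^ η * (Λ * (Λ * δ))) ^ ((p - 5) / 2) *
          (2 * C * (Λ ^ η) ^ 24 * (Λ ^ (2 : ℝ) * δ ^ (5 / 2 : ℝ)))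
        = 2 * C * C₀ ^ ((p - 5) / 2) * (Λ ^ (η * 24) * Λ ^ (η * ((p - 5) / 2))) *
            (Λ ^ (p - 3) * δ ^ (p / 2)) := by
          rw [e1, ← e2, ← Real.rpow_natCast, ← Real.rpow_mul hΛ0.le]; push_cast; ring
      _ = 2 * C * C₀ ^ ((p - 5) / 2) * Λ ^ (η * (24 + (p - 5) / 2)) *
            (Λ ^ (p - 3) * δ ^ (p / 2)) := by
          rw [← Real.rpow_add hΛ0, ← mul_add]
      _ ≤ 2 * C * C₀ ^ p * Λ ^ (η * (24 + p)) *
            ((Λ * δ) ^ (p / 2 - 1) + Λ ^ (p - 3) * δ ^ (p / 2)) := by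
          have : 0 ≤ (Λ * δ) ^ (p / 2 - 1) := by positivity
          gcongr <;> linarith

lemma lpNorm_eq_avg (p : ℝ) (a : Freq →₀ ℂ) :
    lpNorm p a = avg (fun x => ‖tp a a.support x‖ ^ p) ^ (1 / p) := rfl

lemma l2Norm_eq_mass (a : Freq →₀ ℂ) : l2Norm a = mass a a.support ^ (1 / 2 : ℝ) := rfl

lemma finite_shell {φ ψ : Freq →+ V3} {K : ℝ} (hφ : IsFrame φ ψ K) (hK : 1 ≤ K) (Λ δ : ℝ) :
    {k : Freq | |‖φ k‖ - Λ| < δ}.Finite := by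
  refine (Set.Finite.pi' (t := fun _ : Fin 3 => Set.Icc (-⌈K * (Λ + δ)⌉) ⌈K * (Λ + δ)⌉)
    fun _ => Set.finite_Icc _ _).subset fun k hk i => ?_
  have h1 := hφ.abs_le k i
  have h2 : ‖φ k‖ ≤ Λ + δ := by
    have := (abs_lt.mp (show |‖φ k‖ - Λ| < δ from hk)).2
    linarith
  have h3 : |(k i : ℝ)| ≤ (⌈K * (Λ + δ)⌉ : ℤ) :=
    h1.trans ((mul_le_mul_of_nonneg_left h2 (by linarith)).trans (Int.le_ceil _))
  exact abs_le.mp (by exact_mod_cast h3)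

/-- Taking roots in the moment bound. -/
lemma lpNorm_le_of_moment {p ε η C Λ δ : ℝ} {a : Freq →₀ ℂ} (hp : 2 ≤ p) (hC : 1 ≤ C)
    (hΛ : 1 < Λ) (hδ : 0 < δ) (hη0 : 0 < η) (hη : η ≤ ε / 13)
    (h : avg (fun x => ‖tp a a.support x‖ ^ p) ≤ C * Λ ^ (η * (24 + p)) *
      ((Λ * δ) ^ (p / 2 - 1) + Λ ^ (p - 3) * δ ^ (p / 2)) * mass a a.support ^ (p / 2)) :
    lpNorm p a ≤ C * Λ ^ ε *
      ((Λ * δ) ^ (1 / 2 - 1 / p) + Λ ^ (1 - 3 / p) * δ ^ ((1:ℝ) / 2)) * l2Norm a := by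
  have hp0 : 0 < p := by linarith
  have hΛ0 : 0 < Λ := by linarith
  have hm := mass_nonneg a a.support
  have hp1 : 1 / p ≤ 1 := by rw [div_le_one hp0]; linarith
  rw [lpNorm_eq_avg, l2Norm_eq_mass]
  refine (Real.rpow_le_rpow (avg_nonneg fun x => by positivity) h (by positivity)).trans ?_
  rw [Real.mul_rpow (by positivity) (by positivity), Real.mul_rpow (by positivity) (by positivity),
    Real.mul_rpow (by positivity) (by positivity), ← Real.rpow_mul hm,
    show p / 2 * (1 / p) = 1 / 2 by field_simp]
  gcongr
  · exact Real.rpow_le_self_of_one_le hC hp1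
  · rw [← Real.rpow_mul hΛ0.le]
    refine Real.rpow_le_rpow_of_exponent_le hΛ.le ?_
    rw [mul_one_div, div_le_iff₀ hp0]
    nlinarith
  · refine (Real.rpow_add_le_add_rpow (by positivity) (by positivity) (by positivity) hp1).trans
      (le_of_eq ?_)
    rw [← Real.rpow_mul (by positivity),
      Real.mul_rpow (x := Λ ^ (p - 3)) (by positivity) (by positivity),
      ← Real.rpow_mul hΛ0.le, ← Real.rpow_mul hδ.le,
      show (p / 2 - 1) * (1 / p) = 1 / 2 - 1 / p by field_simp,
      show (p - 3) * (1 / p) = 1 - 3 / p by field_simp,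
      show p / 2 * (1 / p) = 1 / 2 by field_simp]

end

theorem statement2 (A : Matrix (Fin 3) (Fin 3) ℝ) (hA : A.IsSymm) (hApd : A.PosDef)
    (hcount : ∀ ε : ℝ, 0 < ε → ∃ Cε : ℝ, 0 < Cε ∧
      ∀ lam δ : ℝ, 1 < lam → lam⁻¹ < δ → δ < 1 →
        (({x : Fin 3 → ℤ |
            |Real.sqrt (Qform A fun i => (x i : ℝ)) - lam| < δ}).ncard : ℝ)
          ≤ Cε * lam ^ (2 + ε) * δ)
    (p ε : ℝ) (hp2 : 2 ≤ p) (hε : 0 < ε) :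
    ∃ C : ℝ, 0 < C ∧
      ∀ lam δ : ℝ, 1 < lam → 0 < δ → δ < 1 →
        (lam ^ (-(1 / 2 : ℝ)) < δ ∨
          (4 < p ∧ p ≤ 5 ∧
            max (lam ^ ((p - 6) / 2)) (lam ^ ((27 * p - 316) / (104 * (p - 2)))) < δ)) →
        ∀ a : (Fin 3 → ℤ) →₀ ℂ,
          (∀ k ∈ a.support, |Real.sqrt (Qform A fun i => (k i : ℝ)) - lam| < δ) →
          lpNorm p a ≤
            C * lam ^ ε *
              ((lam * δ) ^ (1 / 2 - 1 / p) + lam ^ (1 - 3 / p) * δ ^ ((1:ℝ) / 2)) * l2Norm a := by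
  obtain ⟨φ, ψ, K, hK, hφ, hQ⟩ := exists_frame_of_posDef hApd
  have hsqrt : ∀ k : Freq, Real.sqrt (Qform A fun i => (k i : ℝ)) = ‖φ k‖ := fun k => by
    rw [Qform, ← hQ, Real.sqrt_sq (norm_nonneg _)]
  simp only [hsqrt] at hcount ⊢
  have hp0 : 0 < p := by linarith
  have hη : 0 < min 1 (ε / 13) := by positivity
  obtain ⟨C₀, hC₀, hc⟩ := hcount _ hη
  obtain ⟨C, hC, h⟩ := exists_shell_moment_le hφ hK hη (min_le_left _ _) (le_max_left 1 C₀) hp2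
  refine ⟨C, by linarith, fun lam δ hl hδ hδ1 hrange a ha => ?_⟩
  have hl0 : 0 < lam := by linarith
  have hD : lam ^ (1 / 2 : ℝ) ≤ lam * δ ∨ (4 < p ∧ p ≤ 5 ∧ lam ^ ((p - 4) / 2) ≤ lam * δ) := by
    refine hrange.imp (fun h => ?_) fun h => ⟨h.1, h.2.1, ?_⟩
    · calc lam ^ (1 / 2 : ℝ) = lam * lam ^ (-(1 / 2) : ℝ) := by
            rw [← Real.rpow_one_add' hl0.le (by norm_num)]; norm_num
        _ ≤ _ := by gcongr
    · calc lam ^ ((p - 4) / 2) = lam * lam ^ ((p - 6) / 2) := by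
            rw [← Real.rpow_one_add' hl0.le (by linarith)]; congr 1; ring
        _ ≤ _ := by gcongr; exact (le_max_left _ _).trans h.2.2.le
  have hD1 : 1 < lam * δ := by
    rcases hD with hD | ⟨h4, _, hD⟩
    · exact (Real.one_lt_rpow hl (by norm_num)).trans_le hD
    · exact (Real.one_lt_rpow hl (by linarith)).trans_le hD
  have hcard : (a.support.card : ℝ) ≤
      max 1 C₀ * lam ^ min 1 (ε / 13) * (lam * (lam * δ)) := by
    refine (Nat.cast_le.mpr ?_).trans
      ((hc lam δ hl ((inv_lt_iff_one_lt_mul₀' hl0).mpr hD1) hδ1).trans ?_)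
    · rw [← Set.ncard_coe_finset]
      exact Set.ncard_le_ncard (fun k hk => ha k hk) (finite_shell hφ hK lam δ)
    · rw [Real.rpow_add hl0, Real.rpow_two]
      calc C₀ * (lam ^ 2 * lam ^ (min 1 (ε / 13))) * δ
          = C₀ * lam ^ (min 1 (ε / 13)) * (lam * (lam * δ)) := by ring
        _ ≤ _ := by gcongr; exact le_max_right _ _
  exact lpNorm_le_of_moment hp2 hC hl hδ hη (min_le_right _ _)
    (h a.support lam δ hl hδ hδ1 hD ha hcard a)
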